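/- Let 𝒜 be a central complex hyperplane arrangement of rank r containing hyperplanes H₁,…,H_{2r−1} such that H₁,…,H_r are independent and, for each j = 1,…,r, the set {H_j, H_{r+1},…,H_{2r−1}} is independent. Then TC(M(𝒜)) = 2r. -/

import Mathlib

/-- The space of continuous paths `[0,1] → X`, with the compact-open topology. -/
abbrev PathSpace (X : Type*) [TopologicalSpace X] := C(unitInterval, X)

/-- `U ⊆ X × X` admits a continuous section of the path fibration
`π : PX → X × X`, `π(γ) = (γ 0, γ 1)`. -/
def HasMotionPlanningSection (X : Type*) [TopologicalSpace X] (U : Set (X × X)) : Prop :=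
  ∃ s : C(U, PathSpace X), ∀ p : U, s p 0 = (p : X × X).1 ∧ s p 1 = (p : X × X).2

/-- `X × X` can be covered by `k` open sets, over each of which the path
fibration admits a continuous section. -/
def HasTCCover (X : Type*) [TopologicalSpace X] (k : ℕ) : Prop :=
  ∃ U : Fin k → Set (X × X), (∀ i, IsOpen (U i)) ∧ (⋃ i, U i) = Set.univ ∧
    ∀ i, HasMotionPlanningSection X (U i)

/-- The topological complexity of `X` (in the unnormalized convention of Farber,
so that `TopComplexity(point) = 1`), as an extended natural number. -/
noncomputable def TopComplexity (X : Type*) [TopologicalSpace X] : ℕ∞ :=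
  sInf {N : ℕ∞ | ∃ k : ℕ, N = k ∧ HasTCCover X k}


/-- `H` is a (linear) hyperplane in `ℂ^ℓ`: the kernel of a nonzero linear functional. -/
def IsHyperplane {ℓ : ℕ} (H : Submodule ℂ (Fin ℓ → ℂ)) : Prop :=
  ∃ α : (Fin ℓ → ℂ) →ₗ[ℂ] ℂ, α ≠ 0 ∧ H = LinearMap.ker α

/-- The complement `M(𝒜) = ℂ^ℓ - ⋃_{H ∈ 𝒜} H` of a (central) arrangement `𝒜`. -/
abbrev ArrComplement {ℓ : ℕ} (𝒜 : Finset (Submodule ℂ (Fin ℓ → ℂ))) :=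
  {x : Fin ℓ → ℂ // ∀ H ∈ 𝒜, x ∉ H}

section Miranda

/-- Move one step in direction `i` in the grid. -/
def gridStep (i : ℕ) (v : ℕ → ℕ) : ℕ → ℕ := Function.update v i (v i + 1)

theorem gridStep_comm (i j : ℕ) (v : ℕ → ℕ) :
    gridStep i (gridStep j v) = gridStep j (gridStep i v) := by
  unfold gridStep
  rcases eq_or_ne i j with rfl | h
  · rfl
  · rw [Function.update_of_ne h, Function.update_of_ne h.symm, Function.update_comm h]

/-- Iterated cubical cup product of the coboundaries of the functions `a m`, modulo two. -/
def gridCup (a : ℕ → (ℕ → ℕ) → ZMod 2) : ℕ → Finset ℕ → (ℕ → ℕ) → ZMod 2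
  | 0, S, _ => if S = ∅ then 1 else 0
  | m + 1, S, v => ∑ i ∈ S, (a m (gridStep i v) + a m v) * gridCup a m (S.erase i) (gridStep i v)

theorem sum_erase_symm_eq_zero (f : ℕ → ℕ → ZMod 2) (hf : ∀ i j, f i j = f j i) (S : Finset ℕ) :
    ∑ i ∈ S, ∑ j ∈ S.erase i, f i j = 0 := by
  induction S using Finset.induction_on with
  | empty => simp
  | insert x S hx ih =>
    rw [Finset.sum_insert hx, Finset.erase_insert hx]
    have h1 : ∑ i ∈ S, ∑ j ∈ (insert x S).erase i, f i j
        = ∑ i ∈ S, (f i x + ∑ j ∈ S.erase i, f i j) := by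
      refine Finset.sum_congr rfl fun i hi => ?_
      have hne : x ≠ i := fun h => hx (h ▸ hi)
      rw [Finset.erase_insert_of_ne hne, Finset.sum_insert]
      simp [hx]
    rw [h1, Finset.sum_add_distrib, ih, add_zero, ← Finset.sum_add_distrib]
    refine Finset.sum_eq_zero fun i _ => ?_
    rw [hf x i]; exact CharTwo.add_self_eq_zero _

/-- The cubical coboundary modulo two. -/
def gridD (g : Finset ℕ → (ℕ → ℕ) → ZMod 2) (S : Finset ℕ) (v : ℕ → ℕ) : ZMod 2 :=
  ∑ i ∈ S, (g (S.erase i) (gridStep i v) + g (S.erase i) v)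

theorem gridD_gridD (g : Finset ℕ → (ℕ → ℕ) → ZMod 2) (S : Finset ℕ) (v : ℕ → ℕ) :
    gridD (gridD g) S v = 0 := by
  unfold gridD
  simp_rw [← Finset.sum_add_distrib]
  refine sum_erase_symm_eq_zero (fun i j => _) (fun i j => ?_) S
  rw [gridStep_comm i j, Finset.erase_right_comm]
  ring

theorem gridCup_succ_eq_gridD (a : ℕ → (ℕ → ℕ) → ZMod 2) (m : ℕ)
    (h : ∀ S v, gridD (gridCup a m) S v = 0) (S : Finset ℕ) (v : ℕ → ℕ) :
    gridCup a (m + 1) S v = gridD (fun T w => a m w * gridCup a m T w) S v := by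
  have h1 : gridCup a (m + 1) S v
      = gridD (fun T w => a m w * gridCup a m T w) S v + a m v * gridD (gridCup a m) S v := by
    unfold gridD
    rw [gridCup, Finset.mul_sum, ← Finset.sum_add_distrib]
    refine Finset.sum_congr rfl fun i _ => ?_
    have := CharTwo.add_self_eq_zero (a m v * gridCup a m (S.erase i) v)
    linear_combination -this
  rw [h1, h, mul_zero, add_zero]

theorem gridD_gridCup (a : ℕ → (ℕ → ℕ) → ZMod 2) (m : ℕ) (S : Finset ℕ) (v : ℕ → ℕ) :
    gridD (gridCup a m) S v = 0 := by
  induction m generalizing S v with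
  | zero =>
    unfold gridD
    refine Finset.sum_eq_zero fun i _ => ?_
    simp only [gridCup]
    exact CharTwo.add_self_eq_zero _
  | succ m ih =>
    have : gridCup a (m + 1) = gridD (fun T w => a m w * gridCup a m T w) := by
      funext S v; exact gridCup_succ_eq_gridD a m ih S v
    rw [this]; exact gridD_gridD _ _ _

theorem gridCup_eq_zero (a : ℕ → (ℕ → ℕ) → ZMod 2) (m i c : ℕ) (z : ZMod 2) (him : i < m)
    (hc : ∀ v, v i = c → a i v = z) (T : Finset ℕ) (hT : i ∉ T) (v : ℕ → ℕ) (hv : v i = c) :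
    gridCup a m T v = 0 := by
  induction m generalizing T v with
  | zero => omega
  | succ m ih =>
    rw [gridCup]
    refine Finset.sum_eq_zero fun j hj => ?_
    have hij : i ≠ j := fun h => hT (h ▸ hj)
    have hv' : gridStep j v i = c := by rw [gridStep, Function.update_of_ne hij, hv]
    rcases Nat.lt_succ_iff_lt_or_eq.1 him with h | rfl
    · rw [ih h _ (fun h => hT (Finset.mem_of_mem_erase h)) _ hv', mul_zero]
    · rw [hc _ hv, hc _ hv', CharTwo.add_self_eq_zero, zero_mul]

/-- Sum over the grid cube of dimension `m` and side `N`, the other coordinates being `N`. -/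
def gridSum (N : ℕ) : ℕ → ((ℕ → ℕ) → ZMod 2) → ZMod 2
  | 0, f => f (fun _ => N)
  | m + 1, f => gridSum N m (fun v => ∑ t ∈ Finset.range N, f (Function.update v m t))

theorem gridSum_add (N m : ℕ) (f g : (ℕ → ℕ) → ZMod 2) :
    gridSum N m (fun v => f v + g v) = gridSum N m f + gridSum N m g := by
  induction m generalizing f g with
  | zero => rfl
  | succ m ih => simp only [gridSum, Finset.sum_add_distrib, ih]

theorem gridSum_sum (N m : ℕ) (S : Finset ℕ) (f : ℕ → (ℕ → ℕ) → ZMod 2) :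
    gridSum N m (fun v => ∑ i ∈ S, f i v) = ∑ i ∈ S, gridSum N m (f i) := by
  induction S using Finset.induction_on with
  | empty =>
    simp only [Finset.sum_empty]
    have := gridSum_add N m (fun _ => 0) (fun _ => 0)
    simpa using this
  | insert x S hx ih => simp only [Finset.sum_insert hx, gridSum_add, ih]

theorem gridSum_exists (N m : ℕ) (f : (ℕ → ℕ) → ZMod 2) (h : gridSum N m f ≠ 0) :
    ∃ v, (∀ i, v i ≤ N) ∧ f v ≠ 0 := by
  induction m generalizing f with
  | zero => exact ⟨_, fun _ => le_rfl, h⟩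
  | succ m ih =>
    obtain ⟨v, hv, h1⟩ := ih _ h
    obtain ⟨t, ht, h2⟩ := Finset.exists_ne_zero_of_sum_ne_zero h1
    refine ⟨_, fun i => ?_, h2⟩
    rcases eq_or_ne i m with rfl | hi
    · simpa using (Finset.mem_range.1 ht).le
    · rw [Function.update_of_ne hi]; exact hv i

theorem gridSum_congr_last (N m : ℕ) (f g : (ℕ → ℕ) → ZMod 2)
    (h : ∀ v, (∀ i, m ≤ i → v i = N) → f v = g v) : gridSum N m f = gridSum N m g := by
  induction m generalizing f g with
  | zero => exact h _ fun _ _ => rfl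
  | succ m ih =>
    refine ih _ _ fun v hv => Finset.sum_congr rfl fun t _ => h _ fun i hi => ?_
    rw [Function.update_of_ne (by omega)]; exact hv i (by omega)

theorem sum_range_step (f : ℕ → ZMod 2) (N : ℕ) :
    ∑ t ∈ Finset.range N, (f (t + 1) + f t) = f N + f 0 := by
  induction N with
  | zero => simp [CharTwo.add_self_eq_zero]
  | succ N ih =>
    rw [Finset.sum_range_succ, ih]
    linear_combination CharTwo.add_self_eq_zero (f N)

theorem gridSum_step_last (N i : ℕ) (g : (ℕ → ℕ) → ZMod 2) :
    gridSum N (i + 1) (fun v => g (gridStep i v) + g v)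
      = gridSum N i (fun v => g (Function.update v i N) + g (Function.update v i 0)) := by
  simp only [gridSum]
  congr 1
  funext v
  rw [← sum_range_step (fun t => g (Function.update v i t))]
  simp [gridStep]

theorem gridSum_step_eq_zero (N i m : ℕ) (him : i < m) (g : (ℕ → ℕ) → ZMod 2)
    (h0 : ∀ v, v i = 0 → g v = 0) (h1 : ∀ v, v i = N → g v = 0) :
    gridSum N m (fun v => g (gridStep i v) + g v) = 0 := by
  induction m generalizing g with
  | zero => omega
  | succ m ih =>
    rcases Nat.lt_succ_iff_lt_or_eq.1 him with h | rfl
    · have key := ih h (fun v => ∑ t ∈ Finset.range N, g (Function.update v m t))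
        (fun v hv => Finset.sum_eq_zero fun t _ => h0 _ (by
          rw [Function.update_of_ne h.ne]; exact hv))
        (fun v hv => Finset.sum_eq_zero fun t _ => h1 _ (by
          rw [Function.update_of_ne h.ne]; exact hv))
      rw [← key]
      simp only [gridSum, ← Finset.sum_add_distrib]
      congr 1
      funext v
      refine Finset.sum_congr rfl fun t _ => ?_
      congr 2
      unfold gridStep
      rw [Function.update_of_ne h.ne, Function.update_comm h.ne]
    · rw [gridSum_step_last]
      have : (fun v : ℕ → ℕ => g (Function.update v i N) + g (Function.update v i 0))
          = fun v => ∑ j ∈ (∅ : Finset ℕ), (0 : ZMod 2) := by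
        funext v
        rw [h1 (Function.update v i N) (by simp), h0 (Function.update v i 0) (by simp)]
        simp
      rw [this, gridSum_sum]; simp

theorem gridSum_gridCup (a : ℕ → (ℕ → ℕ) → ZMod 2) (N m : ℕ)
    (h0 : ∀ i < m, ∀ v, v i = 0 → a i v = 0) (h1 : ∀ i < m, ∀ v, v i = N → a i v = 1) :
    gridSum N m (gridCup a m (Finset.range m)) = 1 := by
  induction m with
  | zero => simp [gridSum, gridCup]
  | succ m ih =>
    have e : gridCup a (m + 1) (Finset.range (m + 1))
        = fun v => ∑ i ∈ Finset.range (m + 1),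
          (a m (gridStep i v) * gridCup a m ((Finset.range (m + 1)).erase i) (gridStep i v) +
            a m v * gridCup a m ((Finset.range (m + 1)).erase i) v) := by
      funext v
      exact gridCup_succ_eq_gridD a m (gridD_gridCup a m) _ v
    rw [e, gridSum_sum, Finset.sum_range_succ, Finset.sum_eq_zero, zero_add]
    · have e2 : (Finset.range (m + 1)).erase m = Finset.range m := by
        rw [Finset.range_add_one, Finset.erase_insert (by simp)]
      rw [e2, gridSum_step_last N m (fun v => a m v * gridCup a m (Finset.range m) v),
        ← ih (fun i hi => h0 i (by omega)) (fun i hi => h1 i (by omega))]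
      refine gridSum_congr_last N m _ _ fun v hv => ?_
      rw [h1 m (by omega) _ (by simp), h0 m (by omega) (Function.update v m 0) (by simp), one_mul,
        zero_mul, add_zero]
      congr 1
      rw [← hv m le_rfl, Function.update_eq_self]
    · intro i hi
      have him := Finset.mem_range.1 hi
      refine gridSum_step_eq_zero N i (m + 1) (by omega)
        (fun v => a m v * gridCup a m ((Finset.range (m + 1)).erase i) v) ?_ ?_
      · intro v hv
        rw [gridCup_eq_zero a m i 0 0 him (fun v hv => h0 i (by omega) v hv) _ (by simp) v hv,
          mul_zero]
      · intro v hv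
        rw [gridCup_eq_zero a m i N 1 him (fun v hv => h1 i (by omega) v hv) _ (by simp) v hv,
          mul_zero]

theorem exists_of_gridCup_ne_zero (a : ℕ → (ℕ → ℕ) → ZMod 2) (m : ℕ) (S : Finset ℕ)
    (v : ℕ → ℕ) (h : gridCup a m S v ≠ 0) (i : ℕ) (hi : i < m) :
    ∃ w w', a i w ≠ a i w' ∧ (∀ j, v j ≤ w j ∧ w j ≤ v j + 1 ∧ v j ≤ w' j ∧ w' j ≤ v j + 1) := by
  have main : ∃ w w', a i w ≠ a i w' ∧ (∀ j, v j ≤ w j ∧ v j ≤ w' j ∧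
      (j ∈ S → w j ≤ v j + 1 ∧ w' j ≤ v j + 1) ∧ (j ∉ S → w j = v j ∧ w' j = v j)) := by
    induction m generalizing S v with
    | zero => omega
    | succ m ih =>
      rw [gridCup] at h
      obtain ⟨k, hk, h2⟩ := Finset.exists_ne_zero_of_sum_ne_zero h
      have hstep : ∀ j, gridStep k v j = if j = k then v j + 1 else v j := by
        intro j
        unfold gridStep
        by_cases hj : j = k
        · subst hj; simp
        · simp [hj]
      rcases Nat.lt_succ_iff_lt_or_eq.1 hi with hlt | rfl
      · obtain ⟨w, w', h3, h4⟩ := ih _ _ (right_ne_zero_of_mul h2) hlt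
        refine ⟨w, w', h3, fun j => ?_⟩
        have := h4 j
        rw [hstep] at this
        by_cases hj : j = k
        · subst hj
          simp only [Finset.mem_erase, ne_eq, not_true_eq_false, false_and, not_false_eq_true,
            if_true, forall_const] at this
          refine ⟨by omega, by omega, fun _ => by omega, fun h => absurd hk h⟩
        · simpa [hj] using this
      · refine ⟨gridStep k v, v, fun h5 => left_ne_zero_of_mul h2 ?_, fun j => ?_⟩
        · rw [h5]; exact CharTwo.add_self_eq_zero _
        · rw [hstep]
          by_cases hj : j = k
          · subst hj; simp [hk]
          · simp [hj]
  obtain ⟨w, w', h1, h2⟩ := main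
  refine ⟨w, w', h1, fun j => ?_⟩
  have := h2 j
  by_cases hj : j ∈ S
  · have := this.2.2.1 hj; omega
  · have := this.2.2.2 hj; omega

/-- Poincaré–Miranda theorem on a cube `[0, L]^k`. -/
theorem poincare_miranda (k : ℕ) (L : ℝ) (hL : 0 < L) (φ : Fin k → (Fin k → ℝ) → ℝ)
    (hφ : ∀ i, Continuous (φ i))
    (h0 : ∀ i x, (∀ j, x j ∈ Set.Icc 0 L) → x i = 0 → φ i x < 0)
    (h1 : ∀ i x, (∀ j, x j ∈ Set.Icc 0 L) → x i = L → 0 < φ i x) :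
    ∃ x, (∀ j, x j ∈ Set.Icc 0 L) ∧ ∀ i, φ i x = 0 := by
  classical
  set Q : Set (Fin k → ℝ) := Set.pi Set.univ fun _ => Set.Icc (0 : ℝ) L with hQ
  have hQc : IsCompact Q := isCompact_univ_pi fun _ => isCompact_Icc
  have hQm : ∀ x, x ∈ Q ↔ ∀ j, x j ∈ Set.Icc 0 L := by intro x; simp only [hQ, Set.mem_univ_pi]
  -- approximate zeros
  have approx : ∀ n : ℕ, ∃ x ∈ Q, ∀ i, ∃ y ∈ Q, ∃ y' ∈ Q, dist x y ≤ L / (n + 1) ∧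
      dist x y' ≤ L / (n + 1) ∧ φ i y ≤ 0 ∧ 0 ≤ φ i y' := by
    intro n
    set N := n + 1 with hN
    let pt : (ℕ → ℕ) → Fin k → ℝ := fun v j => L * (min (v j) N : ℕ) / N
    have hNpos : (0 : ℝ) < N := by positivity
    have hpt : ∀ v, pt v ∈ Q := by
      intro v
      rw [hQm]
      intro j
      constructor
      · positivity
      · rw [div_le_iff₀ hNpos]
        have : ((min (v j) N : ℕ) : ℝ) ≤ N := by exact_mod_cast min_le_right _ _
        nlinarith
    let a : ℕ → (ℕ → ℕ) → ZMod 2 := fun m v =>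
      if h : m < k then (if 0 < φ ⟨m, h⟩ (pt v) then 1 else 0) else 0
    have key := gridSum_gridCup a N k (fun i hi v hv => by
        have : φ ⟨i, hi⟩ (pt v) < 0 := h0 _ _ ((hQm _).1 (hpt v)) (by simp [pt, hv])
        simp [a, hi, this.le]) (fun i hi v hv => by
        have : 0 < φ ⟨i, hi⟩ (pt v) := h1 _ _ ((hQm _).1 (hpt v)) (by
          simp [pt, hv])
        simp [a, hi, this])
    obtain ⟨v, -, hv⟩ := gridSum_exists N k _ (by rw [key]; exact one_ne_zero)
    have hd : ∀ w : ℕ → ℕ, (∀ j, v j ≤ w j ∧ w j ≤ v j + 1) →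
        dist (pt v) (pt w) ≤ L / ((n : ℝ) + 1) := by
      intro w hw
      rw [dist_pi_le_iff (by positivity)]
      intro j
      have e : ((n : ℝ) + 1) = N := by simp [hN]
      rw [e, Real.dist_eq]
      simp only [pt]
      rw [← sub_div, ← mul_sub, abs_div, abs_mul, abs_of_pos hL, abs_of_pos hNpos]
      gcongr
      have h3 : |((min (v j) N : ℕ) : ℝ) - ((min (w j) N : ℕ) : ℝ)| ≤ 1 := by
        have := hw j
        have a1 : min (v j) N ≤ min (w j) N := by omega
        have a2 : min (w j) N ≤ min (v j) N + 1 := by omega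
        have b1 : ((min (v j) N : ℕ) : ℝ) ≤ ((min (w j) N : ℕ) : ℝ) := by exact_mod_cast a1
        have b2 : ((min (w j) N : ℕ) : ℝ) ≤ ((min (v j) N : ℕ) : ℝ) + 1 := by exact_mod_cast a2
        rw [abs_le]; constructor <;> linarith
      nlinarith
    refine ⟨pt v, hpt v, fun i => ?_⟩
    obtain ⟨w, w', h3, h4⟩ := exists_of_gridCup_ne_zero a k _ v hv i i.2
    have d1 := hd w fun j => ⟨(h4 j).1, (h4 j).2.1⟩
    have d2 := hd w' fun j => (h4 j).2.2
    simp only [a, i.2, dif_pos, Fin.eta] at h3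
    by_cases p1 : 0 < φ i (pt w)
    · by_cases p2 : 0 < φ i (pt w')
      · simp [p1, p2] at h3
      · exact ⟨_, hpt w', _, hpt w, d2, d1, not_lt.1 p2, p1.le⟩
    · by_cases p2 : 0 < φ i (pt w')
      · exact ⟨_, hpt w, _, hpt w', d1, d2, not_lt.1 p1, p2.le⟩
      · simp [p1, p2] at h3
  choose x hxQ hx using approx
  obtain ⟨z, hz, ψ, hψ, hlim⟩ := hQc.tendsto_subseq hxQ
  refine ⟨z, (hQm z).1 hz, fun i => ?_⟩
  choose y hy y' hy' hd hd' hle hge using fun n => hx n i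
  have hsmall : Filter.Tendsto (fun n : ℕ => L / ((ψ n : ℝ) + 1)) Filter.atTop (nhds 0) := by
    have : Filter.Tendsto (fun n : ℕ => L / ((n : ℝ) + 1)) Filter.atTop (nhds 0) :=
      by
      simpa using tendsto_one_div_add_atTop_nhds_zero_nat.const_mul L |>.congr fun n => by ring
    exact this.comp hψ.tendsto_atTop
  have hc : ∀ w : ℕ → Fin k → ℝ, (∀ n, dist (x n) (w n) ≤ L / ((n : ℝ) + 1)) →
      Filter.Tendsto (fun n => φ i (w (ψ n))) Filter.atTop (nhds (φ i z)) := by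
    intro w hw
    refine ((hφ i).tendsto z).comp ?_
    refine (tendsto_iff_of_dist ?_).1 hlim
    exact squeeze_zero (fun _ => dist_nonneg) (fun n => hw (ψ n)) hsmall
  exact le_antisymm (le_of_tendsto' (hc y hd) fun n => hle _)
    (ge_of_tendsto' (hc y' hd') fun n => hge _)

end Miranda

section TorusCover

/-- `k` open subsets of the torus over each of which the corresponding coordinate has a
continuous logarithm cannot cover the `k`-dimensional torus. -/
theorem torus_not_covered (k : ℕ) (U : Fin k → Set (Fin k → ℝ)) (hU : ∀ j, IsOpen (U j))
    (hcov : ∀ t, ∃ j, t ∈ U j)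
    (hinv : ∀ j t (n : Fin k → ℤ), t ∈ U j → (fun i => t i + n i) ∈ U j)
    (m : Fin k → (Fin k → ℝ) → ℤ)
    (hm : ∀ j, ∀ t ∈ U j, ∀ᶠ s in nhds t, m j s = m j t)
    (hshift : ∀ j, ∀ t ∈ U j, ∀ n : Fin k → ℤ, m j (fun i => t i + n i) = m j t + n j) : False := by
  classical
  set Q : Set (Fin k → ℝ) := Set.pi Set.univ fun _ => Set.Icc (0 : ℝ) 1 with hQ
  have hQc : IsCompact Q := isCompact_univ_pi fun _ => isCompact_Icc
  obtain ⟨δ, hδ, hleb⟩ := lebesgue_number_lemma_of_metric hQc hU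
    (fun t _ => Set.mem_iUnion.2 (hcov t))
  have hfl : ∀ t : Fin k → ℝ, (fun i => t i + ((-⌊t i⌋ : ℤ) : ℝ)) ∈ Q := by
    intro t i _
    have h1 := Int.floor_le (t i)
    have h2 := Int.lt_floor_add_one (t i)
    constructor <;> push_cast <;> linarith
  -- closed shrinking
  set K : Fin k → Set (Fin k → ℝ) := fun j => {t | Metric.ball t δ ⊆ U j} with hK
  have hKinv : ∀ j t (n : Fin k → ℤ), t ∈ K j → (fun i => t i + n i) ∈ K j := by
    intro j t n ht s hs
    have h1 : (fun i => s i + ((-n i : ℤ) : ℝ)) ∈ Metric.ball t δ := by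
      rw [Metric.mem_ball] at hs ⊢
      refine lt_of_le_of_lt (le_of_eq ?_) hs
      rw [dist_eq_norm, dist_eq_norm]
      congr 1
      funext i
      simp; ring
    have h2 := hinv j _ n (ht h1)
    have e : (fun i => (s i + ((-n i : ℤ) : ℝ)) + (n i : ℝ)) = s := by
      funext i; push_cast; ring
    simpa only [e] using h2
  have hKcov : ∀ t, ∃ j, t ∈ K j := by
    intro t
    obtain ⟨j, hj⟩ := hleb _ (hfl t)
    refine ⟨j, ?_⟩
    have h2 := hKinv j _ (fun i => ⌊t i⌋) hj
    have e : (fun i => (t i + ((-⌊t i⌋ : ℤ) : ℝ)) + (⌊t i⌋ : ℝ)) = t := by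
      funext i; push_cast; ring
    simpa only [e] using h2
  have hKU : ∀ j, K j ⊆ U j := fun j t ht => ht (Metric.mem_ball_self hδ)
  have hKc : ∀ j, IsClosed (K j) := by
    intro j
    rw [← isOpen_compl_iff, Metric.isOpen_iff]
    intro t ht
    have ht' : ∃ s ∈ Metric.ball t δ, s ∉ U j := Set.not_subset.1 ht
    obtain ⟨s, hs, hsU⟩ := ht'
    rw [Metric.mem_ball] at hs
    refine ⟨δ - dist s t, by linarith, fun t' ht' hc => hsU (hc ?_)⟩
    rw [Metric.mem_ball] at ht' ⊢
    have := dist_triangle s t t'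
    rw [dist_comm t t'] at this
    linarith
  -- boundedness
  have hbd : ∀ j, ∃ B : ℝ, ∀ t ∈ K j ∩ Q, |(m j t : ℝ)| ≤ B := by
    intro j
    have hc : ContinuousOn (fun t => (m j t : ℝ)) (K j ∩ Q) := by
      intro t ht
      refine ContinuousAt.continuousWithinAt ?_
      refine (continuousAt_const (y := (m j t : ℝ))).congr ?_
      filter_upwards [hm j t (hKU j ht.1)] with s hs
      rw [hs]
    obtain ⟨B, hB⟩ := (hQc.inter_left (hKc j)).exists_bound_of_continuousOn hc
    exact ⟨B, hB⟩
  choose B hB using hbd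
  have hB2 : ∀ j, ∀ t ∈ K j, |(m j t : ℝ) - t j| ≤ B j + 1 := by
    intro j t ht
    have h1 := hKinv j t (fun i => -⌊t i⌋) ht
    have h2 := hB j _ ⟨h1, hfl t⟩
    have h3 := hshift j t (hKU j ht) (fun i => -⌊t i⌋)
    rw [h3] at h2
    push_cast at h2
    have h4 := Int.floor_le (t j)
    have h5 := Int.lt_floor_add_one (t j)
    rw [abs_le] at h2 ⊢
    constructor <;> linarith [h2.1, h2.2]
  obtain ⟨C, hC⟩ : ∃ C : ℝ, ∀ j, B j + 1 < C := by
    obtain ⟨C, hC⟩ := (Set.finite_range B).bddAbove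
    exact ⟨C + 2, fun j => by linarith [hC (Set.mem_range_self j)]⟩
  set L : ℝ := max (2 * C) 1 with hLdef
  have hL : 0 < L := lt_of_lt_of_le one_pos (le_max_right _ _)
  have hL2 : 2 * C ≤ L := le_max_left _ _
  set A : Fin k → Set (Fin k → ℝ) := fun j => {t | t ∈ K j ∧ (m j t : ℝ) ≤ L / 2} ∪ {t | t j ≤ 0}
  set D : Fin k → Set (Fin k → ℝ) := fun j => {t | t ∈ K j ∧ L / 2 < (m j t : ℝ)} ∪ {t | L ≤ t j}
  have hcl : ∀ j (P : ℤ → Prop), IsClosed {t | t ∈ K j ∧ P (m j t)} := by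
    intro j P
    rw [← isOpen_compl_iff, isOpen_iff_mem_nhds]
    intro t ht
    by_cases h : t ∈ K j
    · have hP : ¬ P (m j t) := fun hp => ht ⟨h, hp⟩
      filter_upwards [hm j t (hKU j h)] with s hs hs2
      exact hP (hs ▸ hs2.2)
    · filter_upwards [(hKc j).isOpen_compl.mem_nhds h] with s hs hs2
      exact hs hs2.1
  have hAc : ∀ j, IsClosed (A j) := fun j => (hcl j fun z => (z : ℝ) ≤ L / 2).union
    (isClosed_le (continuous_apply j) continuous_const)
  have hDc : ∀ j, IsClosed (D j) := fun j => (hcl j fun z => L / 2 < (z : ℝ)).union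
    (isClosed_le continuous_const (continuous_apply j))
  have hdisj : ∀ j t, t ∈ A j → t ∈ D j → False := by
    rintro j t (⟨h1, h2⟩ | h1) (⟨h3, h4⟩ | h3)
    · linarith
    · have := abs_le.1 (hB2 j t h1)
      have := hC j
      simp only [Set.mem_ofPred_eq] at h3
      linarith [this]
    · have := abs_le.1 (hB2 j t h3)
      have := hC j
      simp only [Set.mem_ofPred_eq] at h1
      linarith
    · simp only [Set.mem_ofPred_eq] at h1 h3
      linarith
  have hAne : ∀ j, (A j).Nonempty := fun j => ⟨fun _ => 0, Or.inr (by simp)⟩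
  have hDne : ∀ j, (D j).Nonempty := fun j => ⟨fun _ => L, Or.inr (by simp)⟩
  have hneg : ∀ j t, t ∈ A j → Metric.infDist t (A j) - Metric.infDist t (D j) < 0 := by
    intro j t ht
    have h1 := ((hDc j).notMem_iff_infDist_pos (hDne j)).1 (hdisj j t ht)
    rw [Metric.infDist_zero_of_mem ht]; linarith
  have hpos : ∀ j t, t ∈ D j → 0 < Metric.infDist t (A j) - Metric.infDist t (D j) := by
    intro j t ht
    have h1 := ((hAc j).notMem_iff_infDist_pos (hAne j)).1 (fun h => hdisj j t h ht)
    rw [Metric.infDist_zero_of_mem ht]; linarith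
  obtain ⟨x, -, hx⟩ := poincare_miranda k L hL
    (fun j t => Metric.infDist t (A j) - Metric.infDist t (D j))
    (fun j => (Metric.continuous_infDist_pt _).sub (Metric.continuous_infDist_pt _))
    (fun j t _ h => hneg j t (Or.inr (by simp [h])))
    (fun j t _ h => hpos j t (Or.inr (by simp [h])))
  obtain ⟨j, hj⟩ := hKcov x
  by_cases h : (m j x : ℝ) ≤ L / 2
  · exact (hneg j x (Or.inl ⟨hj, h⟩)).ne (hx j)
  · exact (hpos j x (Or.inl ⟨hj, not_le.1 h⟩)).ne' (hx j)

end TorusCover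

section LowerBound

open Complex

theorem HasTCCover.mono {X : Type*} [TopologicalSpace X] {k k' : ℕ} (hk : k ≤ k')
    (h : HasTCCover X k) : HasTCCover X k' := by
  obtain ⟨U, hU, hcov, hs⟩ := h
  refine ⟨fun i => if h : (i : ℕ) < k then U ⟨i, h⟩ else ∅, fun i => ?_, ?_, fun i => ?_⟩
  · by_cases h : (i : ℕ) < k
    · simpa [h] using hU _
    · simp [h]
  · rw [Set.eq_univ_iff_forall] at hcov ⊢
    intro p
    obtain ⟨i, hi⟩ := Set.mem_iUnion.1 (hcov p)
    refine Set.mem_iUnion.2 ⟨⟨i, i.2.trans_le hk⟩, ?_⟩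
    simpa using hi
  · by_cases h : (i : ℕ) < k
    · simpa [h] using hs _
    · simp only [h, dite_false]
      exact ⟨⟨fun p => (p.2 : False).elim, continuous_iff_continuousAt.2 fun p => p.2.elim⟩,
        fun p => p.2.elim⟩

/-- Along a continuous motion planner, quotients of values of a nowhere vanishing function have
a continuous logarithm. -/
theorem exists_log_of_section {X : Type*} [TopologicalSpace X] {U : Set (X × X)}
    (hU : HasMotionPlanningSection X U) (α : X → ℂ) (hα : Continuous α) (h0 : ∀ x, α x ≠ 0) :
    ∃ l : U → ℂ, Continuous l ∧
      ∀ p : U, exp (l p) = α (p : X × X).2 / α (p : X × X).1 := by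
  obtain ⟨s, hs⟩ := hU
  have hsc : Continuous fun q : unitInterval × U => s q.2 q.1 := by fun_prop
  have hs0 : Continuous fun q : unitInterval × U => s q.2 0 := by fun_prop
  let H : C(unitInterval × U, {z : ℂ // z ≠ 0}) :=
    ⟨fun q => ⟨α (s q.2 q.1) / α (s q.2 0), div_ne_zero (h0 _) (h0 _)⟩,
      Continuous.subtype_mk ((hα.comp hsc).div (hα.comp hs0) fun _ => h0 _) _⟩
  have H0 : ∀ a, H (0, a) = (⟨exp ((ContinuousMap.const U (0 : ℂ)) a), exp_ne_zero _⟩ :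
      {z : ℂ // z ≠ 0}) := by
    intro a
    apply Subtype.ext
    simp [H, div_self (h0 _)]
  let L := Complex.isCoveringMap_exp.liftHomotopy H (ContinuousMap.const U (0 : ℂ)) H0
  refine ⟨fun p => L (1, p), by fun_prop, fun p => ?_⟩
  have h1 := congrFun (Complex.isCoveringMap_exp.liftHomotopy_lifts H
    (ContinuousMap.const U (0 : ℂ)) H0) (1, p)
  have h2 := congrArg Subtype.val h1
  simp only [Function.comp_apply] at h2
  refine h2.trans ?_
  simp only [H, ContinuousMap.coe_mk]
  rw [(hs p).1, (hs p).2]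

/-- A lower bound for the number of motion planners from a torus in `X × X`, on which the
quotients of values of invertible functions wind independently. -/
theorem not_hasTCCover_of_torus {X : Type*} [TopologicalSpace X] (k : ℕ)
    (f : (Fin k → ℝ) → X × X) (hf : Continuous f)
    (hper : ∀ t (n : Fin k → ℤ), f (fun i => t i + n i) = f t)
    (α : Fin k → X → ℂ) (hα : ∀ j, Continuous (α j)) (h0 : ∀ j x, α j x ≠ 0)
    (L : Fin k → (Fin k → ℝ) → ℂ) (hL : ∀ j, Continuous (L j))
    (hexp : ∀ j t, exp (L j t) = α j (f t).2 / α j (f t).1)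
    (hshift : ∀ j t (n : Fin k → ℤ),
      L j (fun i => t i + n i) = L j t + 2 * Real.pi * I * n j) :
    ¬ HasTCCover X k := by
  rintro ⟨U, hU, hcov, hs⟩
  choose l hl hlexp using fun j => exists_log_of_section (hs j) (α j) (hα j) (h0 j)
  have hpi : (2 * Real.pi * I : ℂ) ≠ 0 := two_pi_I_ne_zero
  have hm : ∀ j t, f t ∈ U j → ∃ m : ℤ, ∀ h : f t ∈ U j,
      L j t = l j ⟨f t, h⟩ + m * (2 * Real.pi * I) := by
    intro j t h
    have : exp (L j t) = exp (l j ⟨f t, h⟩) := by rw [hexp, hlexp]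
    obtain ⟨m, hm⟩ := exp_eq_exp_iff_exists_int.1 this
    exact ⟨m, fun _ => hm⟩
  choose! m hm using hm
  refine torus_not_covered k (fun j => f ⁻¹' U j) (fun j => (hU j).preimage hf) (fun t => ?_)
    (fun j t n h => ?_) m (fun j t ht => ?_) (fun j t ht n => ?_)
  · have h : f t ∈ ⋃ i, U i := hcov ▸ Set.mem_univ (f t)
    obtain ⟨j, hj⟩ := Set.mem_iUnion.1 h
    exact ⟨j, hj⟩
  · simpa [hper] using h
  · have hc : ContinuousOn (fun s => (m j s : ℂ)) (f ⁻¹' U j) := by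
      rw [continuousOn_iff_continuous_domRestrict]
      have : Continuous fun s : f ⁻¹' U j => (L j s - l j ⟨f s, s.2⟩) / (2 * Real.pi * I) :=
        (((hL j).comp continuous_subtype_val).sub ((hl j).comp
          ((hf.comp continuous_subtype_val).subtype_mk _))).div_const _
      refine this.congr fun s => ?_
      rw [hm j s s.2 s.2]
      simp [hpi]
    have hc2 := (hc.continuousAt (((hU j).preimage hf).mem_nhds ht))
    have hev := Metric.tendsto_nhds.1 hc2 1 one_pos
    filter_upwards [hev] with s hs
    rw [dist_eq_norm, ← Int.cast_sub, norm_intCast] at hs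
    have : |m j s - m j t| < 1 := by exact_mod_cast hs
    rw [abs_lt] at this
    omega
  · have h1 := hm j _ (by simpa [hper] using ht : f (fun i => t i + n i) ∈ U j)
      (by simpa [hper] using ht)
    have h2 := hm j t ht ht
    rw [hshift, h2] at h1
    have h3 : l j ⟨f (fun i => t i + n i), by simpa [hper] using ht⟩ = l j ⟨f t, ht⟩ := by
      congr 1; exact Subtype.ext (hper t n)
    rw [h3] at h1
    have h4 : ((m j fun i => t i + n i : ℤ) : ℂ) = m j t + n j := by
      apply mul_right_cancel₀ hpi
      linear_combination -h1
    exact_mod_cast h4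

/-- Exponential sums with a dominant term have a continuous logarithm. -/
theorem exists_log_of_dominant (r : ℕ) {ι : Type*} [Fintype ι] (c : ι → Fin r → ℂ)
    (lead : ι → Fin r) (h1 : ∀ h, c h (lead h) ≠ 0) (h2 : ∀ h i, lead h < i → c h i = 0) :
    ∃ M : ℝ, 0 < M ∧ ∃ P : ι → (Fin r → ℝ) → ℂ, (∀ h, Continuous (P h)) ∧
      (∀ h θ (n : Fin r → ℤ), P h (fun i => θ i + n i)
        = P h θ + 2 * Real.pi * I * n (lead h)) ∧
      ∀ h θ, exp (P h θ) = ∑ i, c h i * ((M : ℂ) ^ (i : ℕ) * exp (2 * Real.pi * I * θ i)) := by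
  classical
  set M : ℝ := 1 + ∑ h, (∑ i, ‖c h i‖) / ‖c h (lead h)‖ with hM
  have hMh : ∀ h, (∑ i, ‖c h i‖) < M * ‖c h (lead h)‖ := by
    intro h
    have hp : 0 < ‖c h (lead h)‖ := norm_pos_iff.2 (h1 h)
    rw [← div_lt_iff₀ hp]
    have := Finset.single_le_sum (f := fun h => (∑ i, ‖c h i‖) / ‖c h (lead h)‖)
      (fun h _ => by positivity) (Finset.mem_univ h)
    linarith
  have hM1 : 1 ≤ M := by
    have : 0 ≤ ∑ h, (∑ i, ‖c h i‖) / ‖c h (lead h)‖ := Finset.sum_nonneg fun h _ => by positivity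
    linarith
  have hM0 : 0 < M := by linarith
  have hMC : (M : ℂ) ≠ 0 := by exact_mod_cast hM0.ne'
  let S : ι → (Fin r → ℝ) → ℂ := fun h θ => ∑ i ∈ Finset.univ.erase (lead h),
    c h i * ((M : ℂ) ^ (i : ℕ) * exp (2 * Real.pi * I * (θ i - θ (lead h)))) /
      (c h (lead h) * (M : ℂ) ^ (lead h : ℕ))
  have hSn : ∀ h θ, ‖S h θ‖ < 1 := by
    intro h θ
    have hp : 0 < ‖c h (lead h)‖ := norm_pos_iff.2 (h1 h)
    have hterm : ∀ i ∈ Finset.univ.erase (lead h),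
        ‖c h i * ((M : ℂ) ^ (i : ℕ) * exp (2 * Real.pi * I * (θ i - θ (lead h)))) /
        (c h (lead h) * (M : ℂ) ^ (lead h : ℕ))‖ ≤ ‖c h i‖ / (M * ‖c h (lead h)‖) := by
      intro i hi
      have hne := Finset.ne_of_mem_erase hi
      have e : (2 * Real.pi * I * (θ i - θ (lead h)) : ℂ)
          = ((2 * Real.pi * (θ i - θ (lead h)) : ℝ) : ℂ) * I := by push_cast; ring
      rw [norm_div, norm_mul, norm_mul, norm_mul, norm_pow, norm_pow, norm_real, e,
        norm_exp_ofReal_mul_I, mul_one, Real.norm_of_nonneg hM0.le]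
      rcases lt_or_ge (lead h) i with hlt | hge
      · rw [h2 h i hlt]; simp
      · have hlt : (i : ℕ) < lead h := lt_of_le_of_ne hge (fun e => hne (Fin.ext e))
        rw [div_le_div_iff₀ (by positivity) (by positivity)]
        have : M ^ (i : ℕ) * M ≤ M ^ (lead h : ℕ) := by
          rw [← pow_succ]; exact pow_le_pow_right₀ hM1 hlt
        have h5 := mul_le_mul_of_nonneg_left this
          (mul_nonneg (norm_nonneg (c h i)) (norm_nonneg (c h (lead h))))
        linarith
    calc ‖S h θ‖ ≤ ∑ i ∈ Finset.univ.erase (lead h), ‖c h i‖ / (M * ‖c h (lead h)‖) :=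
          norm_sum_le_of_le _ hterm
      _ ≤ ∑ i, ‖c h i‖ / (M * ‖c h (lead h)‖) :=
          Finset.sum_le_sum_of_subset_of_nonneg (Finset.subset_univ _) fun i _ _ => by positivity
      _ < 1 := by
          rw [← Finset.sum_div, div_lt_one (by positivity)]
          exact hMh h
  have hslit : ∀ h θ, 1 + S h θ ∈ slitPlane := fun h θ =>
    mem_slitPlane_of_norm_lt_one (hSn h θ)
  have hSc : ∀ h, Continuous (S h) := by
    intro h
    refine continuous_finsetSum _ fun i _ => ?_
    fun_prop
  have hSp : ∀ h θ (n : Fin r → ℤ), S h (fun i => θ i + n i) = S h θ := by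
    intro h θ n
    refine Finset.sum_congr rfl fun i _ => ?_
    congr 3
    rw [exp_eq_exp_iff_exists_int]
    exact ⟨n i - n (lead h), by push_cast; ring⟩
  refine ⟨M, hM0, fun h θ => log (c h (lead h) * (M : ℂ) ^ (lead h : ℕ)) +
    2 * Real.pi * I * θ (lead h) + log (1 + S h θ), fun h => ?_, fun h θ n => ?_, fun h θ => ?_⟩
  · refine Continuous.add (by fun_prop) ?_
    exact (continuous_const.add (hSc h)).clog (hslit h)
  · simp only [hSp]; push_cast; ring
  · have hne : c h (lead h) * (M : ℂ) ^ (lead h : ℕ) ≠ 0 := mul_ne_zero (h1 h) (pow_ne_zero _ hMC)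
    rw [exp_add, exp_add, exp_log hne, exp_log (slitPlane_ne_zero (hslit h θ)), mul_add, mul_one,
      ← Finset.add_sum_erase _ _ (Finset.mem_univ (lead h)), Finset.mul_sum]
    congr 1
    · ring
    · refine Finset.sum_congr rfl fun i _ => ?_
      have e : exp (2 * Real.pi * I * θ i) = exp (2 * Real.pi * I * θ (lead h)) *
          exp (2 * Real.pi * I * (θ i - θ (lead h))) := by rw [← exp_add]; congr 1; ring
      rw [e]
      generalize exp (2 * Real.pi * I * θ (lead h)) = A
      generalize exp (2 * Real.pi * I * (θ i - θ (lead h))) = B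
      have := h1 h
      field_simp

end LowerBound

section LowerBoundArrangement

open Complex

/-- Linearly independent functionals on a vector space admit a dual family of vectors. -/
theorem exists_dual_family {K V : Type*} [Field K] [AddCommGroup V] [Module K V] {r : ℕ}
    (b : Fin r → V →ₗ[K] K) (hb : LinearIndependent K b) :
    ∃ v : Fin r → V, ∀ i j, b i (v j) = if i = j then 1 else 0 := by
  have hsurj : Function.Surjective (LinearMap.pi b) := by
    rw [← LinearMap.range_eq_top]
    by_contra hne
    obtain ⟨φ, hφ0, hφ⟩ := Submodule.exists_le_ker_of_lt_top _ (lt_top_iff_ne_top.2 hne)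
    refine hφ0 (LinearMap.pi_ext' fun i => LinearMap.ext_ring ?_)
    have hz : ∑ i, φ (Pi.single i 1) • b i = 0 := by
      ext x
      have h1 : φ (LinearMap.pi b x) = 0 := hφ ⟨x, rfl⟩
      rw [← LinearMap.sum_single_apply (fun _ : Fin r => K) (LinearMap.pi b x), map_sum] at h1
      rw [LinearMap.sum_apply, LinearMap.zero_apply, ← h1]
      refine Finset.sum_congr rfl fun i _ => ?_
      have : (Pi.single i ((LinearMap.pi b x) i) : Fin r → K)
          = (b i x) • (Pi.single i 1 : Fin r → K) := by
        rw [← Pi.single_smul]; simp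
      rw [this, map_smul]
      simp [mul_comm]
    simpa using Fintype.linearIndependent_iff.1 hb _ hz i
  choose v hv using fun j : Fin r => hsurj (Pi.single j 1)
  refine ⟨v, fun i j => ?_⟩
  have := congrFun (hv j) i
  simpa [Pi.single_apply] using this

/-- A periodic family of points of the complement of an arrangement, whose values under the
defining functionals have leading terms rotating independently. -/
theorem exists_torus_param {ι V : Type*} [Fintype ι] [AddCommGroup V] [Module ℂ V]
    [TopologicalSpace V] [ContinuousAdd V] [ContinuousSMul ℂ V]
    {r : ℕ} (α : ι → V →ₗ[ℂ] ℂ) (hα : ∀ h, α h ≠ 0) (b : Fin r → V →ₗ[ℂ] ℂ)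
    (hb : LinearIndependent ℂ b) (hspan : ∀ h, α h ∈ Submodule.span ℂ (Set.range b)) :
    ∃ (v : Fin r → V) (lead : ι → Fin r) (z : (Fin r → ℝ) → V) (P : ι → (Fin r → ℝ) → ℂ),
      (∀ i j, b i (v j) = if i = j then 1 else 0) ∧
      (∀ h, α h = ∑ i, α h (v i) • b i) ∧
      (∀ h, α h (v (lead h)) ≠ 0 ∧ ∀ i, lead h < i → α h (v i) = 0) ∧
      Continuous z ∧ (∀ θ (n : Fin r → ℤ), z (fun i => θ i + n i) = z θ) ∧
      (∀ h, Continuous (P h)) ∧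
      (∀ h θ (n : Fin r → ℤ), P h (fun i => θ i + n i)
        = P h θ + 2 * Real.pi * I * n (lead h)) ∧
      ∀ h θ, exp (P h θ) = α h (z θ) := by
  classical
  obtain ⟨v, hv⟩ := exists_dual_family b hb
  have hexpand : ∀ h, α h = ∑ i, α h (v i) • b i := by
    intro h
    obtain ⟨c, hc⟩ := (Submodule.mem_span_range_iff_exists_fun ℂ).1 (hspan h)
    have : ∀ i, α h (v i) = c i := by
      intro i
      rw [← hc, LinearMap.sum_apply]
      simp [hv]
    simp_rw [this, hc]
  have hne : ∀ h, (Finset.univ.filter fun i => α h (v i) ≠ 0).Nonempty := by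
    intro h
    by_contra hcon
    rw [Finset.not_nonempty_iff_eq_empty, Finset.filter_eq_empty_iff] at hcon
    refine hα h ?_
    rw [hexpand h]
    refine Finset.sum_eq_zero fun i _ => ?_
    have := hcon (Finset.mem_univ i)
    rw [not_not] at this
    rw [this, zero_smul]
  let lead : ι → Fin r := fun h => (Finset.univ.filter fun i => α h (v i) ≠ 0).max' (hne h)
  have hl1 : ∀ h, α h (v (lead h)) ≠ 0 := fun h =>
    (Finset.mem_filter.1 (Finset.max'_mem _ (hne h))).2
  have hl2 : ∀ h i, lead h < i → α h (v i) = 0 := by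
    intro h i hi
    by_contra hcon
    exact absurd (Finset.le_max' _ i (Finset.mem_filter.2 ⟨Finset.mem_univ _, hcon⟩))
      (not_le.2 hi)
  obtain ⟨M, hM, P, hP1, hP2, hP3⟩ := exists_log_of_dominant r (fun h i => α h (v i)) lead hl1 hl2
  refine ⟨v, lead, fun θ => ∑ i : Fin r, ((M : ℂ) ^ (i : ℕ) * exp (2 * Real.pi * I * θ i)) • v i, P,
    hv, hexpand, fun h => ⟨hl1 h, hl2 h⟩, ?_, fun θ n => ?_, hP1, hP2, fun h θ => ?_⟩
  · fun_prop
  · refine Finset.sum_congr rfl fun i _ => ?_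
    congr 2
    rw [exp_eq_exp_iff_exists_int]
    exact ⟨n i, by push_cast; ring⟩
  · rw [hP3, map_sum]
    refine Finset.sum_congr rfl fun i _ => ?_
    rw [map_smul, smul_eq_mul, mul_comm]

theorem le_of_hasTCCover_arrComplement {ℓ : ℕ} (𝒜 : Finset (Submodule ℂ (Fin ℓ → ℂ)))
    (α : 𝒜 → ((Fin ℓ → ℂ) →ₗ[ℂ] ℂ))
    (hα : ∀ H : 𝒜, α H ≠ 0 ∧ (H : Submodule ℂ (Fin ℓ → ℂ)) = LinearMap.ker (α H))
    (q : ℕ) (hr : q + 1 = Module.finrank ℂ (Submodule.span ℂ (Set.range α)))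
    (F : Fin (q + 1) → 𝒜) (G : Fin q → 𝒜)
    (hindF : LinearIndependent ℂ (fun i => α (F i)))
    (hindG : ∀ j : Fin (q + 1), LinearIndependent ℂ
      (Sum.elim (fun _ : Unit => α (F j)) (fun i => α (G i))))
    {k : ℕ} (hk : HasTCCover (ArrComplement 𝒜) k) : 2 * (q + 1) ≤ k := by
  classical
  by_contra hlt
  have hk' : HasTCCover (ArrComplement 𝒜) ((q + 1) + q) := hk.mono (by omega)
  revert hk'
  have hmem : ∀ x : Fin ℓ → ℂ, (∀ H : 𝒜, α H x ≠ 0) → ∀ H ∈ 𝒜, x ∉ H := by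
    intro x hx H hH hxH
    refine hx ⟨H, hH⟩ ?_
    have := (hα ⟨H, hH⟩).2
    simp only at this
    rw [this] at hxH
    exact LinearMap.mem_ker.1 hxH
  have hmem' : ∀ x : ArrComplement 𝒜, ∀ H : 𝒜, α H x ≠ 0 := by
    intro x H h
    refine x.2 H H.2 ?_
    rw [(hα H).2]
    exact LinearMap.mem_ker.2 h
  have hspan : ∀ b : Fin (q + 1) → (Fin ℓ → ℂ) →ₗ[ℂ] ℂ, LinearIndependent ℂ b →
      (∀ i, ∃ H, b i = α H) → ∀ H, α H ∈ Submodule.span ℂ (Set.range b) := by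
    intro b hb hbα H
    have h1 : Submodule.span ℂ (Set.range b) ≤ Submodule.span ℂ (Set.range α) := by
      refine Submodule.span_mono ?_
      rintro _ ⟨i, rfl⟩
      obtain ⟨H, hH⟩ := hbα i
      exact ⟨H, hH.symm⟩
    have h2 := Submodule.eq_of_le_of_finrank_eq h1
      (by rw [finrank_span_eq_card hb, ← hr, Fintype.card_fin])
    rw [h2]
    exact Submodule.subset_span ⟨H, rfl⟩
  have hFG : ∀ j, α (F j) ∉ Submodule.span ℂ (Set.range fun i => α (G i)) := by
    intro j hj
    have h1 := (hindG j).notMem_span_image (s := Set.range Sum.inr) (x := Sum.inl ()) (by simp)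
    refine h1 ?_
    rw [← Set.range_comp]
    exact hj
  have hG : LinearIndependent ℂ fun i => α (G i) := by
    simpa [Function.comp_def] using (hindG 0).comp Sum.inr Sum.inr_injective
  set b : Fin (q + 1) → (Fin ℓ → ℂ) →ₗ[ℂ] ℂ := Fin.snoc (fun i => α (G i)) (α (F 0)) with hbdef
  have hbc : ∀ i : Fin q, b i.castSucc = α (G i) := fun i => by simp [hbdef]
  have hbl : b (Fin.last q) = α (F 0) := by simp [hbdef]
  have hb : LinearIndependent ℂ b := linearIndependent_finSnoc.2 ⟨hG, hFG 0⟩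
  have hbα : ∀ i, ∃ H, b i = α H := by
    intro i
    refine Fin.lastCases ⟨F 0, hbl⟩ (fun i => ⟨G i, hbc i⟩) i
  obtain ⟨v, lead, z, P, hv, -, hlead, hz, hzp, hP, hPs, hPe⟩ :=
    exists_torus_param α (fun h => (hα h).1) (fun i => α (F i)) hindF
      (hspan _ hindF fun i => ⟨F i, rfl⟩)
  obtain ⟨v', lead', z', P', hv', hexp', hlead', hz', hzp', hP', hPs', hPe'⟩ :=
    exists_torus_param α (fun h => (hα h).1) b hb (hspan _ hb hbα)
  have hleadF : ∀ j, lead (F j) = j := by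
    intro j
    have h1 := (hlead (F j)).1
    rw [hv] at h1
    by_contra hne
    exact h1 (if_neg fun e => hne e.symm)
  have hleadG : ∀ i : Fin q, lead' (G i) = i.castSucc := by
    intro i
    have h1 := (hlead' (G i)).1
    rw [← hbc, hv'] at h1
    by_contra hne
    exact h1 (if_neg fun e => hne e.symm)
  have hleadF' : ∀ j, lead' (F j) = Fin.last q := by
    intro j
    by_contra hne
    have h1 := (hlead' (F j)).2 _ (Fin.lt_last_iff_ne_last.2 hne)
    refine hFG j ?_
    rw [hexp' (F j), Fin.sum_univ_castSucc, h1, zero_smul, add_zero]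
    refine Submodule.sum_mem _ fun i _ => Submodule.smul_mem _ _ ?_
    rw [hbc]
    exact Submodule.subset_span ⟨i, rfl⟩
  -- phases
  let θ : (Fin (q + 1 + q) → ℝ) → Fin (q + 1) → ℝ := fun T i => -T (Fin.castAdd q i)
  let θ' : (Fin (q + 1 + q) → ℝ) → Fin (q + 1) → ℝ := fun T =>
    Fin.snoc (fun i : Fin q => T (Fin.natAdd (q + 1) i) - T (Fin.castAdd q (lead (G i)))) 0
  let N : (Fin (q + 1 + q) → ℤ) → Fin (q + 1) → ℤ := fun T i => -T (Fin.castAdd q i)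
  let N' : (Fin (q + 1 + q) → ℤ) → Fin (q + 1) → ℤ := fun T =>
    Fin.snoc (fun i : Fin q => T (Fin.natAdd (q + 1) i) - T (Fin.castAdd q (lead (G i)))) 0
  have hθ : Continuous θ := by fun_prop
  have hθ' : Continuous θ' := by
    refine continuous_pi fun i => ?_
    refine Fin.lastCases ?_ (fun i => ?_) i
    · simp only [θ', Fin.snoc_last]; exact continuous_const
    · simp only [θ', Fin.snoc_castSucc]; fun_prop
  have hθn : ∀ T (n : Fin (q + 1 + q) → ℤ), θ (fun i => T i + n i) = fun i => θ T i + N n i := by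
    intro T n; funext i; simp [θ, N]; ring
  have hθn' : ∀ T (n : Fin (q + 1 + q) → ℤ),
      θ' (fun i => T i + n i) = fun i => θ' T i + N' n i := by
    intro T n; funext i
    refine Fin.lastCases ?_ (fun i => ?_) i
    · simp [θ', N']
    · simp [θ', N']; ring
  have hne : ∀ T, ∀ H ∈ 𝒜, z T ∉ H := fun T => hmem _ fun H => by
    rw [← hPe]; exact exp_ne_zero _
  have hne' : ∀ T, ∀ H ∈ 𝒜, z' T ∉ H := fun T => hmem _ fun H => by
    rw [← hPe']; exact exp_ne_zero _
  let sel : Fin (q + 1 + q) → 𝒜 := Fin.addCases F G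
  refine not_hasTCCover_of_torus (q + 1 + q)
    (fun T => (⟨z (θ T), hne _⟩, ⟨z' (θ' T), hne' _⟩)) ?_ (fun T n => ?_)
    (fun j x => α (sel j) x) (fun j => ?_) (fun j x => hmem' x _)
    (fun j T => P' (sel j) (θ' T) - P (sel j) (θ T)) (fun j => ?_) (fun j T => ?_)
    (fun j T n => ?_)
  · exact ((hz.comp hθ).subtype_mk _).prodMk ((hz'.comp hθ').subtype_mk _)
  · have h1 : z (θ fun i => T i + n i) = z (θ T) := by rw [hθn, hzp]
    have h2 : z' (θ' fun i => T i + n i) = z' (θ' T) := by rw [hθn', hzp']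
    exact Prod.ext (Subtype.ext h1) (Subtype.ext h2)
  · exact (LinearMap.continuous_of_finiteDimensional _).comp continuous_subtype_val
  · exact ((hP' _).comp hθ').sub ((hP _).comp hθ)
  · rw [exp_sub, hPe, hPe']
  · rw [hθn, hθn', hPs, hPs']
    refine Fin.addCases (fun j => ?_) (fun i => ?_) j
    · simp only [sel, Fin.addCases_left, hleadF, hleadF', N, N', Fin.snoc_last]
      push_cast; ring
    · simp only [sel, Fin.addCases_right, hleadG, N, N', Fin.snoc_castSucc]
      push_cast; ring

end LowerBoundArrangement

section

open Set Filter Topology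

/-- The complement of the affine hyperplanes `lam i x + b i = 0`. -/
def affCompl {E ι : Type*} [NormedAddCommGroup E] [NormedSpace ℂ E]
    (lam : ι → E →L[ℂ] ℂ) (b : ι → ℂ) : Set E := {x | ∀ i, lam i x + b i ≠ 0}

/-- The functionals indexed by `S` have no common nonzero zero. -/
def Separating {E ι : Type*} [NormedAddCommGroup E] [NormedSpace ℂ E]
    (lam : ι → E →L[ℂ] ℂ) (S : Set ι) : Prop := ∀ x, (∀ i ∈ S, lam i x = 0) → x = 0

/-- The zero-dimensional flats of an affine arrangement. -/
def arrVertices {E ι : Type*} [NormedAddCommGroup E] [NormedSpace ℂ E]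
    (lam : ι → E →L[ℂ] ℂ) (b : ι → ℂ) : Set E := {p | Separating lam {i | lam i p + b i = 0}}

/-- `u` is nonconstant on every positive-dimensional flat direction. -/
def GenericFor {E ι : Type*} [NormedAddCommGroup E] [NormedSpace ℂ E]
    (lam : ι → E →L[ℂ] ℂ) (u : E →L[ℂ] ℂ) : Prop :=
  ∀ S : Set ι, ¬ Separating lam S → ∃ e, (∀ i ∈ S, lam i e = 0) ∧ u e = 1

section
variable {E ι : Type*} [NormedAddCommGroup E] [NormedSpace ℂ E]
  {lam : ι → E →L[ℂ] ℂ} {b : ι → ℂ}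

theorem Separating.mono {S T : Set ι} (h : Separating lam S) (hST : S ⊆ T) :
    Separating lam T := fun x hx => h x fun i hi => hx i (hST hi)

theorem isOpen_affCompl [Finite ι] : IsOpen (affCompl lam b) := by
  have : affCompl lam b = ⋂ i, {x | lam i x + b i ≠ 0} := by ext; simp [affCompl]
  rw [this]
  exact isOpen_iInter_of_finite fun i => isOpen_ne_fun (by fun_prop) continuous_const

theorem finite_arrVertices [Finite ι] : (arrVertices lam b).Finite := by
  refine Set.Finite.of_finite_image (f := fun p => {i | lam i p + b i = 0}) (Set.toFinite _) ?_
  intro p hp q hq h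
  rw [← sub_eq_zero]
  refine hp _ fun i hi => ?_
  have hi' : i ∈ {i | lam i q + b i = 0} := (Set.ext_iff.1 h i).1 hi
  have h1 : lam i p + b i = 0 := hi
  have h2 : lam i q + b i = 0 := hi'
  rw [map_sub]
  linear_combination h1 - h2

theorem exists_le_norm_of_separating [FiniteDimensional ℂ E] [Fintype ι] {ρ : ℝ} (hρ : 0 < ρ)
    (S : Set ι) (hS : Separating lam S) :
    ∃ δ > 0, ∀ x, (∀ p ∈ arrVertices lam b, ρ ≤ ‖x - p‖) → ∃ j ∈ S, δ ≤ ‖lam j x + b j‖ := by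
  classical
  have : ProperSpace E := FiniteDimensional.proper ℂ E
  let L : E →L[ℂ] (S → ℂ) := ContinuousLinearMap.pi fun j : S => lam j
  have hLinj : LinearMap.ker (L : E →ₗ[ℂ] (S → ℂ)) = ⊥ := by
    rw [LinearMap.ker_eq_bot']
    intro x hx
    exact hS x fun i hi => congrFun hx ⟨i, hi⟩
  obtain ⟨K, -, hK⟩ := LinearMap.exists_antilipschitzWith (L : E →ₗ[ℂ] (S → ℂ)) hLinj
  let bb : S → ℂ := fun j => b j
  let Q : Set E := {x | (∀ p ∈ arrVertices lam b, ρ ≤ ‖x - p‖)} ∩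
    L ⁻¹' Metric.closedBall (-bb) 1
  have hQc : IsCompact Q := by
    refine Metric.isCompact_of_isClosed_isBounded ?_ ?_
    · refine IsClosed.inter ?_ (Metric.isClosed_closedBall.preimage L.continuous)
      have : {x : E | (∀ p ∈ arrVertices lam b, ρ ≤ ‖x - p‖)} =
          ⋂ p ∈ arrVertices lam b, {x | ρ ≤ ‖x - p‖} := by ext; simp
      rw [this]
      exact isClosed_biInter fun p _ => isClosed_le continuous_const (by fun_prop)
    · exact (hK.isBounded_preimage Metric.isBounded_closedBall).subset inter_subset_right
  have key : ∃ δ > 0, δ ≤ 1 ∧ ∀ x ∈ Q, δ ≤ ‖L x + bb‖ := by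
    rcases Q.eq_empty_or_nonempty with h | h
    · exact ⟨1, one_pos, le_rfl, by simp [h]⟩
    · obtain ⟨x0, hx0, hmin⟩ := hQc.exists_isMinOn h
        (f := fun x => ‖L x + bb‖) (by fun_prop)
      refine ⟨min 1 ‖L x0 + bb‖, lt_min one_pos ?_, min_le_left _ _,
        fun x hx => (min_le_right _ _).trans (hmin hx)⟩
      rw [norm_pos_iff]
      intro h0
      have hv : x0 ∈ arrVertices lam b :=
        hS.mono fun i hi => congrFun h0 ⟨i, hi⟩
      have := hx0.1 x0 hv
      simp only [sub_self, norm_zero] at this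
      linarith
  obtain ⟨δ, hδ, hδ1, hmin⟩ := key
  refine ⟨δ, hδ, fun x hx => ?_⟩
  by_contra! hcon
  have hlt : ‖L x + bb‖ < δ := by
    rw [pi_norm_lt_iff hδ]
    exact fun j => hcon j j.2
  refine absurd (hmin x ⟨hx, ?_⟩) (not_le.2 hlt)
  rw [mem_preimage, mem_closedBall_iff_norm, sub_neg_eq_add]
  linarith

/-- Away from the vertices of an arrangement there is a continuous vector field which is
transverse to `u` and tangent to all nearby hyperplanes. -/
theorem exists_transverse_field [FiniteDimensional ℂ E] [Fintype ι] {u : E →L[ℂ] ℂ}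
    (hu : GenericFor lam u) :
    ∃ K > 0, ∀ ρ > 0, ∃ η > 0, ∃ e : E → E,
      ContinuousOn e {x | ∀ p ∈ arrVertices lam b, ρ ≤ ‖x - p‖} ∧
      (∀ x, (∀ p ∈ arrVertices lam b, ρ ≤ ‖x - p‖) → u (e x) = 1 ∧ ‖e x‖ ≤ K ∧
        (x ∈ affCompl lam b → ∀ z : ℂ, ‖z‖ ≤ η → x + z • e x ∈ affCompl lam b)) := by
  classical
  have hu' : ∀ S : Finset ι, ∃ e, ¬ Separating lam (S : Set ι) →
      (∀ i ∈ S, lam i e = 0) ∧ u e = 1 := by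
    intro S
    by_cases h : Separating lam (S : Set ι)
    · exact ⟨0, fun h' => absurd h h'⟩
    · obtain ⟨e, he⟩ := hu S h
      exact ⟨e, fun _ => ⟨fun i hi => he.1 i hi, he.2⟩⟩
  choose e0 he0 using hu'
  let K : ℝ := 1 + ∑ S, ‖e0 S‖
  have hK : 0 < K := by positivity
  have hKe : ∀ S, ‖e0 S‖ ≤ K := fun S => by
    have := Finset.single_le_sum (f := fun S => ‖e0 S‖) (fun i _ => norm_nonneg _)
      (Finset.mem_univ S)
    simp only [K]; linarith
  refine ⟨K, hK, fun ρ hρ => ?_⟩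
  have hδ : ∃ δ > 0, ∀ x, (∀ p ∈ arrVertices lam b, ρ ≤ ‖x - p‖) →
      ¬ Separating lam {j | ‖lam j x + b j‖ < δ} := by
    have h1 : ∀ S : Set ι, ∃ δ > 0, Separating lam S → ∀ x,
        (∀ p ∈ arrVertices lam b, ρ ≤ ‖x - p‖) → ∃ j ∈ S, δ ≤ ‖lam j x + b j‖ := by
      intro S
      by_cases h : Separating lam S
      · obtain ⟨δ, hδ, h'⟩ := exists_le_norm_of_separating (b := b) hρ S h
        exact ⟨δ, hδ, fun _ => h'⟩
      · exact ⟨1, one_pos, fun h' => absurd h' h⟩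
    choose d hd hd' using h1
    obtain ⟨S0, hS0⟩ := Finite.exists_min d
    refine ⟨d S0, hd S0, fun x hx hsep => ?_⟩
    obtain ⟨j, hj, hj'⟩ := hd' _ hsep x hx
    have h3 : ‖lam j x + b j‖ < d S0 := hj
    linarith [hS0 {j | ‖lam j x + b j‖ < d S0}]
  obtain ⟨δ, hδ, hsep⟩ := hδ
  let w : Finset ι → E → ℝ := fun S x =>
    if Separating lam (S : Set ι) then 0 else ∏ j ∈ Sᶜ, max 0 (‖lam j x + b j‖ - δ / 2)
  let W : E → ℝ := fun x => ∑ S, w S x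
  have hw0 : ∀ S x, 0 ≤ w S x := by
    intro S x
    simp only [w]
    split_ifs
    · exact le_rfl
    · exact Finset.prod_nonneg fun j _ => le_max_left _ _
  have hwc : ∀ S, Continuous (w S) := by
    intro S
    simp only [w]
    split_ifs <;> fun_prop
  have hW : ∀ x, (∀ p ∈ arrVertices lam b, ρ ≤ ‖x - p‖) → 0 < W x := by
    intro x hx
    refine Finset.sum_pos' (fun S _ => hw0 S x)
      ⟨Finset.univ.filter fun j => ‖lam j x + b j‖ < δ, Finset.mem_univ _, ?_⟩
    simp only [w]
    rw [if_neg (by simpa using hsep x hx)]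
    refine Finset.prod_pos fun j hj => ?_
    have : δ ≤ ‖lam j x + b j‖ := by simpa using hj
    exact lt_max_of_lt_right (by linarith)
  have hwS : ∀ S x, w S x ≠ 0 → ¬ Separating lam (S : Set ι) ∧
      ∀ j, ‖lam j x + b j‖ ≤ δ / 2 → j ∈ S := by
    intro S x h
    simp only [w] at h
    split_ifs at h with h'
    · exact absurd rfl h
    · refine ⟨h', fun j hj => ?_⟩
      by_contra hjS
      refine h (Finset.prod_eq_zero (i := j) (by simpa using hjS) ?_)
      exact max_eq_left (by linarith)
  let e : E → E := fun x => ∑ S, ((w S x / W x : ℝ) : ℂ) • e0 S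
  let M : ℝ := 1 + ∑ j, ‖lam j‖
  have hM : 0 < M := by positivity
  have hMl : ∀ j, ‖lam j‖ ≤ M := fun S => by
    have := Finset.single_le_sum (f := fun S => ‖lam S‖) (fun i _ => norm_nonneg _)
      (Finset.mem_univ S)
    simp only [M]; linarith
  refine ⟨δ / (4 * (M * K)), by positivity, e, ?_, ?_⟩
  · refine continuousOn_finsetSum _ fun S _ => ContinuousOn.smul ?_ continuousOn_const
    refine Complex.continuous_ofReal.comp_continuousOn ?_
    refine ContinuousOn.div (hwc S).continuousOn ?_ fun x hx => (hW x hx).ne'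
    exact (continuous_finsetSum _ fun S _ => hwc S).continuousOn
  intro x hx
  have hWx := hW x hx
  have hsum : ∑ S, w S x / W x = 1 := by
    rw [← Finset.sum_div]; exact div_self hWx.ne'
  have hek : ‖e x‖ ≤ K := by
    calc ‖e x‖ ≤ ∑ S, ‖((w S x / W x : ℝ) : ℂ) • e0 S‖ := norm_sum_le _ _
      _ ≤ ∑ S, w S x / W x * K := by
        refine Finset.sum_le_sum fun S _ => ?_
        have h0 : 0 ≤ w S x / W x := div_nonneg (hw0 S x) hWx.le
        rw [norm_smul, Complex.norm_of_nonneg h0]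
        exact mul_le_mul_of_nonneg_left (hKe S) h0
      _ = K := by rw [← Finset.sum_mul, hsum, one_mul]
  refine ⟨?_, hek, ?_⟩
  · simp only [e, map_sum, map_smul, smul_eq_mul]
    have : ∀ S, ((w S x / W x : ℝ) : ℂ) * u (e0 S) = ((w S x / W x : ℝ) : ℂ) := by
      intro S
      by_cases h : w S x = 0
      · simp [h]
      · rw [(he0 S (hwS S x h).1).2, mul_one]
    rw [Finset.sum_congr rfl fun S _ => this S, ← Complex.ofReal_sum, hsum, Complex.ofReal_one]
  · intro hxN z hz j
    rw [map_add, map_smul, smul_eq_mul]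
    by_cases hj : ‖lam j x + b j‖ ≤ δ / 2
    · have h0 : lam j (e x) = 0 := by
        simp only [e, map_sum, map_smul, smul_eq_mul]
        refine Finset.sum_eq_zero fun S _ => ?_
        by_cases h : w S x = 0
        · simp [h]
        · rw [(he0 S (hwS S x h).1).1 j ((hwS S x h).2 j hj), mul_zero]
      rw [h0, mul_zero, add_zero]
      exact hxN j
    · intro h0
      have h1 : lam j x + b j = - (z * lam j (e x)) := by linear_combination h0
      have h2 : ‖z * lam j (e x)‖ ≤ δ / (4 * (M * K)) * (M * K) := by
        rw [norm_mul]
        refine mul_le_mul hz ?_ (norm_nonneg _) (by positivity)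
        exact ((lam j).le_opNorm _).trans (mul_le_mul (hMl j) hek (norm_nonneg _) hM.le)
      have h3 : δ / (4 * (M * K)) * (M * K) = δ / 4 := by field_simp
      rw [h1, norm_neg] at hj
      linarith

/-- Sweeping along a field transverse to `u` multiplies `u - c` by the factor `1 - s φ`. -/
theorem exists_sweep {u : E →L[ℂ] ℂ} {c : ℂ} {N R Z : Set E} {e : E → E} {K η : ℝ}
    (hη : 0 < η) (heR : ContinuousOn e R) (hue : ∀ x ∈ R, u (e x) = 1)
    (heK : ∀ x ∈ R, ‖e x‖ ≤ K)
    (hN : ∀ x ∈ N, x ∈ R → ∀ z : ℂ, ‖z‖ ≤ η → x + z • e x ∈ N) (hZN : Z ⊆ N)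
    {φ : E → ℝ} (hφc : ContinuousOn φ Z) (hφ : ∀ y ∈ Z, 0 ≤ φ y ∧ φ y ≤ 1)
    (hR : ∀ y ∈ Z, ∀ x ∈ N, ∀ θ : ℝ, 1 - φ y ≤ θ → θ ≤ 1 → u x - c = θ * (u y - c) →
      ‖x - y‖ ≤ K * ((1 - θ) * ‖u y - c‖) → x ∈ R) :
    ∃ G : ℝ → E → E, ContinuousOn (fun q : ℝ × E => G q.1 q.2) (Icc 0 1 ×ˢ Z) ∧
      (∀ y ∈ Z, G 0 y = y) ∧ ∀ s ∈ Icc (0 : ℝ) 1, ∀ y ∈ Z, G s y ∈ N ∧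
        u (G s y) - c = (1 - s * φ y : ℝ) * (u y - c) ∧
        ‖G s y - y‖ ≤ K * (s * φ y * ‖u y - c‖) := by
  let τ : E → ℝ := fun y => ‖u y - c‖ / η + 1
  have hτ1 : ∀ y, 1 ≤ τ y := fun y => by
    have : 0 ≤ ‖u y - c‖ / η := by positivity
    simp only [τ]; linarith
  have hτ0 : ∀ y, 0 < τ y := fun y => one_pos.trans_le (hτ1 y)
  have hτc : Continuous τ := by fun_prop
  have hτη : ∀ y, ‖u y - c‖ ≤ η * τ y := fun y => by
    simp only [τ, mul_add, mul_div_cancel₀ _ hη.ne']; linarith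
  let cl : ℝ → ℝ := fun t => max 0 (min 1 t)
  have hclc : Continuous cl := by fun_prop
  have hcl0 : ∀ t, 0 ≤ cl t := fun t => le_max_left _ _
  have hcl1 : ∀ t, cl t ≤ 1 := fun t => max_le zero_le_one (min_le_left _ _)
  let Ψ : ℕ → ℝ × E → E := fun n => Nat.rec (fun q => q.2)
    (fun n f q => f q - (((φ q.2 / τ q.2 * cl (q.1 - n) : ℝ) : ℂ) * (u q.2 - c)) • e (f q)) n
  have hΨ0 : ∀ q, Ψ 0 q = q.2 := fun q => rfl
  have hΨs : ∀ n q, Ψ (n + 1) q = Ψ n q -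
      (((φ q.2 / τ q.2 * cl (q.1 - n) : ℝ) : ℂ) * (u q.2 - c)) • e (Ψ n q) := fun n q => rfl
  let D : Set (ℝ × E) := {q | q.2 ∈ Z ∧ 0 ≤ q.1 ∧ q.1 ≤ τ q.2}
  have inv : ∀ n : ℕ, (∀ q ∈ D, Ψ n q ∈ N ∧
      u (Ψ n q) - c = (1 - φ q.2 / τ q.2 * min q.1 n : ℝ) * (u q.2 - c) ∧
      ‖Ψ n q - q.2‖ ≤ K * (φ q.2 / τ q.2 * min q.1 n * ‖u q.2 - c‖)) := by
    intro n
    induction n with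
    | zero =>
      rintro ⟨t, y⟩ ⟨hy, ht0, ht1⟩
      refine ⟨hZN hy, ?_, ?_⟩
      · simp [hΨ0, min_eq_right ht0]
      · simp [hΨ0, min_eq_right ht0]
    | succ n ih =>
      rintro ⟨t, y⟩ hq
      obtain ⟨h1, h2, h3⟩ := ih _ hq
      obtain ⟨hy, ht0, ht1⟩ := hq
      simp only at hy ht0 ht1 h2 h3
      have hφy := hφ y hy
      have hr0 : 0 ≤ φ y / τ y := div_nonneg hφy.1 (hτ0 y).le
      have hmle : φ y / τ y * min t n ≤ φ y := by
        calc φ y / τ y * min t n ≤ φ y / τ y * τ y :=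
              mul_le_mul_of_nonneg_left ((min_le_left _ _).trans ht1) hr0
          _ = φ y := div_mul_cancel₀ _ (hτ0 y).ne'
      have hm0 : 0 ≤ φ y / τ y * min t n := mul_nonneg hr0 (le_min ht0 n.cast_nonneg)
      have hxR : Ψ n (t, y) ∈ R := by
        refine hR y hy _ h1 (1 - φ y / τ y * min t n) (by linarith) (by linarith) h2 ?_
        rw [sub_sub_cancel]; exact h3
      have hstep : min t ((n + 1 : ℕ) : ℝ) = min t n + cl (t - n) := by
        push_cast
        simp only [cl]
        rcases le_total t n with h | h
        · rw [min_eq_left h, min_eq_left (by linarith), min_eq_right (by linarith),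
            max_eq_left (by linarith), add_zero]
        · rw [min_eq_right h]
          rcases le_total t (n + 1) with h' | h'
          · rw [min_eq_left h', min_eq_right (by linarith), max_eq_right (by linarith)]; ring
          · rw [min_eq_right h', min_eq_left (by linarith), max_eq_right (by linarith)]
      have hcoef : ‖((φ y / τ y * cl (t - n) : ℝ) : ℂ) * (u y - c)‖ =
          φ y / τ y * cl (t - n) * ‖u y - c‖ := by
        rw [norm_mul, Complex.norm_of_nonneg (mul_nonneg hr0 (hcl0 _))]
      refine ⟨?_, ?_, ?_⟩
      · rw [hΨs, sub_eq_add_neg, ← neg_smul]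
        refine hN _ h1 hxR _ ?_
        rw [norm_neg]
        simp only
        rw [hcoef]
        calc φ y / τ y * cl (t - n) * ‖u y - c‖ ≤ 1 / τ y * 1 * (η * τ y) := by
              gcongr
              · exact hφy.2
              · exact hcl1 _
              · exact hτη y
          _ = η := by have := (hτ0 y).ne'; field_simp
      · rw [hΨs, map_sub, map_smul, hue _ hxR, hstep]
        simp only [smul_eq_mul, mul_one]
        rw [sub_right_comm, h2]
        push_cast
        ring
      · rw [hΨs, hstep]
        simp only
        calc ‖Ψ n (t, y) - (((φ y / τ y * cl (t - n) : ℝ) : ℂ) * (u y - c)) • e (Ψ n (t, y)) - y‖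
            ≤ ‖Ψ n (t, y) - y‖ +
              ‖(((φ y / τ y * cl (t - n) : ℝ) : ℂ) * (u y - c)) • e (Ψ n (t, y))‖ := by
              rw [sub_right_comm]; exact norm_sub_le _ _
          _ ≤ K * (φ y / τ y * min t n * ‖u y - c‖) +
              φ y / τ y * cl (t - n) * ‖u y - c‖ * K := by
              refine add_le_add h3 ?_
              rw [norm_smul, hcoef]
              exact mul_le_mul_of_nonneg_left (heK _ hxR)
                (mul_nonneg (mul_nonneg hr0 (hcl0 _)) (norm_nonneg _))
          _ = _ := by ring
  have hmemR : ∀ n : ℕ, ∀ q ∈ D, Ψ n q ∈ R := by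
    rintro n ⟨t, y⟩ hq
    obtain ⟨h1, h2, h3⟩ := inv n _ hq
    obtain ⟨hy, ht0, ht1⟩ := hq
    simp only at hy ht0 ht1 h2 h3
    have hφy := hφ y hy
    have hr0 : 0 ≤ φ y / τ y := div_nonneg hφy.1 (hτ0 y).le
    have hmle : φ y / τ y * min t n ≤ φ y := by
      calc φ y / τ y * min t n ≤ φ y / τ y * τ y :=
            mul_le_mul_of_nonneg_left ((min_le_left _ _).trans ht1) hr0
        _ = φ y := div_mul_cancel₀ _ (hτ0 y).ne'
    have hm0 : 0 ≤ φ y / τ y * min t n := mul_nonneg hr0 (le_min ht0 n.cast_nonneg)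
    refine hR y hy _ h1 (1 - φ y / τ y * min t n) (by linarith) (by linarith) h2 ?_
    rw [sub_sub_cancel]; exact h3
  have hφD : ContinuousOn (fun q : ℝ × E => φ q.2) D :=
    hφc.comp continuousOn_snd fun q hq => hq.1
  have hcont : ∀ n, ContinuousOn (Ψ n) D := by
    intro n
    induction n with
    | zero => exact continuousOn_snd
    | succ n ih =>
      have : Ψ (n + 1) = fun q => Ψ n q -
        (((φ q.2 / τ q.2 * cl (q.1 - n) : ℝ) : ℂ) * (u q.2 - c)) • e (Ψ n q) := rfl
      rw [this]
      refine ih.sub (ContinuousOn.smul (ContinuousOn.mul ?_ (by fun_prop)) (heR.comp ih (hmemR n)))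
      refine Complex.continuous_ofReal.comp_continuousOn (ContinuousOn.mul ?_ (by fun_prop))
      exact hφD.div (by fun_prop) fun q _ => (hτ0 _).ne'
  have hstab : ∀ q : ℝ × E, ∀ n m : ℕ, q.1 ≤ n → n ≤ m → Ψ m q = Ψ n q := by
    intro q n m hqn hnm
    induction m, hnm using Nat.le_induction with
    | base => rfl
    | succ m hnm ih =>
      have : (n : ℝ) ≤ m := by exact_mod_cast hnm
      rw [hΨs, ih]
      have h0 : cl (q.1 - m) = 0 := by
        simp only [cl]
        rw [min_eq_right (by linarith), max_eq_left (by linarith)]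
      simp [h0]
  have hD : ∀ s ∈ Icc (0 : ℝ) 1, ∀ y ∈ Z, ((s * τ y, y) : ℝ × E) ∈ D := fun s hs y hy =>
    ⟨hy, mul_nonneg hs.1 (hτ0 y).le, mul_le_of_le_one_left (hτ0 y).le hs.2⟩
  refine ⟨fun s y => Ψ ⌈τ y⌉₊ (s * τ y, y), ?_, ?_, ?_⟩
  · rintro ⟨s0, y0⟩ ⟨hs0, hy0⟩
    set N0 : ℕ := ⌈τ y0⌉₊ + 1
    have hev : ∀ᶠ q in 𝓝[Icc 0 1 ×ˢ Z] ((s0, y0) : ℝ × E), τ q.2 < N0 := by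
      refine nhdsWithin_le_nhds ?_
      have hc : ContinuousAt (fun q : ℝ × E => τ q.2) (s0, y0) := by fun_prop
      refine hc.eventually_lt_const ?_
      simp only [N0]
      push_cast
      linarith [Nat.le_ceil (τ y0)]
    have hN0 : ContinuousWithinAt (fun q : ℝ × E => Ψ N0 (q.1 * τ q.2, q.2)) (Icc 0 1 ×ˢ Z)
        (s0, y0) := by
      refine ContinuousOn.comp (t := D) (hcont N0) (by fun_prop) ?_ (s0, y0) ⟨hs0, hy0⟩
      exact fun q hq => hD q.1 hq.1 q.2 hq.2
    have key : ∀ q : ℝ × E, q ∈ Icc (0 : ℝ) 1 ×ˢ Z → τ q.2 < N0 →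
        Ψ ⌈τ q.2⌉₊ (q.1 * τ q.2, q.2) = Ψ N0 (q.1 * τ q.2, q.2) := by
      intro q hq hlt
      refine (hstab (q.1 * τ q.2, q.2) ⌈τ q.2⌉₊ N0 ?_ ?_).symm
      · exact (hD q.1 hq.1 q.2 hq.2).2.2.trans (Nat.le_ceil _)
      · exact Nat.ceil_le.2 hlt.le
    refine hN0.congr_of_eventuallyEq ?_ ?_
    · filter_upwards [hev, self_mem_nhdsWithin] with q hq1 hq2 using key q hq2 hq1
    · exact key (s0, y0) ⟨hs0, hy0⟩ (hev.self_of_nhdsWithin ⟨hs0, hy0⟩)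
  · intro y hy
    simp only [zero_mul]
    rw [hstab (0, y) 0 ⌈τ y⌉₊ (by simp) (by simp), hΨ0]
  · intro s hs y hy
    have h := inv ⌈τ y⌉₊ _ (hD s hs y hy)
    have hmin : min (s * τ y) ((⌈τ y⌉₊ : ℕ) : ℝ) = s * τ y :=
      min_eq_left ((hD s hs y hy).2.2.trans (Nat.le_ceil _))
    simp only [hmin] at h
    have h' : φ y / τ y * (s * τ y) = s * φ y := by have := (hτ0 y).ne'; field_simp
    rw [h'] at h
    exact h

end

end

section

open Set Filter Topology

/-- `A` can be deformed inside `N` to a discrete set of points. -/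
def ContractsIn {E : Type*} [TopologicalSpace E] (A N : Set E) : Prop :=
  ∃ K : ℝ → E → E, ContinuousOn (fun q : ℝ × E => K q.1 q.2) (Icc 0 1 ×ˢ A) ∧
    (∀ x ∈ A, K 0 x = x) ∧ (∀ s ∈ Icc (0 : ℝ) 1, ∀ x ∈ A, K s x ∈ N) ∧
    ∀ x ∈ A, ∀ᶠ y in 𝓝[A] x, K 1 y = K 1 x

theorem ContinuousOn.of_closed_cover {X Y : Type*} [TopologicalSpace X] [TopologicalSpace Y]
    {f : X → Y} {Z F₁ F₂ : Set X} (h₁ : ContinuousOn f (Z ∩ F₁)) (h₂ : ContinuousOn f (Z ∩ F₂))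
    (hF₁ : IsClosed F₁) (hF₂ : IsClosed F₂) (hZ : Z ⊆ F₁ ∪ F₂) : ContinuousOn f Z := by
  have key : ∀ F, IsClosed F → ContinuousOn f (Z ∩ F) → ∀ x ∈ Z,
      ContinuousWithinAt f (Z ∩ F) x := by
    intro F hF h x hx
    by_cases hxF : x ∈ F
    · exact h x ⟨hx, hxF⟩
    · have : 𝓝[Z ∩ F] x = ⊥ := by
        have h1 : x ∉ closure (Z ∩ F) := fun h2 =>
          hxF (hF.closure_subset_iff.2 inter_subset_right h2)
        simpa [mem_closure_iff_nhdsWithin_neBot] using h1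
      simp [ContinuousWithinAt, this]
  intro x hx
  have h3 := (key F₁ hF₁ h₁ x hx).union (key F₂ hF₂ h₂ x hx)
  rwa [← inter_union_distrib_left, inter_eq_left.2 hZ] at h3

/-- Concatenation of partially defined homotopies. -/
theorem exists_homotopy_trans {X : Type*} [TopologicalSpace X] {F F' : ℝ → X → X} {Z Z' : Set X}
    (hF : ContinuousOn (fun q : ℝ × X => F q.1 q.2) (Icc 0 1 ×ˢ Z))
    (hF' : ContinuousOn (fun q : ℝ × X => F' q.1 q.2) (Icc 0 1 ×ˢ Z'))
    (h1 : ∀ x ∈ Z, F 1 x ∈ Z') (h0 : ∀ x ∈ Z', F' 0 x = x) :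
    ∃ G : ℝ → X → X, ContinuousOn (fun q : ℝ × X => G q.1 q.2) (Icc 0 1 ×ˢ Z) ∧
      (∀ x, G 0 x = F 0 x) ∧ (∀ x, G 1 x = F' 1 (F 1 x)) ∧
      ∀ s ∈ Icc (0 : ℝ) 1, ∀ x, (∃ s' ∈ Icc (0 : ℝ) 1, G s x = F s' x) ∨
        ∃ s' ∈ Icc (0 : ℝ) 1, G s x = F' s' (F 1 x) := by
  refine ⟨fun s x => if s ≤ 1 / 2 then F (2 * s) x else F' (2 * s - 1) (F 1 x), ?_, ?_, ?_, ?_⟩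
  · refine ContinuousOn.of_closed_cover (F₁ := {q : ℝ × X | q.1 ≤ 1 / 2})
      (F₂ := {q : ℝ × X | 1 / 2 ≤ q.1}) ?_ ?_ (isClosed_le (by fun_prop) (by fun_prop))
      (isClosed_le (by fun_prop) (by fun_prop)) fun q _ => le_total q.1 (1 / 2)
    · refine (hF.comp (f := fun q : ℝ × X => (2 * q.1, q.2)) (by fun_prop) ?_).congr ?_
      · rintro ⟨s, x⟩ ⟨⟨hs, hx⟩, hs'⟩
        simp only [Set.mem_ofPred_eq] at hs'
        exact ⟨⟨by linarith [hs.1], by simp only; linarith⟩, hx⟩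
      · rintro ⟨s, x⟩ ⟨-, hs'⟩
        exact if_pos hs'
    · have hc : ContinuousOn (fun q : ℝ × X => (2 * q.1 - 1, F 1 q.2))
          (Icc 0 1 ×ˢ Z ∩ {q : ℝ × X | 1 / 2 ≤ q.1}) := by
        refine ContinuousOn.prodMk (by fun_prop) ?_
        refine hF.comp (f := fun q : ℝ × X => ((1 : ℝ), q.2)) (by fun_prop) ?_
        rintro ⟨s, x⟩ ⟨⟨hs, hx⟩, hs'⟩
        exact ⟨⟨zero_le_one, le_rfl⟩, hx⟩
      refine (hF'.comp hc ?_).congr ?_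
      · rintro ⟨s, x⟩ ⟨⟨hs, hx⟩, hs'⟩
        simp only [Set.mem_ofPred_eq] at hs'
        exact ⟨⟨by simp only; linarith, by simp only; linarith [hs.2]⟩, h1 x hx⟩
      · rintro ⟨s, x⟩ ⟨⟨hs, hx⟩, hs'⟩
        simp only [Set.mem_ofPred_eq] at hs'
        simp only [Function.comp]
        split_ifs with h
        · have : s = 1 / 2 := le_antisymm h hs'
          subst this
          norm_num
          exact (h0 _ (h1 x hx)).symm
        · rfl
  · intro x; simp
  · intro x
    simp only
    rw [if_neg (by norm_num)]
    norm_num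
  · intro s hs x
    by_cases h : s ≤ 1 / 2
    · exact Or.inl ⟨2 * s, ⟨by linarith [hs.1], by linarith⟩, if_pos h⟩
    · exact Or.inr ⟨2 * s - 1, ⟨by linarith, by linarith [hs.2]⟩, if_neg h⟩

theorem ContinuousOn.of_locallyConst {X Y : Type*} [TopologicalSpace X] [TopologicalSpace Y]
    {f : X → Y} {A : Set X} (h : ∀ x ∈ A, ∀ᶠ y in 𝓝[A] x, f y = f x) : ContinuousOn f A :=
  fun x hx => continuousWithinAt_const.congr_of_eventuallyEq (h x hx) rfl

theorem ContractsIn.mono {E : Type*} [TopologicalSpace E] {A N A' N' : Set E}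
    (h : ContractsIn A N) (hA : A' ⊆ A) (hN : N ⊆ N') : ContractsIn A' N' := by
  obtain ⟨K, h1, h2, h3, h4⟩ := h
  exact ⟨K, h1.mono (prod_mono_right hA), fun x hx => h2 x (hA hx),
    fun s hs x hx => hN (h3 s hs x (hA hx)),
    fun x hx => nhdsWithin_mono x hA (h4 x (hA hx))⟩

/-- If `A` deforms inside `N` into a set that contracts inside `N`, then so does `A`. -/
theorem ContractsIn.of_deform {E : Type*} [TopologicalSpace E] {A B N : Set E}
    (h : ContractsIn B N) {F : ℝ → E → E}
    (hF : ContinuousOn (fun q : ℝ × E => F q.1 q.2) (Icc 0 1 ×ˢ A))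
    (h0 : ∀ x ∈ A, F 0 x = x) (hN : ∀ s ∈ Icc (0 : ℝ) 1, ∀ x ∈ A, F s x ∈ N)
    (h1 : ∀ x ∈ A, F 1 x ∈ B) : ContractsIn A N := by
  obtain ⟨K, k1, k2, k3, k4⟩ := h
  obtain ⟨G, g1, g2, g3, g4⟩ := exists_homotopy_trans hF k1 h1 k2
  refine ⟨G, g1, fun x hx => (g2 x).trans (h0 x hx), fun s hs x hx => ?_, fun x hx => ?_⟩
  · rcases g4 s hs x with ⟨s', hs', h⟩ | ⟨s', hs', h⟩
    · exact h ▸ hN s' hs' x hx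
    · exact h ▸ k3 s' hs' _ (h1 x hx)
  · have hc : ContinuousOn (F 1) A :=
      hF.comp (f := fun x : E => ((1 : ℝ), x)) (by fun_prop)
        fun x hx => ⟨⟨zero_le_one, le_rfl⟩, hx⟩
    have ht : Tendsto (F 1) (𝓝[A] x) (𝓝[B] (F 1 x)) :=
      tendsto_nhdsWithin_of_tendsto_nhds_of_eventually_within _ (hc x hx)
        (eventually_mem_nhdsWithin.mono h1)
    filter_upwards [ht.eventually (k4 _ (h1 x hx))] with y hy
    rw [g3, g3, hy]

/-- `c` is not a critical value of `u` and distinct critical values lie on distinct rays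
from `c`. -/
def GoodLevel {E ι : Type*} [NormedAddCommGroup E] [NormedSpace ℂ E]
    (lam : ι → E →L[ℂ] ℂ) (b : ι → ℂ) (u : E →L[ℂ] ℂ) (c : ℂ) : Prop :=
  (∀ p ∈ arrVertices lam b, u p ≠ c) ∧
  ∀ p ∈ arrVertices lam b, ∀ q ∈ arrVertices lam b,
    (u p - c) / ‖u p - c‖ = (u q - c) / ‖u q - c‖ → u p = u q

/-- After removal of a closed set `S` which contracts to a discrete set, the complement of the
arrangement deforms radially to a generic slice. -/
def HasSweep {E ι : Type*} [NormedAddCommGroup E] [NormedSpace ℂ E]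
    (lam : ι → E →L[ℂ] ℂ) (b : ι → ℂ) (u : E →L[ℂ] ℂ) : Prop :=
  ∃ K > 0, ∀ c, GoodLevel lam b u c → ∀ m > 0, (∀ p ∈ arrVertices lam b, m < ‖u p - c‖) →
    ∀ ε > 0, ∃ (S : Set E) (τ : E → ℂ) (G : ℝ → E → E), S ⊆ affCompl lam b ∧
      IsOpen (affCompl lam b \ S) ∧ ContractsIn S (affCompl lam b) ∧
      (∀ x ∈ S, ‖τ x‖ = 1 ∧ m ≤ (τ x * (u x - c)).re ∧ ∀ᶠ y in 𝓝[S] x, τ y = τ x) ∧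
      ContinuousOn (fun q : ℝ × E => G q.1 q.2) (Icc 0 1 ×ˢ (affCompl lam b \ S)) ∧
      ∀ x ∈ affCompl lam b \ S, G 0 x = x ∧ u (G 1 x) = c ∧ ∀ s ∈ Icc (0 : ℝ) 1,
        G s x ∈ affCompl lam b ∧
        (∃ θ ∈ Icc (0 : ℝ) 1, ‖(u (G s x) - c) - θ * (u x - c)‖ ≤ ε) ∧
        ‖G s x - x‖ ≤ K * ‖u x - c‖ + ε

theorem exists_goodLevel {E ι : Type*} [NormedAddCommGroup E] [NormedSpace ℂ E] [Finite ι]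
    (lam : ι → E →L[ℂ] ℂ) (b : ι → ℂ) (u : E →L[ℂ] ℂ) (c₀ : ℂ) {ε : ℝ} (hε : 0 < ε) :
    ∃ c, ‖c - c₀‖ < ε ∧ GoodLevel lam b u c := by
  let pt : ℝ → ℂ := fun s => c₀ + ⟨s, s ^ 2⟩
  have hfin : ∀ t t' : ℂ, t ≠ t' →
      {s : ℝ | (t - pt s) / ‖t - pt s‖ = (t' - pt s) / ‖t' - pt s‖ ∧ t ≠ pt s ∧
        t' ≠ pt s}.Finite := by
    intro t t' htt
    let P : Polynomial ℝ := Polynomial.C ((t - c₀) * (starRingEnd ℂ) (t' - c₀)).im +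
      Polynomial.C ((t' - c₀).im - (t - c₀).im) * Polynomial.X +
      Polynomial.C ((t - c₀).re - (t' - c₀).re) * Polynomial.X ^ 2
    have hP : P ≠ 0 := by
      intro h
      apply htt
      have hq : ∀ a b d : ℝ, Polynomial.C a + Polynomial.C b * Polynomial.X +
          Polynomial.C d * Polynomial.X ^ 2 = 0 → b = 0 ∧ d = 0 := by
        intro a b d h
        have h1 := congrArg (fun P => Polynomial.coeff P 1) h
        have h2 := congrArg (fun P => Polynomial.coeff P 2) h
        simp [Polynomial.coeff_C] at h1 h2
        exact ⟨h1, h2⟩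
      obtain ⟨h1, h2⟩ := hq _ _ _ h
      simp only [Complex.sub_re, Complex.sub_im] at h1 h2
      exact Complex.ext (by linarith) (by linarith)
    refine (P.roots.toFinset.finite_toSet).subset ?_
    rintro s ⟨h, hne, hne'⟩
    have hn : (0 : ℝ) < ‖t - pt s‖ := norm_pos_iff.2 (sub_ne_zero.2 hne)
    have hn' : (0 : ℝ) < ‖t' - pt s‖ := norm_pos_iff.2 (sub_ne_zero.2 hne')
    simp only [Multiset.mem_toFinset, Finset.mem_coe, Polynomial.mem_roots hP,
      Polynomial.IsRoot.def]
    rw [div_eq_div_iff (by exact_mod_cast hn.ne') (by exact_mod_cast hn'.ne')] at h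
    have hre := congrArg Complex.re h
    have him := congrArg Complex.im h
    simp [pt] at hre him
    simp [P]
    have h3 : ‖t' - pt s‖ * ((t.im - (c₀.im + s ^ 2)) * (t'.re - (c₀.re + s)) -
      (t.re - (c₀.re + s)) * (t'.im - (c₀.im + s ^ 2))) = 0 := by
      simp only [pt]
      linear_combination (t'.re - (c₀.re + s)) * him - (t'.im - (c₀.im + s ^ 2)) * hre
    have h4 := (mul_eq_zero.1 h3).resolve_left hn'.ne'
    linear_combination h4
  have hV := finite_arrVertices (lam := lam) (b := b)
  let Bad : Set ℝ := (⋃ t ∈ u '' arrVertices lam b, {s | t = pt s}) ∪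
    ⋃ t ∈ u '' arrVertices lam b, ⋃ t' ∈ u '' arrVertices lam b,
      {s : ℝ | t ≠ t' ∧ (t - pt s) / ‖t - pt s‖ = (t' - pt s) / ‖t' - pt s‖ ∧ t ≠ pt s ∧ t' ≠ pt s}
  have hBad : Bad.Finite := by
    refine Set.Finite.union ?_ ?_
    · refine (hV.image u).biUnion fun t _ => ?_
      refine Set.Subsingleton.finite ?_
      intro s hs s' hs'
      have h : pt s = pt s' := (show t = pt s from hs).symm.trans hs'
      simpa [pt] using congrArg Complex.re h
    · refine (hV.image u).biUnion fun t _ => (hV.image u).biUnion fun t' _ => ?_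
      by_cases h : t = t'
      · simp [h]
      · exact (hfin t t' h).subset fun s hs => hs.2
  have hcont : Tendsto (fun s : ℝ => ‖pt s - c₀‖) (𝓝[>] 0) (𝓝 0) := by
    have hc : Continuous fun s : ℝ => ‖pt s - c₀‖ := by
      have : (fun s : ℝ => ‖pt s - c₀‖) = fun s : ℝ => ‖(s : ℂ) + (s : ℂ) ^ 2 * Complex.I‖ := by
        ext s
        congr 1
        simp only [pt]
        apply Complex.ext <;> simp [pow_two]
      rw [this]; fun_prop
    have := hc.tendsto 0
    simp only [pt] at this
    have h0 : (⟨0, 0 ^ 2⟩ : ℂ) = 0 := by apply Complex.ext <;> simp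
    rw [h0, add_zero, sub_self, norm_zero] at this
    exact this.mono_left nhdsWithin_le_nhds
  have hev : ∀ᶠ s in 𝓝[>] (0 : ℝ), ‖pt s - c₀‖ < ε := hcont.eventually_lt_const hε
  have hinf : {s | ‖pt s - c₀‖ < ε}.Infinite := by
    intro hf
    have h1 : {s | ‖pt s - c₀‖ < ε} ∈ 𝓝[>] (0 : ℝ) := hev
    obtain ⟨a, ha, hsub⟩ := mem_nhdsGT_iff_exists_Ioo_subset.1 h1
    exact (Ioo_infinite ha) (hf.subset hsub)
  obtain ⟨s, hs, hsB⟩ := (hinf.sdiff hBad).nonempty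
  simp only [Bad, mem_union, mem_iUnion, not_or, not_exists] at hsB
  have hne : ∀ p ∈ arrVertices lam b, u p ≠ pt s := fun p hp h =>
    hsB.1 (u p) (mem_image_of_mem _ hp) h
  refine ⟨pt s, hs, hne, fun p hp p' hp' h => ?_⟩
  by_contra hpp
  exact hsB.2 (u p) (mem_image_of_mem _ hp) (u p') (mem_image_of_mem _ hp')
    ⟨hpp, h, hne p hp, hne p' hp'⟩

end

section

open Set Filter Topology

theorem exists_affine_chart {E ι : Type*} [NormedAddCommGroup E] [NormedSpace ℂ E]
    [FiniteDimensional ℂ E] [Nontrivial E]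
    {lam : ι → E →L[ℂ] ℂ} {u : E →L[ℂ] ℂ} (hsep : Separating lam univ) (hu : GenericFor lam u) :
    ∃ (i₀ : ι) (q₀ : E) (E' : Submodule ℂ E) (P : E →L[ℂ] E'), lam i₀ q₀ = 1 ∧
      (∀ y : E', lam i₀ y = 0) ∧ (∀ x, (P x : E) = x - lam i₀ x • q₀) ∧
      Module.finrank ℂ E' + 1 = Module.finrank ℂ E ∧
      GenericFor (fun i => (lam i).comp E'.subtypeL) (u.comp E'.subtypeL) ∧
      ∀ p ∈ arrVertices (fun i => (lam i).comp E'.subtypeL) (fun i => lam i q₀),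
        u (q₀ + p) ≠ 0 := by
  have h1 : ∃ i₀ q, lam i₀ q ≠ 0 := by
    by_contra! h
    obtain ⟨x, hx⟩ := exists_ne (0 : E)
    exact hx (hsep x fun i _ => h i x)
  obtain ⟨i₀, q, hq⟩ := h1
  have hq0 : lam i₀ ((lam i₀ q)⁻¹ • q) = 1 := by
    rw [map_smul, smul_eq_mul, inv_mul_cancel₀ hq]
  set q₀ := (lam i₀ q)⁻¹ • q
  let P : E →L[ℂ] LinearMap.ker (lam i₀ : E →ₗ[ℂ] ℂ) :=
    (ContinuousLinearMap.id ℂ E - (lam i₀).smulRight q₀).codRestrict _ (by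
      intro x
      simp [hq0])
  refine ⟨i₀, q₀, _, P, hq0, fun y => y.2, fun x => rfl, ?_, ?_, ?_⟩
  · have h := (lam i₀ : E →ₗ[ℂ] ℂ).finrank_range_add_finrank_ker
    have hr : LinearMap.range (lam i₀ : E →ₗ[ℂ] ℂ) = ⊤ := by
      rw [LinearMap.range_eq_top]
      intro z
      exact ⟨z • q₀, by simp [hq0]⟩
    rw [hr, finrank_top, Module.finrank_self] at h
    omega
  · intro S hS
    have : ¬ Separating lam (insert i₀ S) := by
      intro h
      refine hS fun x hx => ?_
      have hx0 : (x : E) = 0 := by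
        refine h x fun i hi => ?_
        rcases hi with rfl | hi
        · exact x.2
        · exact hx i hi
      exact Subtype.ext hx0
    obtain ⟨e, he, hue⟩ := hu _ this
    exact ⟨⟨e, he i₀ (mem_insert _ _)⟩, fun i hi => he i (mem_insert_of_mem _ hi), hue⟩
  · intro p hp h0
    have hlp : lam i₀ (q₀ + p) = 1 := by
      rw [map_add, hq0, show lam i₀ (p : E) = 0 from p.2, add_zero]
    have hS : ¬ Separating lam {i | lam i (q₀ + p) = 0} := by
      intro h
      have h2 := h (q₀ + p) fun i hi => hi
      rw [h2, map_zero] at hlp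
      exact zero_ne_one hlp
    obtain ⟨e, he, hue⟩ := hu _ hS
    have hz : (⟨e - lam i₀ e • (q₀ + p), by
        change lam i₀ (e - lam i₀ e • (q₀ + p)) = 0
        rw [map_sub, map_smul, hlp, smul_eq_mul, mul_one, sub_self]⟩ :
        LinearMap.ker (lam i₀ : E →ₗ[ℂ] ℂ)) = 0 := by
      refine hp _ fun i hi => ?_
      have hi' : lam i (q₀ + p) = 0 := by
        rw [map_add, add_comm]; exact hi
      change lam i (e - lam i₀ e • (q₀ + p)) = 0
      rw [map_sub, map_smul, he i hi', hi', smul_zero, sub_self]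
    have hz' : e - lam i₀ e • (q₀ + p) = 0 := congrArg Subtype.val hz
    have : u e = 0 := by
      rw [sub_eq_zero.1 hz', map_smul, h0, smul_zero]
    rw [hue] at this
    exact one_ne_zero this

set_option maxHeartbeats 1000000 in
/-- Near a vertex, an arrangement can be swept into the region where `u` almost avoids the
positive real axis, after the removal of a closed contractible set. -/
theorem exists_central_sweep {E ι : Type*} [NormedAddCommGroup E] [NormedSpace ℂ E]
    [FiniteDimensional ℂ E] [Nontrivial E] [Fintype ι]
    {lam : ι → E →L[ℂ] ℂ} {u : E →L[ℂ] ℂ} (hsep : Separating lam univ) (hu : GenericFor lam u)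
    (hT : ∀ (E' : Submodule ℂ E) (lam' : ι → E' →L[ℂ] ℂ) (b' : ι → ℂ) (u' : E' →L[ℂ] ℂ),
      Module.finrank ℂ E' + 1 = Module.finrank ℂ E → GenericFor lam' u' → HasSweep lam' b' u')
    {κ₂ : ℝ} (hκ₂ : 0 < κ₂) :
    ∃ CA ≥ (1 : ℝ), ∃ κ₁ > (0 : ℝ), ∃ (C : Set E) (A : ℝ → E → E), C ⊆ affCompl lam 0 ∧
      IsOpen (affCompl lam 0 \ C) ∧ ContractsIn C (affCompl lam 0) ∧
      (∀ x ∈ C, κ₁ * ‖x‖ ≤ (u x).re) ∧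
      ContinuousOn (fun q : ℝ × E => A q.1 q.2) (Icc 0 1 ×ˢ (affCompl lam 0 \ C)) ∧
      ∀ x ∈ affCompl lam 0 \ C, A 0 x = x ∧
        (∃ w : ℂ, w.re ≤ 2 * |w.im| ∧ ‖u (A 1 x) - w‖ ≤ κ₂ * ‖A 1 x‖) ∧
        ∀ s ∈ Icc (0 : ℝ) 1, A s x ∈ affCompl lam 0 ∧ ‖A s x‖ ≤ CA * ‖x‖ ∧
          ((u x).re < κ₁ * ‖x‖ → A s x = x) := by
  obtain ⟨i₀, q₀, E', P, hq₀, hE', hP, hrank, hgen, hvert⟩ := exists_affine_chart hsep hu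
  set lam' : ι → E' →L[ℂ] ℂ := fun i => (lam i).comp E'.subtypeL
  set b' : ι → ℂ := fun i => lam i q₀
  obtain ⟨K, hK, hsw⟩ := hT E' lam' b' _ hrank hgen
  have hV := finite_arrVertices (lam := lam') (b := b')
  obtain ⟨μ, hμ, hμv⟩ : ∃ μ > 0, ∀ p ∈ arrVertices lam' b', μ ≤ ‖u (q₀ + p)‖ := by
    rcases (arrVertices lam' b').eq_empty_or_nonempty with h | h
    · exact ⟨1, one_pos, by simp [h]⟩
    · obtain ⟨p0, hp0, hmin⟩ := hV.exists_minimalFor (fun p : E' => ‖u (q₀ + p)‖) _ h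
      refine ⟨_, norm_pos_iff.2 (hvert p0 hp0), fun p hp => ?_⟩
      by_contra! hlt
      exact absurd (hmin hp hlt.le) (not_le.2 hlt)
  set Λ : ℝ := ‖lam i₀‖ with hΛdef
  have hΛ : 0 < Λ := by
    rw [hΛdef, norm_pos_iff]
    intro h
    rw [h] at hq₀
    simp at hq₀
  obtain ⟨ε, hε, hε1, hε2, hε3⟩ : ∃ ε > 0, ε ≤ 1 ∧ ε * (4 * Λ) ≤ κ₂ ∧ ε * (8 * Λ) ≤ 1 := by
    refine ⟨min 1 (min (κ₂ / (4 * Λ)) (1 / (8 * Λ))), by positivity, min_le_left _ _, ?_, ?_⟩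
    · rw [← le_div_iff₀ (by positivity)]
      exact (min_le_right _ _).trans (min_le_left _ _)
    · rw [← le_div_iff₀ (by positivity)]
      exact (min_le_right _ _).trans (min_le_right _ _)
  obtain ⟨d, hd, hd1, hd2, hd3, hd4⟩ : ∃ d > 0, d ≤ 1 ∧ d * (4 * Λ) ≤ κ₂ ∧ d * (8 * K * Λ) ≤ 1 ∧
      4 * d ≤ μ := by
    refine ⟨min (min 1 (μ / 4)) (min (κ₂ / (4 * Λ)) (1 / (8 * K * Λ))), by positivity,
      (min_le_left _ _).trans (min_le_left _ _), ?_, ?_, ?_⟩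
    · rw [← le_div_iff₀ (by positivity)]
      exact (min_le_right _ _).trans (min_le_left _ _)
    · rw [← le_div_iff₀ (by positivity)]
      exact (min_le_right _ _).trans (min_le_right _ _)
    · rw [mul_comm, ← le_div_iff₀ (by positivity)]
      exact (min_le_left _ _).trans (min_le_right _ _)
  obtain ⟨κ₁, hκ₁, hκ₁a, hκ₁b⟩ : ∃ κ₁ > 0, 8 * κ₁ ≤ κ₂ ∧ 40 * K * κ₁ ≤ 1 := by
    refine ⟨min (κ₂ / 8) (1 / (40 * K)), by positivity, ?_, ?_⟩
    · rw [mul_comm, ← le_div_iff₀ (by positivity)]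
      exact min_le_left _ _
    · rw [mul_comm, ← le_div_iff₀ (by positivity)]
      exact min_le_right _ _
  obtain ⟨c, hc0, hgood⟩ := exists_goodLevel lam' b' (u.comp E'.subtypeL) (-u q₀) hd
  obtain ⟨c', rfl⟩ : ∃ c', c = c' - u q₀ := ⟨c + u q₀, by ring⟩
  have hc' : ‖c'‖ < d := by
    rwa [show c' - u q₀ - -u q₀ = c' by ring] at hc0
  have hUsub : ∀ y : E', u.comp E'.subtypeL y - (c' - u q₀) = u (q₀ + y) - c' := by
    intro y; simp; ring
  obtain ⟨S, τ, G, hSN, hSo, hSc, hSτ, hGc, hG⟩ := hsw _ hgood (2 * d) (by positivity) (by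
    intro p hp
    rw [hUsub]
    have h1 := hμv p hp
    have h2 := norm_sub_norm_le (u (q₀ + p)) c'
    linarith) ε hε
  simp only [hUsub] at hSτ hG
  -- the chart
  have hN' : ∀ y : E', y ∈ affCompl lam' b' ↔ q₀ + (y : E) ∈ affCompl lam 0 := by
    intro y
    simp [affCompl, lam', b', add_comm]
  have hcone : ∀ z : ℂ, z ≠ 0 → ∀ x : E, x ∈ affCompl lam 0 → z • x ∈ affCompl lam 0 := by
    intro z hz x hx i
    have := hx i
    simp only [Pi.zero_apply, add_zero, map_smul, smul_eq_mul] at this ⊢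
    exact mul_ne_zero hz this
  have hM0 : ∀ x ∈ affCompl lam 0, lam i₀ x ≠ 0 := fun x hx => by simpa using hx i₀
  let Y : E → E' := fun x => P ((lam i₀ x)⁻¹ • x)
  have hY : ∀ x ∈ affCompl lam 0, lam i₀ x • (q₀ + (Y x : E)) = x := by
    intro x hx
    have h := hM0 x hx
    have h1 : (Y x : E) = (lam i₀ x)⁻¹ • x - q₀ := by
      simp only [Y]
      rw [hP, map_smul, smul_eq_mul, inv_mul_cancel₀ h, one_smul]
    rw [h1, add_sub_cancel, smul_smul, mul_inv_cancel₀ h, one_smul]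
  have hYN : ∀ x ∈ affCompl lam 0, Y x ∈ affCompl lam' b' := by
    intro x hx
    rw [hN']
    have := hcone _ (inv_ne_zero (hM0 x hx)) x hx
    rw [← hY x hx] at this
    rwa [smul_smul, hY x hx, inv_mul_cancel₀ (hM0 x hx), one_smul] at this
  have hYc : ContinuousOn Y (affCompl lam 0) := by
    refine P.continuous.comp_continuousOn (ContinuousOn.smul ?_ continuousOn_id)
    exact (lam i₀).continuous.continuousOn.inv₀ hM0
  have huY : ∀ x ∈ affCompl lam 0, lam i₀ x * u (q₀ + (Y x : E)) = u x := by
    intro x hx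
    conv_rhs => rw [← hY x hx]
    rw [map_smul, smul_eq_mul]
  have hlam1 : ∀ y : E', lam i₀ (q₀ + (y : E)) = 1 := by
    intro y
    rw [map_add, hq₀, hE', add_zero]
  have hnorm : ∀ (z : ℂ) (y : E'), ‖z‖ ≤ Λ * ‖z • (q₀ + (y : E))‖ := by
    intro z y
    have := (lam i₀).le_opNorm (z • (q₀ + (y : E)))
    rwa [map_smul, hlam1, smul_eq_mul, mul_one] at this
  have hMo : IsOpen (affCompl lam (0 : ι → ℂ)) := isOpen_affCompl
  let f : E → ℝ := fun x => (u x).re - |(u x).im| - κ₁ * ‖x‖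
  have hfc : Continuous f := by
    have h1 : Continuous fun x => (u x).re := Complex.continuous_re.comp u.continuous
    have h2 : Continuous fun x => (u x).im := Complex.continuous_im.comp u.continuous
    fun_prop
  let C : Set E := {x | x ∈ affCompl lam 0 ∧ 0 ≤ f x ∧ Y x ∈ S}
  have hx0 : ∀ x ∈ affCompl lam 0, 0 < ‖x‖ := by
    intro x hx
    rw [norm_pos_iff]
    rintro rfl
    exact hM0 0 hx (map_zero _)
  let β : E → ℝ := fun x => max 0 (min 1 (f x / (κ₁ * ‖x‖)))
  have hβ0 : ∀ x, 0 ≤ β x := fun x => le_max_left _ _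
  have hβ1 : ∀ x, β x ≤ 1 := fun x => max_le zero_le_one (min_le_left _ _)
  have hβf : ∀ x, f x ≤ 0 → β x = 0 := by
    intro x hx
    refine max_eq_left ((min_le_right _ _).trans ?_)
    exact div_nonpos_of_nonpos_of_nonneg hx (by positivity)
  have hβc : ContinuousOn β (affCompl lam 0) := by
    refine ContinuousOn.sup continuousOn_const (ContinuousOn.inf continuousOn_const ?_)
    refine hfc.continuousOn.div (by fun_prop) fun x hx => ?_
    have := hx0 x hx
    positivity
  have hI : ∀ s ∈ Icc (0 : ℝ) 1, ∀ x, s * β x ∈ Icc (0 : ℝ) 1 := fun s hs x =>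
    ⟨mul_nonneg hs.1 (hβ0 x), mul_le_one₀ hs.2 (hβ0 x) (hβ1 x)⟩
  open Classical in
  let A : ℝ → E → E := fun s x =>
    if f x ≤ 0 then x else lam i₀ x • (q₀ + (G (s * β x) (Y x) : E))
  have hYS : ∀ x ∈ affCompl lam 0 \ C, 0 ≤ f x → Y x ∈ affCompl lam' b' \ S :=
    fun x hx hf => ⟨hYN x hx.1, fun h => hx.2 ⟨hx.1, hf, h⟩⟩
  have hAG : ∀ s, ∀ x ∈ affCompl lam 0 \ C, 0 ≤ f x →
      A s x = lam i₀ x • (q₀ + (G (s * β x) (Y x) : E)) := by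
    intro s x hx hf
    simp only [A]
    split_ifs with h
    · rw [hβf x h, mul_zero, (hG _ (hYS x hx hf)).1, hY x hx.1]
    · rfl
  have hAid : ∀ s x, f x ≤ 0 → A s x = x := fun s x h => if_pos h
  refine ⟨1 + (K * (‖u‖ + Λ) + Λ), le_add_of_nonneg_right (by positivity), κ₁, hκ₁, C, A,
    fun x hx => hx.1, ?_, ?_, ?_, ?_, ?_⟩
  · have : affCompl lam 0 \ C = (affCompl lam 0 ∩ {x | f x < 0}) ∪
        (affCompl lam 0 ∩ Y ⁻¹' (affCompl lam' b' \ S)) := by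
      ext x
      constructor
      · rintro ⟨hx, hxC⟩
        rcases lt_or_ge (f x) 0 with h | h
        · exact Or.inl ⟨hx, h⟩
        · exact Or.inr ⟨hx, hYS x ⟨hx, hxC⟩ h⟩
      · rintro (⟨hx, h⟩ | ⟨hx, h⟩)
        · exact ⟨hx, fun hC => not_le.2 h hC.2.1⟩
        · exact ⟨hx, fun hC => h.2 hC.2.2⟩
    rw [this]
    exact (hMo.inter (isOpen_lt hfc continuous_const)).union
      (hYc.isOpen_inter_preimage hMo hSo)
  · obtain ⟨k, k1, k2, k3, k4⟩ := hSc
    refine ⟨fun s x => (((1 - s : ℝ) : ℂ) * lam i₀ x + (s : ℂ) * τ (Y x)) •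
      (q₀ + (k s (Y x) : E)), ?_, ?_, ?_, ?_⟩
    · have hYc' : ContinuousOn (fun q : ℝ × E => Y q.2) (Icc 0 1 ×ˢ C) :=
        (hYc.mono fun x hx => hx.1).comp continuousOn_snd fun q hq => hq.2
      refine ContinuousOn.smul (ContinuousOn.add (by fun_prop) (ContinuousOn.mul (by fun_prop) ?_))
        (continuousOn_const.add ?_)
      · exact (ContinuousOn.of_locallyConst fun x hx => (hSτ x hx).2.2).comp hYc'
          fun q hq => hq.2.2.2
      · refine continuous_subtype_val.comp_continuousOn ?_
        exact k1.comp (continuousOn_fst.prodMk hYc') fun q hq => ⟨hq.1, hq.2.2.2⟩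
    · intro x hx
      simp [k2 _ hx.2.2, hY x hx.1]
    · intro s hs x hx
      refine hcone _ ?_ _ ((hN' _).1 (k3 s hs _ hx.2.2))
      intro h0
      have h1 := congrArg Complex.re (congrArg (fun z => z * u (q₀ + (Y x : E))) h0)
      have h2 : (((1 - s : ℝ) : ℂ) * lam i₀ x + (s : ℂ) * τ (Y x)) * u (q₀ + (Y x : E)) =
          ((1 - s : ℝ) : ℂ) * u x + (s : ℂ) * (τ (Y x) * u (q₀ + (Y x : E))) := by
        rw [← huY x hx.1]; ring
      simp only [h2, zero_mul, Complex.add_re, Complex.re_ofReal_mul, Complex.zero_re] at h1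
      have h3 : 0 < (u x).re := by
        have := hx.2.1
        simp only [f] at this
        have := hx0 x hx.1
        have : 0 < κ₁ * ‖x‖ := by positivity
        have := abs_nonneg (u x).im
        linarith
      have h4 : 0 < (τ (Y x) * u (q₀ + (Y x : E))).re := by
        have h5 := (hSτ _ hx.2.2).2.1
        rw [mul_sub, Complex.sub_re] at h5
        have h6 := Complex.re_le_norm (-(τ (Y x) * c'))
        rw [norm_neg, norm_mul, (hSτ _ hx.2.2).1, one_mul, Complex.neg_re] at h6
        linarith
      rcases hs.1.lt_or_eq with h | h
      · have := mul_pos h h4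
        have := mul_nonneg (sub_nonneg.2 hs.2) h3.le
        linarith
      · rw [← h] at h1
        linarith
    · intro x hx
      have ht : Tendsto Y (𝓝[C] x) (𝓝[S] (Y x)) :=
        tendsto_nhdsWithin_of_tendsto_nhds_of_eventually_within _
          ((hYc.mono fun x hx => hx.1) x hx) (eventually_mem_nhdsWithin.mono fun y hy => hy.2.2)
      filter_upwards [ht.eventually (k4 _ hx.2.2), ht.eventually (hSτ _ hx.2.2).2.2] with y h1 h2
      simp [h1, h2]
  · intro x hx
    have := hx.2.1
    simp only [f] at this
    have := abs_nonneg (u x).im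
    linarith
  · refine ContinuousOn.of_closed_cover (F₁ := {q : ℝ × E | f q.2 ≤ 0})
      (F₂ := {q : ℝ × E | 0 ≤ f q.2}) ?_ ?_ (isClosed_le (by fun_prop) (by fun_prop))
      (isClosed_le (by fun_prop) (by fun_prop)) fun q _ => le_total (f q.2) 0
    · exact continuousOn_snd.congr fun q hq => hAid _ _ hq.2
    · refine ContinuousOn.congr
        (f := fun q : ℝ × E => lam i₀ q.2 • (q₀ + (G (q.1 * β q.2) (Y q.2) : E))) ?_
        fun q hq => hAG _ _ hq.1.2 hq.2
      refine ContinuousOn.smul (by fun_prop) (continuousOn_const.add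
        (continuous_subtype_val.comp_continuousOn ?_))
      refine hGc.comp (f := fun q : ℝ × E => (q.1 * β q.2, Y q.2)) (ContinuousOn.prodMk
        (continuousOn_fst.mul (hβc.comp continuousOn_snd fun q hq => hq.1.2.1))
        (hYc.comp continuousOn_snd fun q hq => hq.1.2.1)) ?_
      exact fun q hq => ⟨hI _ hq.1.1 _, hYS _ hq.1.2 hq.2⟩
  · intro x hx
    have hxp := hx0 x hx.1
    have hlx : ‖lam i₀ x‖ ≤ Λ * ‖x‖ := (lam i₀).le_opNorm x
    have hux : ‖u x‖ ≤ ‖u‖ * ‖x‖ := u.le_opNorm x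
    have hmove : 0 ≤ f x → ∀ s ∈ Icc (0 : ℝ) 1, ‖A s x - x‖ ≤
        K * (‖u x‖ + d * (Λ * ‖x‖)) + ε * (Λ * ‖x‖) := by
      intro hf s hs
      obtain ⟨-, -, h⟩ := hG _ (hYS x hx hf)
      obtain ⟨-, -, h3⟩ := h _ (hI s hs x)
      have h4 : A s x - x = lam i₀ x • ((G (s * β x) (Y x) - Y x : E') : E) := by
        rw [hAG s x hx hf]
        have h5 : lam i₀ x • (q₀ + (G (s * β x) (Y x) : E)) - x =
            lam i₀ x • (q₀ + (G (s * β x) (Y x) : E)) - lam i₀ x • (q₀ + (Y x : E)) := by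
          rw [hY x hx.1]
        rw [h5, ← smul_sub, add_sub_add_left_eq_sub]
        rfl
      rw [h4, norm_smul]
      have h5 : ‖lam i₀ x‖ * ‖u (q₀ + (Y x : E)) - c'‖ ≤ ‖u x‖ + d * (Λ * ‖x‖) := by
        rw [← norm_mul, mul_sub, huY x hx.1]
        refine (norm_sub_le _ _).trans ?_
        rw [norm_mul, mul_comm ‖lam i₀ x‖]
        gcongr
      calc ‖lam i₀ x‖ * ‖((G (s * β x) (Y x) - Y x : E') : E)‖
          ≤ ‖lam i₀ x‖ * (K * ‖u (q₀ + (Y x : E)) - c'‖ + ε) := by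
            gcongr; exact h3
        _ = K * (‖lam i₀ x‖ * ‖u (q₀ + (Y x : E)) - c'‖) + ε * ‖lam i₀ x‖ := by ring
        _ ≤ _ := by gcongr
    refine ⟨?_, ?_, fun s hs => ⟨?_, ?_, ?_⟩⟩
    · rcases le_total (f x) 0 with h | h
      · exact hAid _ _ h
      · rw [hAG _ _ hx h, zero_mul, (hG _ (hYS x hx h)).1, hY x hx.1]
    · rcases le_or_gt (f x) 0 with h | h
      · rw [hAid _ _ h]
        refine ⟨u x - (κ₁ * ‖x‖ : ℝ), ?_, ?_⟩
        · simp only [Complex.sub_re, Complex.sub_im, Complex.ofReal_re, Complex.ofReal_im,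
            sub_zero]
          have := abs_nonneg (u x).im
          simp only [f] at h
          linarith
        · rw [sub_sub_cancel, Complex.norm_of_nonneg (by positivity)]
          have : κ₁ ≤ κ₂ := by linarith
          gcongr
      · obtain ⟨-, hG1, hGs⟩ := hG _ (hYS x hx h.le)
        have hA1 := hAG 1 x hx h.le
        rw [one_mul] at hA1
        have hlA : ‖lam i₀ x‖ ≤ Λ * ‖A 1 x‖ := hA1 ▸ hnorm _ _
        have hbound : ∀ t, t ≤ 2 * (κ₂ / (4 * Λ)) → ‖lam i₀ x‖ * t ≤ κ₂ / 2 * ‖A 1 x‖ := by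
          intro t ht
          have h1 : ‖lam i₀ x‖ * t ≤ ‖lam i₀ x‖ * (2 * (κ₂ / (4 * Λ))) := by gcongr
          have h2 : ‖lam i₀ x‖ * (2 * (κ₂ / (4 * Λ))) ≤ Λ * ‖A 1 x‖ * (2 * (κ₂ / (4 * Λ))) := by
            gcongr
          have h3 : Λ * ‖A 1 x‖ * (2 * (κ₂ / (4 * Λ))) = κ₂ / 2 * ‖A 1 x‖ := by
            field_simp; ring
          linarith
        have hd2' : d ≤ κ₂ / (4 * Λ) := by rwa [le_div_iff₀ (by positivity)]
        have hε2' : ε ≤ κ₂ / (4 * Λ) := by rwa [le_div_iff₀ (by positivity)]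
        have hκA : 0 ≤ κ₂ / 2 * ‖A 1 x‖ := by positivity
        by_cases hβ : β x = 1
        · refine ⟨0, by simp, ?_⟩
          have hq : u (q₀ + (G 1 (Y x) : E)) = c' := by
            have : u (G 1 (Y x) : E) = c' - u q₀ := hG1
            rw [map_add, this]; ring
          rw [hA1, hβ, map_smul, hq, sub_zero, smul_eq_mul, norm_mul]
          have h1 := hbound ‖c'‖ (by linarith)
          rw [hA1, hβ] at h1 hκA
          linarith
        · have hf2 : f x < κ₁ * ‖x‖ := by
            by_contra! hge
            refine hβ ?_
            have : 1 ≤ f x / (κ₁ * ‖x‖) := by rwa [one_le_div (by positivity)]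
            simp only [β]
            rw [min_eq_left this, max_eq_right zero_le_one]
          obtain ⟨-, ⟨θ, hθ, hθ1⟩, -⟩ := hGs _ ⟨hβ0 x, hβ1 x⟩
          have hclose : ‖u (A 1 x) - θ * u x‖ ≤ κ₂ / 2 * ‖A 1 x‖ := by
            have h1 : u (A 1 x) - θ * u x = lam i₀ x * ((u (q₀ + (G (β x) (Y x) : E)) - c') -
                θ * (u (q₀ + (Y x : E)) - c') + (1 - θ : ℝ) * c') := by
              rw [hA1, map_smul, ← huY x hx.1, smul_eq_mul]
              push_cast
              ring
            rw [h1, norm_mul]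
            refine hbound _ ((norm_add_le _ _).trans ?_)
            have h2 : ‖((1 - θ : ℝ) : ℂ) * c'‖ ≤ 1 * d := by
              rw [norm_mul, Complex.norm_of_nonneg (by linarith [hθ.2])]
              gcongr
              linarith [hθ.1]
            linarith
          have hre : (u x).re - |(u x).im| < 2 * (κ₁ * ‖x‖) := by
            simp only [f] at hf2
            linarith
          have hθ0 := hθ.1
          have hθ1' := hθ.2
          rcases le_or_gt (10 * (κ₁ * ‖x‖)) ‖u x‖ with hbig | hsmall
          · refine ⟨θ * u x, ?_, by linarith⟩
            rw [Complex.re_ofReal_mul, Complex.im_ofReal_mul, abs_mul, abs_of_nonneg hθ0]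
            have h1 : (u x).re ≤ 2 * |(u x).im| := by
              by_contra! h2
              have h3 := Complex.norm_le_abs_re_add_abs_im (u x)
              have := abs_nonneg (u x).im
              rw [abs_of_nonneg (by linarith : 0 ≤ (u x).re)] at h3
              linarith
            nlinarith
          · have h1 : ‖x‖ ≤ 2 * ‖A 1 x‖ := by
              have h2 := hmove h.le 1 ⟨zero_le_one, le_rfl⟩
              have h3 : K * (‖u x‖ + d * (Λ * ‖x‖)) + ε * (Λ * ‖x‖) ≤ 1 / 2 * ‖x‖ := by
                have h4 : K * ‖u x‖ ≤ K * (10 * (κ₁ * ‖x‖)) := by gcongr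
                have h5 := mul_le_mul_of_nonneg_right hκ₁b hxp.le
                have h6 := mul_le_mul_of_nonneg_right hd3 hxp.le
                have h7 := mul_le_mul_of_nonneg_right hε3 hxp.le
                have e5 : 40 * K * κ₁ * ‖x‖ = 4 * (K * (10 * (κ₁ * ‖x‖))) := by ring
                have e6 : d * (8 * K * Λ) * ‖x‖ = 8 * (K * (d * (Λ * ‖x‖))) := by ring
                have e7 : ε * (8 * Λ) * ‖x‖ = 8 * (ε * (Λ * ‖x‖)) := by ring
                rw [mul_add]
                linarith
              have h8 := norm_sub_norm_le x (A 1 x)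
              rw [norm_sub_rev] at h8
              linarith
            refine ⟨θ * (u x - (2 * (κ₁ * ‖x‖) : ℝ)), ?_, ?_⟩
            · rw [Complex.re_ofReal_mul, Complex.im_ofReal_mul, abs_mul, abs_of_nonneg hθ0]
              simp only [Complex.sub_re, Complex.sub_im, Complex.ofReal_re, Complex.ofReal_im,
                sub_zero]
              have := abs_nonneg (u x).im
              have : (u x).re - 2 * (κ₁ * ‖x‖) ≤ 2 * |(u x).im| := by linarith
              nlinarith
            · have h9 : u (A 1 x) - θ * (u x - (2 * (κ₁ * ‖x‖) : ℝ)) =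
                  (u (A 1 x) - θ * u x) + (θ * (2 * (κ₁ * ‖x‖)) : ℝ) := by push_cast; ring
              rw [h9]
              refine (norm_add_le _ _).trans ?_
              rw [Complex.norm_of_nonneg (by positivity)]
              have h10 : θ * (2 * (κ₁ * ‖x‖)) ≤ 1 * (2 * (κ₁ * (2 * ‖A 1 x‖))) := by gcongr
              have h11 : κ₁ * ‖A 1 x‖ ≤ κ₂ / 8 * ‖A 1 x‖ := by
                gcongr; linarith
              linarith
    · rcases le_total (f x) 0 with h | h
      · rw [hAid _ _ h]; exact hx.1
      · rw [hAG _ _ hx h]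
        exact hcone _ (hM0 x hx.1) _ ((hN' _).1 ((hG _ (hYS x hx h)).2.2 _ (hI s hs x)).1)
    · rcases le_total (f x) 0 with h | h
      · rw [hAid _ _ h]
        exact le_mul_of_one_le_left hxp.le (le_add_of_nonneg_right (by positivity))
      · have h1 := hmove h s hs
        have h2 := norm_sub_norm_le (A s x) x
        have h3 : K * (‖u x‖ + d * (Λ * ‖x‖)) + ε * (Λ * ‖x‖) ≤
            K * (‖u‖ * ‖x‖ + 1 * (Λ * ‖x‖)) + 1 * (Λ * ‖x‖) := by gcongr
        linarith
    · intro h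
      refine hAid _ _ ?_
      simp only [f]
      have := abs_nonneg (u x).im
      linarith

end

section

open Set Filter Topology

theorem smul_mem_affCompl_zero {E ι : Type*} [NormedAddCommGroup E] [NormedSpace ℂ E]
    {lam : ι → E →L[ℂ] ℂ} {x : E} (hx : x ∈ affCompl lam 0) {z : ℝ} (hz : z ≠ 0) :
    z • x ∈ affCompl lam 0 := by
  intro i
  have := hx i
  simp only [Pi.zero_apply, add_zero] at this ⊢
  rw [← Complex.coe_smul, map_smul, smul_eq_mul]
  exact mul_ne_zero (by exact_mod_cast hz) this

theorem ne_zero_of_mem_affCompl_zero {E ι : Type*} [NormedAddCommGroup E] [NormedSpace ℂ E]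
    [Nontrivial E] {lam : ι → E →L[ℂ] ℂ} (hsep : Separating lam univ) {x : E}
    (hx : x ∈ affCompl lam 0) : x ≠ 0 := by
  rintro rfl
  obtain ⟨y, hy⟩ := exists_ne (0 : E)
  exact hy (hsep y fun i _ => absurd (by simp) (hx i))

theorem exists_central_pair {E ι : Type*} [NormedAddCommGroup E] [NormedSpace ℂ E]
    [FiniteDimensional ℂ E] [Nontrivial E] [Fintype ι]
    {lam : ι → E →L[ℂ] ℂ} {u : E →L[ℂ] ℂ} (hsep : Separating lam univ) (hu : GenericFor lam u)
    (hT : ∀ (E' : Submodule ℂ E) (lam' : ι → E' →L[ℂ] ℂ) (b' : ι → ℂ) (u' : E' →L[ℂ] ℂ),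
      Module.finrank ℂ E' + 1 = Module.finrank ℂ E → GenericFor lam' u' → HasSweep lam' b' u')
    {κ₂ : ℝ} (hκ₂ : 0 < κ₂) :
    ∃ κ > (0 : ℝ), ∃ C : Set E, C ⊆ affCompl lam 0 ∧ IsOpen (affCompl lam 0 \ C) ∧
      ∀ ρ > (0 : ℝ), (∀ x ∈ C, (u x).re ≤ κ * ρ → ‖x‖ ≤ ρ / 2) ∧
        ContractsIn (C ∩ {x | (u x).re ≤ κ * ρ}) (affCompl lam 0 ∩ {x | ‖x‖ ≤ ρ}) ∧
        ∃ B : ℝ → E → E, ContinuousOn (fun q : ℝ × E => B q.1 q.2)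
            (Icc 0 1 ×ˢ ((affCompl lam 0 \ C) ∩ {x | (u x).re ≤ κ * ρ})) ∧
          ∀ x ∈ affCompl lam 0 \ C, (u x).re ≤ κ * ρ → B 0 x = x ∧
            (∀ s ∈ Icc (0 : ℝ) 1, B s x ∈ affCompl lam 0 ∧ (ρ ≤ ‖x‖ → B s x = x) ∧
              (‖x‖ ≤ ρ → ‖B s x‖ ≤ ρ)) ∧
            (‖x‖ ≤ ρ → ‖B 1 x‖ = ρ ∧
              ∃ w : ℂ, w.re ≤ 2 * |w.im| ∧ ‖u (B 1 x) - w‖ ≤ κ₂ * ρ) := by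
  obtain ⟨CA, hCA, κ₁, hκ₁, C, A, hCM, hCo, hCc, hCκ, hAc, hA⟩ :=
    exists_central_sweep hsep hu hT hκ₂
  have hM0 : ∀ x ∈ affCompl lam 0, 0 < ‖x‖ := fun x hx =>
    norm_pos_iff.2 (ne_zero_of_mem_affCompl_zero hsep hx)
  have hκs : ∀ ρ > 0, ∀ x : E, κ₁ * ‖x‖ ≤ (u x).re → (u x).re ≤ κ₁ / (2 * CA) * ρ →
      CA * ‖x‖ ≤ ρ / 2 := by
    intro ρ hρ x h1 h2
    have h3 := h1.trans h2
    have h4 : κ₁ / (2 * CA) * ρ = κ₁ * (ρ / (2 * CA)) := by ring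
    rw [h4] at h3
    have h5 := le_of_mul_le_mul_left h3 hκ₁
    rw [le_div_iff₀ (by positivity)] at h5
    linarith
  refine ⟨κ₁ / (2 * CA), by positivity, C, hCM, hCo, fun ρ hρ => ?_⟩
  have hCρ : ∀ x ∈ C, (u x).re ≤ κ₁ / (2 * CA) * ρ → ‖x‖ ≤ ρ / 2 := fun x hx hxu =>
    (le_mul_of_one_le_left (norm_nonneg x) hCA).trans (hκs ρ hρ x (hCκ x hx) hxu)
  refine ⟨hCρ, ?_, ?_⟩
  · obtain ⟨k, k1, k2, k3, k4⟩ := hCc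
    refine ⟨fun s x => min 1 (ρ / ‖k s x‖) • k s x, ?_, ?_, ?_, ?_⟩
    · have k1' := k1.mono (prod_mono_right (s := Icc (0 : ℝ) 1)
        (inter_subset_left : C ∩ {x | (u x).re ≤ κ₁ / (2 * CA) * ρ} ⊆ C))
      have hc : ContinuousOn (fun q : ℝ × E => min 1 (ρ / ‖k q.1 q.2‖))
          (Icc 0 1 ×ˢ (C ∩ {x | (u x).re ≤ κ₁ / (2 * CA) * ρ})) :=
        ContinuousOn.inf continuousOn_const (continuousOn_const.div k1'.norm
          fun q hq => (hM0 _ (k3 _ hq.1 _ hq.2.1)).ne')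
      exact hc.smul k1'
    · intro x hx
      change min 1 (ρ / ‖k 0 x‖) • k 0 x = x
      rw [k2 x hx.1, min_eq_left, one_smul]
      rw [one_le_div (hM0 x (hCM hx.1))]
      linarith [hCρ x hx.1 hx.2]
    · intro s hs x hx
      have h1 := k3 s hs x hx.1
      have h2 := hM0 _ h1
      refine ⟨smul_mem_affCompl_zero h1 (by positivity), ?_⟩
      rw [Set.mem_ofPred_eq, norm_smul, Real.norm_of_nonneg (by positivity)]
      calc min 1 (ρ / ‖k s x‖) * ‖k s x‖ ≤ ρ / ‖k s x‖ * ‖k s x‖ := by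
            gcongr; exact min_le_right _ _
        _ = ρ := by field_simp
    · intro x hx
      filter_upwards [(k4 x hx.1).filter_mono (nhdsWithin_mono x inter_subset_left)] with y hy
      rw [hy]
  · have hR : ContinuousOn (fun q : ℝ × E => ((1 - q.1) + q.1 * max 1 (ρ / ‖q.2‖)) • q.2)
        (Icc 0 1 ×ˢ affCompl lam 0) := by
      have hc : ContinuousOn (fun q : ℝ × E => max 1 (ρ / ‖q.2‖)) (Icc 0 1 ×ˢ affCompl lam 0) :=
        ContinuousOn.sup continuousOn_const (continuousOn_const.div continuousOn_snd.norm
          fun q hq => (hM0 _ hq.2).ne')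
      have hc' : ContinuousOn (fun q : ℝ × E => (1 - q.1) + q.1 * max 1 (ρ / ‖q.2‖))
          (Icc 0 1 ×ˢ affCompl lam 0) := by fun_prop
      exact hc'.smul continuousOn_snd
    obtain ⟨B, hBc, hB0, hB1, hBs⟩ := exists_homotopy_trans
      (F := A) (F' := fun s v => ((1 - s) + s * max 1 (ρ / ‖v‖)) • v)
      (Z := (affCompl lam 0 \ C) ∩ {x | (u x).re ≤ κ₁ / (2 * CA) * ρ}) (Z' := affCompl lam 0)
      (hAc.mono (prod_mono_right inter_subset_left)) hR
      (fun x hx => ((hA x hx.1).2.2 1 ⟨zero_le_one, le_rfl⟩).1) (by simp)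
    have hRpos : ∀ s ∈ Icc (0 : ℝ) 1, ∀ v : E, 0 < (1 - s) + s * max 1 (ρ / ‖v‖) := by
      intro s hs v
      have h1 : s * 1 ≤ s * max 1 (ρ / ‖v‖) := mul_le_mul_of_nonneg_left (le_max_left _ _) hs.1
      linarith
    refine ⟨B, hBc, fun x hx hxu => ?_⟩
    obtain ⟨hA0, hA1, hAs⟩ := hA x hx
    have hfar : ρ ≤ ‖x‖ → ∀ s ∈ Icc (0 : ℝ) 1, A s x = x := by
      intro hxρ s hs
      refine (hAs s hs).2.2 ?_
      by_contra! h
      have := hκs ρ hρ x h hxu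
      have := (le_mul_of_one_le_left (norm_nonneg x) hCA)
      linarith
    have hnear : ‖x‖ ≤ ρ → ∀ s ∈ Icc (0 : ℝ) 1, ‖A s x‖ ≤ ρ := by
      intro hxρ s hs
      rcases lt_or_ge (u x).re (κ₁ * ‖x‖) with h | h
      · rwa [(hAs s hs).2.2 h]
      · have := hκs ρ hρ x h hxu
        linarith [(hAs s hs).2.1]
    have h1I : (1 : ℝ) ∈ Icc (0 : ℝ) 1 := ⟨zero_le_one, le_rfl⟩
    have hv := hM0 _ (hAs 1 h1I).1
    refine ⟨by rw [hB0, hA0], fun s hs => ⟨?_, fun hxρ => ?_, fun hxρ => ?_⟩, fun hxρ => ?_⟩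
    · rcases hBs s hs x with ⟨s', hs', h⟩ | ⟨s', hs', h⟩
      · rw [h]; exact (hAs s' hs').1
      · rw [h]; exact smul_mem_affCompl_zero (hAs 1 h1I).1 (hRpos s' hs' _).ne'
    · rcases hBs s hs x with ⟨s', hs', h⟩ | ⟨s', hs', h⟩
      · rw [h, hfar hxρ s' hs']
      · rw [h, hfar hxρ 1 h1I, max_eq_left]
        · simp
        · rw [div_le_one (by linarith)]; exact hxρ
    · rcases hBs s hs x with ⟨s', hs', h⟩ | ⟨s', hs', h⟩
      · rw [h]; exact hnear hxρ s' hs'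
      · have h2 := hnear hxρ 1 h1I
        rw [h, max_eq_right (by rwa [one_le_div hv]), norm_smul, Real.norm_eq_abs, abs_of_nonneg,
          add_mul, mul_assoc, div_mul_cancel₀ _ hv.ne']
        · have := mul_le_mul_of_nonneg_left h2 (sub_nonneg.2 hs'.2)
          linarith
        · have := hs'.1
          have := sub_nonneg.2 hs'.2
          positivity
    · have h2 := hnear hxρ 1 h1I
      obtain ⟨w, hw1, hw2⟩ := hA1
      have h3 : B 1 x = (ρ / ‖A 1 x‖) • A 1 x := by
        rw [hB1, max_eq_right (by rwa [one_le_div hv])]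
        simp
      have h4 : 0 < ρ / ‖A 1 x‖ := by positivity
      refine ⟨?_, ((ρ / ‖A 1 x‖ : ℝ) : ℂ) * w, ?_, ?_⟩
      · rw [h3, norm_smul, Real.norm_of_nonneg h4.le, div_mul_cancel₀ _ hv.ne']
      · rw [Complex.re_ofReal_mul, Complex.im_ofReal_mul, abs_mul, abs_of_pos h4]
        have := mul_le_mul_of_nonneg_left hw1 h4.le
        linarith
      · rw [h3, ← Complex.coe_smul, map_smul, smul_eq_mul, ← mul_sub, norm_mul,
          Complex.norm_of_nonneg h4.le]
        calc ρ / ‖A 1 x‖ * ‖u (A 1 x) - w‖ ≤ ρ / ‖A 1 x‖ * (κ₂ * ‖A 1 x‖) := by gcongr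
          _ = κ₂ * ρ := by field_simp

end

section

open Set Filter Topology

theorem ContractsIn.of_locallyConst {E J : Type*} [TopologicalSpace E] {A N : Set E} {P : E → J}
    (hP : ∀ x ∈ A, ∀ᶠ y in 𝓝[A] x, P y = P x)
    (h : ∀ x ∈ A, ContractsIn (A ∩ {y | P y = P x}) N) : ContractsIn A N := by
  have h' : ∀ j, ∃ K : ℝ → E → E, j ∈ P '' A →
      ContinuousOn (fun q : ℝ × E => K q.1 q.2) (Icc 0 1 ×ˢ (A ∩ {y | P y = j})) ∧
      (∀ x ∈ A ∩ {y | P y = j}, K 0 x = x) ∧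
      (∀ s ∈ Icc (0 : ℝ) 1, ∀ x ∈ A ∩ {y | P y = j}, K s x ∈ N) ∧
      ∀ x ∈ A ∩ {y | P y = j}, ∀ᶠ y in 𝓝[A ∩ {y | P y = j}] x, K 1 y = K 1 x := by
    intro j
    by_cases hj : j ∈ P '' A
    · obtain ⟨x, hx, rfl⟩ := hj
      obtain ⟨K, hK⟩ := h x hx
      exact ⟨K, fun _ => hK⟩
    · exact ⟨fun _ x => x, fun h => absurd h hj⟩
  choose K hK using h'
  have hmem : ∀ x ∈ A, 𝓝[A ∩ {y | P y = P x}] x = 𝓝[A] x := by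
    intro x hx
    refine le_antisymm (nhdsWithin_mono _ inter_subset_left) ?_
    exact le_inf inf_le_left (le_principal_iff.2 (by
      filter_upwards [hP x hx, self_mem_nhdsWithin] with y h1 h2 using ⟨h2, h1⟩))
  refine ⟨fun s x => K (P x) s x, ?_, ?_, ?_, ?_⟩
  · rintro ⟨s, x⟩ ⟨hs, hx⟩
    have h1 := (hK (P x) ⟨x, hx, rfl⟩).1 (s, x) ⟨hs, hx, rfl⟩
    have h2 : 𝓝[Icc (0 : ℝ) 1 ×ˢ (A ∩ {y | P y = P x})] (s, x) = 𝓝[Icc (0 : ℝ) 1 ×ˢ A] (s, x) := by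
      rw [nhdsWithin_prod_eq, nhdsWithin_prod_eq, hmem x hx]
    rw [ContinuousWithinAt, h2] at h1
    refine h1.congr' ?_
    rw [nhdsWithin_prod_eq]
    filter_upwards [(hP x hx).prod_inr (𝓝[Icc (0 : ℝ) 1] s)] with q hq
    rw [hq]
  · exact fun x hx => (hK _ ⟨x, hx, rfl⟩).2.1 x ⟨hx, rfl⟩
  · exact fun s hs x hx => (hK _ ⟨x, hx, rfl⟩).2.2.1 s hs x ⟨hx, rfl⟩
  · intro x hx
    have h1 := (hK (P x) ⟨x, hx, rfl⟩).2.2.2 x ⟨hx, rfl⟩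
    rw [hmem x hx] at h1
    filter_upwards [h1, hP x hx] with y hy hy'
    rw [hy', hy]

/-- The local model of the sweep near a vertex `p`. -/
theorem exists_vertex_pair {E ι : Type*} [NormedAddCommGroup E] [NormedSpace ℂ E]
    [FiniteDimensional ℂ E] [Nontrivial E] [Fintype ι]
    {lam : ι → E →L[ℂ] ℂ} {b : ι → ℂ} {u : E →L[ℂ] ℂ} (hu : GenericFor lam u)
    {p : E} (hp : p ∈ arrVertices lam b)
    (hT : ∀ (J : Set ι) (E' : Submodule ℂ E) (lam' : J → E' →L[ℂ] ℂ) (b' : J → ℂ)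
      (u' : E' →L[ℂ] ℂ), Module.finrank ℂ E' + 1 = Module.finrank ℂ E → GenericFor lam' u' →
      HasSweep lam' b' u')
    {κ₂ : ℝ} (hκ₂ : 0 < κ₂) {a : ℂ} (ha : a ≠ 0) :
    ∃ κ > (0 : ℝ), ∃ r > (0 : ℝ), ∃ C : Set E,
      (∀ x ∈ C, ‖x - p‖ < r → x ∈ affCompl lam b) ∧
      IsOpen ((affCompl lam b ∩ {x | ‖x - p‖ < r}) \ C) ∧
      ∀ ρ > (0 : ℝ), ρ < r → (∀ x ∈ C, (a * u (x - p)).re ≤ κ * ρ → ‖x - p‖ ≤ ρ / 2) ∧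
        ContractsIn (C ∩ {x | (a * u (x - p)).re ≤ κ * ρ}) (affCompl lam b) ∧
        ∃ B : ℝ → E → E, ContinuousOn (fun q : ℝ × E => B q.1 q.2)
            (Icc 0 1 ×ˢ ((affCompl lam b \ C) ∩
              {x | (a * u (x - p)).re ≤ κ * ρ ∧ ‖x - p‖ ≤ ρ})) ∧
          ∀ x ∈ affCompl lam b \ C, (a * u (x - p)).re ≤ κ * ρ → ‖x - p‖ ≤ ρ → B 0 x = x ∧
            (∀ s ∈ Icc (0 : ℝ) 1, B s x ∈ affCompl lam b ∧ ‖B s x - p‖ ≤ ρ ∧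
              (‖x - p‖ = ρ → B s x = x)) ∧
            ‖B 1 x - p‖ = ρ ∧
              ∃ w : ℂ, w.re ≤ 2 * |w.im| ∧ ‖a * u (B 1 x - p) - w‖ ≤ κ₂ * ρ := by
  classical
  let J : Set ι := {i | lam i p + b i = 0}
  let lam' : J → E →L[ℂ] ℂ := fun i => lam i
  have hsep : Separating lam' univ := fun x hx => hp x fun i hi => hx ⟨i, hi⟩ (mem_univ _)
  have hu' : GenericFor lam' (a • u) := by
    intro S hS
    obtain ⟨e, he, hue⟩ := hu (Subtype.val '' S) fun h => hS fun x hx => h x (by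
      rintro _ ⟨i, hi, rfl⟩
      exact hx i hi)
    refine ⟨a⁻¹ • e, fun i hi => ?_, ?_⟩
    · change lam i (a⁻¹ • e) = 0
      rw [map_smul, he i ⟨i, hi, rfl⟩, smul_zero]
    · rw [smul_apply, map_smul, hue, smul_eq_mul, smul_eq_mul, mul_one,
        mul_inv_cancel₀ ha]
  obtain ⟨κ, hκ, C, hCM, hCo, hC⟩ := exists_central_pair hsep hu' (hT J) hκ₂
  obtain ⟨r, hr, hrN⟩ : ∃ r > 0, ∀ x : E, ‖x - p‖ < r →
      ∀ i ∉ J, lam i x + b i ≠ 0 := by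
    have ho : IsOpen (⋂ i : (Jᶜ : Set ι), {x : E | lam i x + b i ≠ 0}) :=
      isOpen_iInter_of_finite fun i => isOpen_ne_fun (by fun_prop) continuous_const
    obtain ⟨r, hr, h⟩ := Metric.isOpen_iff.1 ho p (mem_iInter.2 fun i => i.2)
    refine ⟨r, hr, fun x hx i hi => ?_⟩
    exact mem_iInter.1 (h (mem_ball_iff_norm.2 hx)) ⟨i, hi⟩
  have hval : ∀ x : E, ∀ i : J, lam' i (x - p) = lam i x + b i := by
    intro x i
    have h : lam i p + b i = 0 := i.2
    change lam i (x - p) = _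
    rw [map_sub]
    linear_combination -h
  have hM : ∀ x ∈ affCompl lam b, x - p ∈ affCompl lam' 0 := by
    intro x hx i
    rw [hval, Pi.zero_apply, add_zero]
    exact hx i
  have hN : ∀ x, ‖x - p‖ < r → x - p ∈ affCompl lam' 0 → x ∈ affCompl lam b := by
    intro x hx h i
    by_cases hi : i ∈ J
    · have := h ⟨i, hi⟩
      rwa [hval, Pi.zero_apply, add_zero] at this
    · exact hrN x hx i hi
  have hu_eq : ∀ v, (a • u) v = a * u v := fun v => rfl
  refine ⟨κ, hκ, r, hr, {x | x - p ∈ C}, fun x hx hxr => hN x hxr (hCM hx), ?_,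
    fun ρ hρ hρr => ?_⟩
  · have : (affCompl lam b ∩ {x | ‖x - p‖ < r}) \ {x | x - p ∈ C} =
        {x | ‖x - p‖ < r} ∩ (fun x => x - p) ⁻¹' (affCompl lam' 0 \ C) := by
      ext x
      constructor
      · rintro ⟨⟨h1, h2⟩, h3⟩
        exact ⟨h2, hM x h1, h3⟩
      · rintro ⟨h2, h1, h3⟩
        exact ⟨⟨hN x h2 h1, h2⟩, h3⟩
    rw [this]
    exact (isOpen_lt (by fun_prop) continuous_const).inter (hCo.preimage (by fun_prop))
  · obtain ⟨hC1, ⟨k, k1, k2, k3, k4⟩, B, hBc, hB⟩ := hC ρ hρ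
    have hNρ : ∀ v : E, ‖v‖ ≤ ρ → v ∈ affCompl lam' 0 → p + v ∈ affCompl lam b := by
      intro v hv hvM
      refine hN _ ?_ ?_
      · rw [add_sub_cancel_left]; linarith
      · rwa [add_sub_cancel_left]
    refine ⟨fun x hx => hC1 (x - p) hx, ⟨fun s x => p + k s (x - p), ?_, ?_, ?_, ?_⟩,
      fun s x => p + B s (x - p), ?_, ?_⟩
    · refine continuousOn_const.add
        (k1.comp (f := fun q : ℝ × E => (q.1, q.2 - p)) (by fun_prop) ?_)
      exact fun q hq => ⟨hq.1, hq.2⟩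
    · intro x hx
      simp only
      rw [k2 (x - p) hx, add_sub_cancel]
    · intro s hs x hx
      have := k3 s hs (x - p) hx
      exact hNρ _ this.2 this.1
    · intro x hx
      have ht : Tendsto (fun y : E => y - p)
          (𝓝[{x | x - p ∈ C} ∩ {x | (a * u (x - p)).re ≤ κ * ρ}] x)
          (𝓝[C ∩ {v | ((a • u) v).re ≤ κ * ρ}] (x - p)) :=
        tendsto_nhdsWithin_of_tendsto_nhds_of_eventually_within _
          ((continuous_id.sub continuous_const).continuousWithinAt)
          (eventually_mem_nhdsWithin.mono fun y hy => hy)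
      filter_upwards [ht.eventually (k4 (x - p) hx)] with y hy
      rw [hy]
    · refine continuousOn_const.add
        (hBc.comp (f := fun q : ℝ × E => (q.1, q.2 - p)) (by fun_prop) ?_)
      exact fun q hq => ⟨hq.1, ⟨hM _ hq.2.1.1, hq.2.1.2⟩, hq.2.2.1⟩
    · intro x hx hxu hxρ
      obtain ⟨h1, h2, h3⟩ := hB (x - p) ⟨hM _ hx.1, hx.2⟩ hxu
      refine ⟨by simp only [h1, add_sub_cancel], fun s hs => ?_, ?_⟩
      · obtain ⟨h4, h5, h6⟩ := h2 s hs
        refine ⟨hNρ _ (h6 hxρ) h4, by rw [add_sub_cancel_left]; exact h6 hxρ, fun h => ?_⟩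
        simp only [h5 h.ge, add_sub_cancel]
      · rw [add_sub_cancel_left]
        exact h3 hxρ

end

section

open Set Filter Topology

/-- `z` points within angle about `δ` of `t`. -/
def NearDir (δ : ℝ) (t z : ℂ) : Prop := ‖(‖t‖ : ℂ) * z - ‖z‖ * t‖ ≤ δ * ‖t‖ * ‖z‖

theorem NearDir.of_norm_sub {δ : ℝ} {t z : ℂ} (h : 2 * ‖z - t‖ ≤ δ * ‖z‖) : NearDir δ t z := by
  have h1 : (‖t‖ : ℂ) * z - ‖z‖ * t = ‖t‖ * (z - t) + ((‖t‖ - ‖z‖ : ℝ) : ℂ) * t := by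
    push_cast; ring
  have h2 : |‖t‖ - ‖z‖| ≤ ‖z - t‖ := by
    rw [norm_sub_rev]; exact abs_norm_sub_norm_le t z
  rw [NearDir, h1]
  refine (norm_add_le _ _).trans ?_
  rw [norm_mul, norm_mul, Complex.norm_real, Complex.norm_real, norm_norm, Real.norm_eq_abs]
  have h3 := mul_le_mul_of_nonneg_right h2 (norm_nonneg t)
  have h4 := mul_le_mul_of_nonneg_left h (norm_nonneg t)
  linarith

theorem nearDir_smul_iff {δ : ℝ} {t z : ℂ} {r : ℝ} (hr : 0 < r) :
    NearDir δ t (r * z) ↔ NearDir δ t z := by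
  have h : (‖t‖ : ℂ) * (r * z) - ‖(r : ℂ) * z‖ * t = r * (‖t‖ * z - ‖z‖ * t) := by
    rw [norm_mul, Complex.norm_of_nonneg hr.le]; push_cast; ring
  rw [NearDir, NearDir, h, norm_mul, norm_mul, Complex.norm_of_nonneg hr.le,
    show δ * ‖t‖ * (r * ‖z‖) = r * (δ * ‖t‖ * ‖z‖) by ring]
  exact mul_le_mul_iff_of_pos_left hr

theorem NearDir.norm_dir_sub_le {δ : ℝ} {t t' z : ℂ} (ht : t ≠ 0) (ht' : t' ≠ 0) (hz : z ≠ 0)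
    (h : NearDir δ t z) (h' : NearDir δ t' z) : ‖t / ‖t‖ - t' / ‖t'‖‖ ≤ 2 * δ := by
  have key : ∀ s : ℂ, s ≠ 0 → NearDir δ s z → ‖z / ‖z‖ - s / ‖s‖‖ ≤ δ := by
    intro s hs h
    have hs' := norm_pos_iff.2 hs
    have hz' := norm_pos_iff.2 hz
    have hsc : (‖s‖ : ℂ) ≠ 0 := by exact_mod_cast hs'.ne'
    have hzc : (‖z‖ : ℂ) ≠ 0 := by exact_mod_cast hz'.ne'
    have h1 : z / ‖z‖ - s / ‖s‖ = ((‖s‖ : ℂ) * z - ‖z‖ * s) / (‖s‖ * ‖z‖) := by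
      field_simp
    rw [h1, norm_div, norm_mul, Complex.norm_real, Complex.norm_real, norm_norm, norm_norm,
      div_le_iff₀ (by positivity)]
    rw [← mul_assoc]
    exact h
  have h1 := key t ht h
  have h2 := key t' ht' h'
  have h3 : t / ‖t‖ - t' / ‖t'‖ = (z / ‖z‖ - t' / ‖t'‖) - (z / ‖z‖ - t / ‖t‖) := by ring
  rw [h3]
  refine (norm_sub_le _ _).trans ?_
  linarith

theorem exists_sector_width {T : Set ℂ} (hT : T.Finite) (h0 : ∀ t ∈ T, t ≠ 0)
    (hdir : ∀ t ∈ T, ∀ t' ∈ T, t / ‖t‖ = t' / ‖t'‖ → t = t') :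
    ∃ δ > 0, ∀ t ∈ T, ∀ t' ∈ T, ∀ z : ℂ, z ≠ 0 → NearDir (2 * δ) t z → NearDir (2 * δ) t' z →
      t = t' := by
  have h1 : ∀ q ∈ T ×ˢ T, ∃ δ > 0, q.1 ≠ q.2 → 4 * δ < ‖q.1 / ‖q.1‖ - q.2 / ‖q.2‖‖ := by
    rintro ⟨t, t'⟩ ⟨ht, ht'⟩
    by_cases h : t = t'
    · exact ⟨1, one_pos, fun h' => absurd h h'⟩
    · have h2 : 0 < ‖t / ‖t‖ - t' / ‖t'‖‖ :=
        norm_pos_iff.2 (sub_ne_zero.2 fun h' => h (hdir t ht t' ht' h'))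
      exact ⟨‖t / ‖t‖ - t' / ‖t'‖‖ / 8, by positivity, fun _ => by simp only; linarith⟩
  choose! d hd hd' using h1
  obtain ⟨δ, hδ, hδd⟩ : ∃ δ > 0, ∀ q ∈ T ×ˢ T, δ ≤ d q := by
    rcases (T ×ˢ T).eq_empty_or_nonempty with h | h
    · exact ⟨1, one_pos, by simp [h]⟩
    · obtain ⟨q, hq, hmin⟩ := (hT.prod hT).exists_minimalFor d _ h
      refine ⟨d q, hd q hq, fun q' hq' => ?_⟩
      by_contra! hlt
      exact absurd (hmin hq' hlt.le) (not_le.2 hlt)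
  refine ⟨δ, hδ, fun t ht t' ht' z hz h h' => ?_⟩
  by_contra hne
  have h2 := h.norm_dir_sub_le (h0 t ht) (h0 t' ht') hz h'
  have h3 := hd' (t, t') ⟨ht, ht'⟩ hne
  have h4 := hδd (t, t') ⟨ht, ht'⟩
  simp only at h3
  linarith

/-- A radial contraction of the plane pulling each sector around `t ∈ T` into the disc of radius
`‖t‖ + ε`, without crossing `T`. -/
theorem exists_radial_shrink {T : Set ℂ} (hT : T.Finite) (h0 : ∀ t ∈ T, t ≠ 0) {δ : ℝ}
    (hδ : 0 < δ) (hδT : ∀ t ∈ T, ∀ t' ∈ T, ∀ z : ℂ, z ≠ 0 → NearDir (2 * δ) t z →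
      NearDir (2 * δ) t' z → t = t') {ε : ℝ} (hε : 0 < ε) :
    ∃ φ : ℂ → ℝ, ∃ η > 0, Continuous φ ∧ (∀ z, 0 ≤ φ z ∧ φ z ≤ 1) ∧
      (∀ z : ℂ, ∀ t ∈ T, NearDir δ t ((1 - φ z : ℝ) * z) → ‖(1 - φ z : ℝ) * z‖ ≤ ‖t‖ + ε) ∧
      ∀ z : ℂ, φ z = 0 ∨ ∀ s ∈ Icc (0 : ℝ) 1, ∀ t ∈ T, η ≤ ‖(1 - s * φ z : ℝ) * z - t‖ := by
  classical
  let χ : ℂ → ℂ → ℝ := fun t z =>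
    max 0 (min 1 (2 - ‖(‖t‖ : ℂ) * z - ‖z‖ * t‖ / (δ * ‖t‖ * max ‖z‖ ‖t‖)))
  let m : ℂ → ℂ → ℝ := fun t z => max 0 (‖z‖ - ‖t‖ - ε) / max ‖z‖ ‖t‖
  have hpos : ∀ t ∈ T, ∀ z : ℂ, 0 < max ‖z‖ ‖t‖ := fun t ht z =>
    lt_max_of_lt_right (norm_pos_iff.2 (h0 t ht))
  have hχ0 : ∀ t z, 0 ≤ χ t z := fun t z => le_max_left _ _
  have hχ1 : ∀ t z, χ t z ≤ 1 := fun t z => max_le zero_le_one (min_le_left _ _)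
  have hm0 : ∀ t z, 0 ≤ m t z := fun t z =>
    div_nonneg (le_max_left _ _) ((norm_nonneg z).trans (le_max_left _ _))
  have hm1 : ∀ t z, m t z ≤ 1 := by
    intro t z
    refine div_le_one_of_le₀ (max_le ((norm_nonneg z).trans (le_max_left _ _)) ?_)
      ((norm_nonneg z).trans (le_max_left _ _))
    have := le_max_left ‖z‖ ‖t‖
    have := norm_nonneg t
    linarith
  have hχm : ∀ t z, 0 ≤ 1 - χ t z * m t z ∧ 1 - χ t z * m t z ≤ 1 := by
    intro t z
    have h1 := mul_le_one₀ (hχ1 t z) (hm0 t z) (hm1 t z)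
    have h2 := mul_nonneg (hχ0 t z) (hm0 t z)
    constructor <;> linarith
  have hχc : ∀ t ∈ T, Continuous (χ t) := by
    intro t ht
    have h1 : Continuous fun z : ℂ =>
        ‖(‖t‖ : ℂ) * z - ‖z‖ * t‖ / (δ * ‖t‖ * max ‖z‖ ‖t‖) := by
      refine Continuous.div (by fun_prop) (by fun_prop) fun z => ?_
      have := hpos t ht z
      have := norm_pos_iff.2 (h0 t ht)
      positivity
    fun_prop
  have hmc : ∀ t ∈ T, Continuous (m t) := fun t ht =>
    Continuous.div (by fun_prop) (by fun_prop) fun z => (hpos t ht z).ne'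
  have hact : ∀ t ∈ T, ∀ z, χ t z * m t z ≠ 0 → ‖t‖ + ε < ‖z‖ ∧ NearDir (2 * δ) t z := by
    intro t ht z h
    have h1 : ‖t‖ + ε < ‖z‖ := by
      by_contra! h2
      refine right_ne_zero_of_mul h ?_
      simp only [m]
      rw [max_eq_left (by linarith), zero_div]
    refine ⟨h1, ?_⟩
    by_contra h2
    refine left_ne_zero_of_mul h (max_eq_left ((min_le_right _ _).trans ?_))
    have ht' := norm_pos_iff.2 (h0 t ht)
    have hz' := hpos t ht z
    rw [max_eq_left (by linarith : ‖t‖ ≤ ‖z‖)] at hz' ⊢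
    rw [NearDir, not_le] at h2
    rw [sub_nonpos, le_div_iff₀ (by positivity)]
    linarith
  let L : ℂ → ℝ := fun z => ∏ t ∈ hT.toFinset, (1 - χ t z * m t z)
  have hL0 : ∀ z, 0 ≤ L z := fun z => Finset.prod_nonneg fun t _ => (hχm t z).1
  have hL1 : ∀ z, L z ≤ 1 := fun z =>
    Finset.prod_le_one (fun t _ => (hχm t z).1) fun t _ => (hχm t z).2
  have hLle : ∀ z, ∀ t ∈ T, L z ≤ 1 - χ t z * m t z := by
    intro z t ht
    simp only [L]
    rw [← Finset.mul_prod_erase _ _ (hT.mem_toFinset.2 ht)]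
    exact mul_le_of_le_one_right (hχm t z).1
      (Finset.prod_le_one (fun t _ => (hχm t z).1) fun t _ => (hχm t z).2)
  obtain ⟨μ, hμ, hμT⟩ : ∃ μ > 0, ∀ t ∈ T, μ ≤ ‖t‖ := by
    rcases T.eq_empty_or_nonempty with h | h
    · exact ⟨1, one_pos, by simp [h]⟩
    · obtain ⟨q, hq, hmin⟩ := hT.exists_minimalFor (fun t : ℂ => ‖t‖) _ h
      refine ⟨‖q‖, norm_pos_iff.2 (h0 q hq), fun q' hq' => ?_⟩
      by_contra! hlt
      exact absurd (hmin hq' hlt.le) (not_le.2 hlt)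
  have hηpos : 0 < min (ε / 2) (min (μ / 2) (δ * μ / 4)) := by positivity
  refine ⟨fun z => 1 - L z, min (ε / 2) (min (μ / 2) (δ * μ / 4)), hηpos, ?_,
    fun z => ⟨by linarith [hL1 z], by linarith [hL0 z]⟩, ?_, ?_⟩
  · refine continuous_const.sub (continuous_finsetProd _ fun t ht => ?_)
    have ht' := hT.mem_toFinset.1 ht
    exact continuous_const.sub ((hχc t ht').mul (hmc t ht'))
  · intro z t ht h
    simp only [sub_sub_cancel] at h ⊢
    have ht' := norm_pos_iff.2 (h0 t ht)
    rw [norm_mul, Complex.norm_of_nonneg (hL0 z)]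
    rcases (hL0 z).eq_or_lt with hz | hz
    · rw [← hz, zero_mul]; positivity
    rw [nearDir_smul_iff hz] at h
    rcases le_or_gt ‖z‖ (‖t‖ + ε) with h1 | h1
    · exact (mul_le_of_le_one_left (norm_nonneg z) (hL1 z)).trans h1
    have hz' : 0 < ‖z‖ := by linarith
    have h2 : χ t z = 1 := by
      simp only [χ]
      rw [max_eq_left (by linarith : ‖t‖ ≤ ‖z‖), min_eq_left, max_eq_right zero_le_one]
      have : ‖(‖t‖ : ℂ) * z - ‖z‖ * t‖ / (δ * ‖t‖ * ‖z‖) ≤ 1 := by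
        rw [div_le_one (by positivity)]; exact h
      linarith
    have h3 : m t z = (‖z‖ - ‖t‖ - ε) / ‖z‖ := by
      simp only [m]
      rw [max_eq_left (by linarith : ‖t‖ ≤ ‖z‖), max_eq_right (by linarith)]
    calc L z * ‖z‖ ≤ (1 - χ t z * m t z) * ‖z‖ :=
          mul_le_mul_of_nonneg_right (hLle z t ht) hz'.le
      _ = ‖t‖ + ε := by rw [h2, h3]; field_simp; ring
  · intro z
    by_cases hall : ∀ t ∈ T, χ t z * m t z = 0
    · left
      have : L z = 1 := Finset.prod_eq_one fun t ht => by
        rw [hall t (hT.mem_toFinset.1 ht), sub_zero]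
      simp [this]
    · right
      push Not at hall
      obtain ⟨t, ht, htz⟩ := hall
      obtain ⟨h1, h2⟩ := hact t ht z htz
      have ht' := norm_pos_iff.2 (h0 t ht)
      have hz' : 0 < ‖z‖ := by linarith
      have hL : L z = 1 - χ t z * m t z := by
        refine Finset.prod_eq_single_of_mem t (hT.mem_toFinset.2 ht) fun t' ht1 hne => ?_
        by_contra h3
        have h4 := hact t' (hT.mem_toFinset.1 ht1) z fun h => h3 (by rw [h, sub_zero])
        exact hne (hδT t' (hT.mem_toFinset.1 ht1) t ht z (norm_pos_iff.1 hz') h4.2 h2)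
      have hLm : ‖t‖ + ε ≤ L z * ‖z‖ := by
        have h3 : m t z = (‖z‖ - ‖t‖ - ε) / ‖z‖ := by
          simp only [m]
          rw [max_eq_left (by linarith : ‖t‖ ≤ ‖z‖), max_eq_right (by linarith)]
        have h4 : χ t z * m t z ≤ m t z := mul_le_of_le_one_left (hm0 t z) (hχ1 t z)
        have h5 : (1 - m t z) * ‖z‖ = ‖t‖ + ε := by rw [h3]; field_simp; ring
        rw [← h5, hL]
        gcongr
      intro s hs t' ht1
      have hθ : L z ≤ 1 - s * (1 - L z) := by
        have := mul_le_of_le_one_left (sub_nonneg.2 (hL1 z)) hs.2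
        linarith
      set θ : ℝ := 1 - s * (1 - L z)
      have hθz : ‖t‖ + ε ≤ θ * ‖z‖ := hLm.trans (by gcongr)
      have hθ0 : 0 < θ := by
        by_contra! h
        have := mul_nonpos_of_nonpos_of_nonneg h hz'.le
        linarith
      have hnorm : ‖(θ : ℂ) * z‖ = θ * ‖z‖ := by
        rw [norm_mul, Complex.norm_of_nonneg hθ0.le]
      by_cases htt : t' = t
      · subst htt
        refine (min_le_left _ _).trans ?_
        have := norm_sub_norm_le ((θ : ℂ) * z) t'
        linarith
      · by_contra! hlt
        refine htt (hδT t' ht1 t ht z (norm_pos_iff.1 hz') ?_ h2)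
        rw [← nearDir_smul_iff hθ0]
        refine NearDir.of_norm_sub ?_
        have h5 : ‖(θ : ℂ) * z - t'‖ < μ / 2 :=
          hlt.trans_le ((min_le_right _ _).trans (min_le_left _ _))
        have h6 : ‖(θ : ℂ) * z - t'‖ < δ * μ / 4 :=
          hlt.trans_le ((min_le_right _ _).trans (min_le_right _ _))
        have h7 := norm_sub_norm_le t' ((θ : ℂ) * z)
        rw [norm_sub_rev] at h7
        have h8 := hμT t' ht1
        have h9 : μ / 2 ≤ ‖(θ : ℂ) * z‖ := by linarith
        have h10 := mul_le_mul_of_nonneg_left h9 hδ.le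
        have h11 : 0 ≤ δ * ‖(θ : ℂ) * z‖ := by positivity
        linarith

end

section

open Set Filter Topology

/-- Radial compression of the values of `u`, lifted along a transverse field. -/
theorem exists_radial_homotopy {E : Type*} [NormedAddCommGroup E] [NormedSpace ℂ E]
    {u : E →L[ℂ] ℂ} {c : ℂ} {N V : Set E} {K : ℝ}
    (hF : ∀ ρ > (0 : ℝ), ∃ η > (0 : ℝ), ∃ e : E → E,
      ContinuousOn e {x | ∀ p ∈ V, ρ ≤ ‖x - p‖} ∧
      ∀ x, (∀ p ∈ V, ρ ≤ ‖x - p‖) → u (e x) = 1 ∧ ‖e x‖ ≤ K ∧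
        (x ∈ N → ∀ z : ℂ, ‖z‖ ≤ η → x + z • e x ∈ N))
    {φ : ℂ → ℝ} (hφc : Continuous φ) (hφ : ∀ z, 0 ≤ φ z ∧ φ z ≤ 1) {η₀ : ℝ} (hη₀ : 0 < η₀)
    (hφη : ∀ z : ℂ, φ z = 0 ∨ ∀ s ∈ Icc (0 : ℝ) 1, ∀ p ∈ V,
      η₀ ≤ ‖(1 - s * φ z : ℝ) * z - (u p - c)‖) :
    ∃ G : ℝ → E → E, ContinuousOn (fun q : ℝ × E => G q.1 q.2) (Icc 0 1 ×ˢ N) ∧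
      (∀ y ∈ N, G 0 y = y) ∧ ∀ s ∈ Icc (0 : ℝ) 1, ∀ y ∈ N, G s y ∈ N ∧
        u (G s y) - c = (1 - s * φ (u y - c) : ℝ) * (u y - c) ∧
        ‖G s y - y‖ ≤ K * (s * φ (u y - c) * ‖u y - c‖) := by
  classical
  have hρ : 0 < η₀ / (‖u‖ + 1) := by positivity
  obtain ⟨η, hη, e, hec, he⟩ := hF _ hρ
  let Q : Set E := {x | ∀ s ∈ Icc (0 : ℝ) 1, ∀ p ∈ V,
    η₀ ≤ ‖(1 - s * φ (u x - c) : ℝ) * (u x - c) - (u p - c)‖}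
  have hQ : IsClosed Q := by
    have : Q = ⋂ s ∈ Icc (0 : ℝ) 1, ⋂ p ∈ V, {x |
        η₀ ≤ ‖(1 - s * φ (u x - c) : ℝ) * (u x - c) - (u p - c)‖} := by
      ext; simp [Q]
    rw [this]
    exact isClosed_biInter fun s _ => isClosed_biInter fun p _ =>
      isClosed_le continuous_const (by fun_prop)
  obtain ⟨G, hGc, hG0, hG⟩ := exists_sweep (c := c) (N := N) (Z := N ∩ Q)
    (φ := fun y => φ (u y - c)) hη hec
    (fun x hx => (he x hx).1) (fun x hx => (he x hx).2.1) (fun x hx hxR => (he x hxR).2.2 hx)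
    inter_subset_left (by fun_prop) (fun y _ => hφ _) (by
      intro y hy x hx θ hθ1 hθ2 hux _ p hp
      obtain ⟨s, hs, hsθ⟩ : ∃ s ∈ Icc (0 : ℝ) 1, 1 - s * φ (u y - c) = θ := by
        rcases (hφ (u y - c)).1.eq_or_lt with h | h
        · refine ⟨0, ⟨le_rfl, zero_le_one⟩, ?_⟩
          linarith
        · refine ⟨(1 - θ) / φ (u y - c), ⟨div_nonneg (by linarith) h.le, ?_⟩, ?_⟩
          · rw [div_le_one h]; linarith
          · rw [div_mul_cancel₀ _ h.ne']; ring
      have h1 := hy.2 s hs p hp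
      rw [hsθ, ← hux, sub_sub_sub_cancel_right, ← map_sub] at h1
      have h2 := u.le_opNorm (x - p)
      rw [div_le_iff₀ (by positivity)]
      have := norm_nonneg (x - p)
      linarith)
  have hid : ∀ s ∈ Icc (0 : ℝ) 1, ∀ y ∈ N ∩ Q, φ (u y - c) = 0 → G s y = y := by
    intro s hs y hy h
    have := (hG s hs y hy).2.2
    rw [h, mul_zero, zero_mul, mul_zero] at this
    exact sub_eq_zero.1 (norm_le_zero_iff.1 this)
  have hQ' : ∀ y, φ (u y - c) ≠ 0 → y ∈ Q := fun y h => (hφη (u y - c)).resolve_left h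
  refine ⟨fun s y => if φ (u y - c) = 0 then y else G s y, ?_, ?_, ?_⟩
  · refine ContinuousOn.of_closed_cover (F₁ := {q : ℝ × E | φ (u q.2 - c) = 0})
      (F₂ := {q : ℝ × E | q.2 ∈ Q}) ?_ ?_ (isClosed_eq (by fun_prop) continuous_const)
      (hQ.preimage continuous_snd) ?_
    · exact continuousOn_snd.congr fun q hq => if_pos hq.2
    · refine (hGc.mono fun q hq => ⟨hq.1.1, hq.1.2, hq.2⟩).congr fun q hq => ?_
      simp only
      split_ifs with h
      · exact (hid q.1 hq.1.1 q.2 ⟨hq.1.2, hq.2⟩ h).symm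
      · rfl
    · intro q _
      by_cases h : φ (u q.2 - c) = 0
      · exact Or.inl h
      · exact Or.inr (hQ' _ h)
  · intro y hy
    simp only
    split_ifs with h
    · rfl
    · exact hG0 y ⟨hy, hQ' y h⟩
  · intro s hs y hy
    simp only
    split_ifs with h
    · simp [hy, h]
    · exact hG s hs y ⟨hy, hQ' y h⟩

end

section

open Set Filter Topology

/-- Gluing of the local sweeps around finitely many vertices. -/
theorem exists_glued_sweep {E : Type*} [NormedAddCommGroup E]
    {N V W : Set E} {ρ ε₂ : ℝ} (hV : V.Finite) (hNo : IsOpen N) (hWN : W ⊆ N) (hρ : 0 < ρ)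
    (hVsep : ∀ p ∈ V, ∀ p' ∈ V, p ≠ p' → 4 * ρ < ‖p - p'‖)
    {f : E → E → ℝ} {C : E → Set E} {Cone : E → E → Prop}
    (hWf : ∀ x ∈ W, ∀ p ∈ V, ‖x - p‖ ≤ ρ → f p x ≤ ε₂)
    (hCo : ∀ p ∈ V, ∃ r > ρ, IsOpen ((N ∩ {x | ‖x - p‖ < r}) \ C p))
    (hCf : ∀ p ∈ V, ∀ x ∈ C p, f p x ≤ ε₂ → ‖x - p‖ ≤ ρ / 2)
    (hCc : ∀ p ∈ V, ContractsIn (C p ∩ {x | f p x ≤ ε₂}) N)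
    (hB : ∀ p ∈ V, ∃ B : ℝ → E → E, ContinuousOn (fun q : ℝ × E => B q.1 q.2)
        (Icc 0 1 ×ˢ ((N \ C p) ∩ {x | f p x ≤ ε₂ ∧ ‖x - p‖ ≤ ρ})) ∧
      ∀ x ∈ N \ C p, f p x ≤ ε₂ → ‖x - p‖ ≤ ρ → B 0 x = x ∧
        (∀ s ∈ Icc (0 : ℝ) 1, B s x ∈ N ∧ ‖B s x - p‖ ≤ ρ ∧ (‖x - p‖ = ρ → B s x = x)) ∧
        ‖B 1 x - p‖ = ρ ∧ Cone p (B 1 x)) :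
    ∃ (S : Set E) (P : E → E), S ⊆ N ∧ IsOpen (N \ S) ∧
      (∀ x ∈ S, P x ∈ V ∧ ‖x - P x‖ ≤ ρ / 2) ∧ (∀ x ∈ S, ∀ᶠ y in 𝓝[S] x, P y = P x) ∧
      ContractsIn (S ∩ W) N ∧
      ∃ B : ℝ → E → E, ContinuousOn (fun q : ℝ × E => B q.1 q.2) (Icc 0 1 ×ˢ (W \ S)) ∧
        ∀ x ∈ W \ S, B 0 x = x ∧ (∀ s ∈ Icc (0 : ℝ) 1, B s x ∈ N ∧ ‖B s x - x‖ ≤ 2 * ρ) ∧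
          (∀ p ∈ V, ρ ≤ ‖B 1 x - p‖) ∧
          (B 1 x = x ∨ ∃ p ∈ V, ‖B 1 x - p‖ = ρ ∧ Cone p (B 1 x)) := by
  classical
  have huniq : ∀ p ∈ V, ∀ p' ∈ V, ∀ x : E, ‖x - p‖ ≤ ρ → ‖x - p'‖ ≤ ρ → p = p' := by
    intro p hp p' hp' x h h'
    by_contra hne
    have h1 := hVsep p hp p' hp' hne
    have h2 := norm_sub_le (x - p') (x - p)
    rw [sub_sub_sub_cancel_left] at h2
    linarith
  let S : Set E := {x | x ∈ N ∧ ∃ p ∈ V, x ∈ C p ∧ ‖x - p‖ ≤ ρ / 2}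
  let P : E → E := fun x => if h : ∃ p ∈ V, ‖x - p‖ ≤ ρ / 2 then h.choose else 0
  have hP : ∀ x ∈ S, P x ∈ V ∧ ‖x - P x‖ ≤ ρ / 2 := by
    rintro x ⟨-, p, hp, -, hxp⟩
    have h : ∃ p ∈ V, ‖x - p‖ ≤ ρ / 2 := ⟨p, hp, hxp⟩
    simp only [P, dif_pos h]
    exact h.choose_spec
  have hPeq : ∀ x ∈ S, ∀ p ∈ V, ‖x - p‖ ≤ ρ → P x = p := fun x hx p hp h =>
    huniq _ (hP x hx).1 p hp x ((hP x hx).2.trans (by linarith)) h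
  have hPloc : ∀ x ∈ S, ∀ᶠ y in 𝓝[S] x, P y = P x := by
    intro x hx
    have h1 : ∀ᶠ y in 𝓝[S] x, ‖y - x‖ < ρ / 2 := by
      refine mem_nhdsWithin_of_mem_nhds ?_
      have := Metric.ball_mem_nhds x (half_pos hρ)
      simpa only [Metric.ball, dist_eq_norm] using this
    filter_upwards [h1, self_mem_nhdsWithin] with y hy hyS
    refine hPeq y hyS _ (hP x hx).1 ?_
    have h2 := norm_add_le (y - x) (x - P x)
    rw [sub_add_sub_cancel] at h2
    linarith [(hP x hx).2]
  have hWC : ∀ x ∈ W \ S, ∀ p ∈ V, ‖x - p‖ ≤ ρ → x ∉ C p := fun x hx p hp hxp hC =>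
    hx.2 ⟨hWN hx.1, p, hp, hC, hCf p hp x hC (hWf x hx.1 p hp hxp)⟩
  refine ⟨S, P, fun x hx => hx.1, ?_, hP, hPloc, ?_, ?_⟩
  · choose! r hr hro using hCo
    have : N \ S = N ∩ ⋂ p ∈ V, ((N ∩ {x | ‖x - p‖ < r p}) \ C p ∪ {x | ρ / 2 < ‖x - p‖}) := by
      ext x
      simp only [mem_inter_iff, mem_iInter]
      constructor
      · rintro ⟨hx, hxS⟩
        refine ⟨hx, fun p hp => ?_⟩
        rcases lt_or_ge (ρ / 2) ‖x - p‖ with h | h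
        · exact Or.inr h
        · refine Or.inl ⟨⟨hx, ?_⟩, fun hC => hxS ⟨hx, p, hp, hC, h⟩⟩
          have := hr p hp
          simp only [Set.mem_ofPred_eq]
          linarith
      · rintro ⟨hx, h⟩
        refine ⟨hx, ?_⟩
        rintro ⟨-, p, hp, hC, hxp⟩
        rcases h p hp with h1 | h1
        · exact h1.2 hC
        · exact not_lt.2 hxp h1
    rw [this]
    refine hNo.inter (hV.isOpen_biInter fun p hp => (hro p hp).union ?_)
    exact isOpen_lt continuous_const (by fun_prop)
  · refine ContractsIn.of_locallyConst (P := P)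
      (fun x hx => (hPloc x hx.1).filter_mono (nhdsWithin_mono x inter_subset_left)) ?_
    intro x hx
    refine (hCc (P x) (hP x hx.1).1).mono ?_ subset_rfl
    rintro y ⟨⟨hyS, hyW⟩, hyP⟩
    obtain ⟨-, p, hp, hC, hyp⟩ := id hyS
    have h1 : P y = p := hPeq y hyS p hp (by linarith)
    have h2 : P x = p := hyP.symm.trans h1
    rw [h2]
    exact ⟨hC, hWf y hyW p hp (by linarith)⟩
  · choose! B hBc hB using hB
    let D : E → ℝ → E → E := fun p s x => if ‖x - p‖ ≤ ρ then B p s x - x else 0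
    have hDc : ∀ p ∈ V, ContinuousOn (fun q : ℝ × E => D p q.1 q.2) (Icc 0 1 ×ˢ (W \ S)) := by
      intro p hp
      refine ContinuousOn.of_closed_cover (F₁ := {q : ℝ × E | ‖q.2 - p‖ ≤ ρ})
        (F₂ := {q : ℝ × E | ρ ≤ ‖q.2 - p‖}) ?_ ?_ (isClosed_le (by fun_prop) (by fun_prop))
        (isClosed_le (by fun_prop) (by fun_prop)) fun q _ => le_total ‖q.2 - p‖ ρ
      · refine ContinuousOn.congr (f := fun q : ℝ × E => B p q.1 q.2 - q.2)
          (((hBc p hp).mono ?_).sub continuousOn_snd) fun q hq => if_pos hq.2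
        rintro q ⟨⟨h1, h2⟩, h3⟩
        exact ⟨h1, ⟨hWN h2.1, hWC _ h2 p hp h3⟩, hWf _ h2.1 p hp h3, h3⟩
      · refine (continuousOn_const (c := (0 : E))).congr ?_
        rintro q ⟨⟨h1, h2⟩, h3⟩
        simp only [D]
        split_ifs with h
        · have h4 : ‖q.2 - p‖ = ρ := le_antisymm h h3
          rw [((hB p hp _ ⟨hWN h2.1, hWC _ h2 p hp h⟩ (hWf _ h2.1 p hp h) h).2.1 _ h1).2.2 h4,
            sub_self]
        · rfl
    let F : ℝ → E → E := fun s x => x + ∑ p ∈ hV.toFinset, D p s x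
    have hFnear : ∀ p ∈ V, ∀ s x, ‖x - p‖ ≤ ρ → F s x = B p s x := by
      intro p hp s x hxp
      have : ∑ p ∈ hV.toFinset, D p s x = D p s x := by
        refine Finset.sum_eq_single_of_mem p (hV.mem_toFinset.2 hp) fun p' hp' hne => ?_
        exact if_neg fun h => hne (huniq p' (hV.mem_toFinset.1 hp') p hp x h hxp)
      simp only [F]
      rw [this]
      simp only [D, if_pos hxp, add_sub_cancel]
    have hFfar : ∀ s x, (∀ p ∈ V, ¬ ‖x - p‖ ≤ ρ) → F s x = x := by
      intro s x h
      simp only [F]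
      rw [Finset.sum_eq_zero, add_zero]
      exact fun p hp => if_neg (h p (hV.mem_toFinset.1 hp))
    refine ⟨F, ?_, fun x hx => ?_⟩
    · exact continuousOn_snd.add (continuousOn_finsetSum _ fun p hp =>
        hDc p (hV.mem_toFinset.1 hp))
    · by_cases h : ∃ p ∈ V, ‖x - p‖ ≤ ρ
      · obtain ⟨p, hp, hxp⟩ := h
        obtain ⟨h1, h2, h3, h4⟩ := hB p hp x ⟨hWN hx.1, hWC x hx p hp hxp⟩
          (hWf x hx.1 p hp hxp) hxp
        rw [hFnear p hp 0 x hxp, hFnear p hp 1 x hxp]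
        refine ⟨h1, fun s hs => ?_, fun p' hp' => ?_, Or.inr ⟨p, hp, h3, h4⟩⟩
        · rw [hFnear p hp s x hxp]
          refine ⟨(h2 s hs).1, ?_⟩
          have h5 := norm_sub_le (B p s x - p) (x - p)
          rw [sub_sub_sub_cancel_right] at h5
          linarith [(h2 s hs).2.1]
        · by_cases hpp : p' = p
          · rw [hpp, h3]
          · have h5 := hVsep p' hp' p hp hpp
            have h6 := norm_sub_le (B p 1 x - p) (B p 1 x - p')
            rw [sub_sub_sub_cancel_left] at h6
            linarith
      · push Not at h
        have h' : ∀ p ∈ V, ¬ ‖x - p‖ ≤ ρ := fun p hp => not_le.2 (h p hp)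
        rw [hFfar 0 x h', hFfar 1 x h']
        refine ⟨rfl, fun s _ => ?_, fun p hp => (h p hp).le, Or.inl rfl⟩
        rw [hFfar s x h', sub_self, norm_zero]
        exact ⟨hWN hx.1, by positivity⟩

end

section

open Set Filter Topology

theorem norm_conj_div_norm {t : ℂ} (ht : t ≠ 0) : ‖(starRingEnd ℂ) t / ‖t‖‖ = 1 := by
  have := norm_pos_iff.2 ht
  rw [norm_div, Complex.norm_real, norm_norm, RCLike.norm_conj, div_self this.ne']

theorem conj_div_norm_mul_self {t : ℂ} (ht : t ≠ 0) : (starRingEnd ℂ) t / ‖t‖ * t = ‖t‖ := by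
  have : (‖t‖ : ℂ) ≠ 0 := by exact_mod_cast (norm_pos_iff.2 ht).ne'
  rw [div_mul_eq_mul_div, mul_comm, Complex.mul_conj', div_eq_iff this]
  ring

theorem le_of_near_cone {w : ℂ} {θ h σ : ℝ} (hθ : 0 ≤ θ) (hw : w.re ≤ 2 * |w.im|)
    (hσ : ‖(θ : ℂ) * w - h‖ ≤ σ) : h ≤ 3 * σ := by
  have h1 := (Complex.abs_re_le_norm _).trans hσ
  have h2 := (Complex.abs_im_le_norm _).trans hσ
  rw [Complex.sub_re, Complex.re_ofReal_mul, Complex.ofReal_re, abs_le] at h1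
  rw [Complex.sub_im, Complex.im_ofReal_mul, Complex.ofReal_im, sub_zero, abs_mul,
    abs_of_nonneg hθ] at h2
  have := mul_le_mul_of_nonneg_left hw hθ
  linarith

/-- A radial sweep starting from points far from the vertices, and either radially bounded or on
the cone part of a small sphere around a vertex, stays away from all vertices. -/
theorem sweep_avoids_vertices {E : Type*} [NormedAddCommGroup E] [NormedSpace ℂ E]
    {u : E →L[ℂ] ℂ} {c : ℂ} {V : Set E} {K δ ρ κ₂ ε₂ ρ₃ : ℝ} (hK : 0 < K) (hδ : 0 < δ)
    (hρ : 0 < ρ) (hV0 : ∀ p ∈ V, u p - c ≠ 0)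
    (hδV : ∀ p ∈ V, ∀ p' ∈ V, ∀ z : ℂ, z ≠ 0 → NearDir δ (u p - c) z →
      NearDir δ (u p' - c) z → u p = u p')
    (hVsep : ∀ p ∈ V, ∀ p' ∈ V, p ≠ p' → 4 * ((1 + K * ‖u‖) * ρ) < ‖p - p'‖)
    (hρδ : ∀ p ∈ V, 8 * (‖u‖ * ρ) ≤ δ * ‖u p - c‖)
    (hρ1 : ∀ p ∈ V, 8 * (‖u‖ * ρ) ≤ ‖u p - c‖)
    (hκ₂ : 24 * (K * κ₂) ≤ 1) (hε₂ : 2 * (K * ε₂) ≤ ρ)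
    (hρ₃ : 0 < ρ₃) (hρ₃' : 4 * ((1 + 12 * (K * ‖u‖)) * ρ₃) ≤ ρ)
    {y : E} (hyV : ∀ p ∈ V, ρ ≤ ‖y - p‖)
    (hy : (∀ p ∈ V, NearDir δ (u p - c) (u y - c) → ‖u y - c‖ ≤ ‖u p - c‖ + ε₂) ∨
      ∃ p ∈ V, ‖y - p‖ = ρ ∧ ∃ w : ℂ, w.re ≤ 2 * |w.im| ∧
        ‖(starRingEnd ℂ) (u p - c) / ‖u p - c‖ * u (y - p) - w‖ ≤ κ₂ * ρ)
    {x : E} {θ : ℝ} (hθ0 : 0 ≤ θ) (hθ1 : θ ≤ 1) (hux : u x - c = θ * (u y - c))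
    (hxy : ‖x - y‖ ≤ K * ((1 - θ) * ‖u y - c‖)) : ∀ p ∈ V, ρ₃ ≤ ‖x - p‖ := by
  intro p hp
  by_contra! hlt
  have hKu : 0 ≤ K * (‖u‖ * ρ₃) := by positivity
  have hKu' : 0 ≤ K * (‖u‖ * ρ) := by positivity
  have hρ₃ρ : ρ₃ ≤ ρ := by linarith
  have hnρ : ‖u‖ * ρ₃ ≤ ‖u‖ * ρ := by gcongr
  have ht := norm_pos_iff.2 (hV0 p hp)
  have hξ : ‖u x - c - (u p - c)‖ ≤ ‖u‖ * ρ₃ := by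
    rw [sub_sub_sub_cancel_right, ← map_sub]
    exact (u.le_opNorm _).trans (by gcongr)
  have hn3 : 0 ≤ ‖u‖ * ρ₃ := by positivity
  have h8 := hρ1 p hp
  have h8' := hρδ p hp
  have hUx : ‖u p - c‖ - ‖u‖ * ρ₃ ≤ ‖u x - c‖ := by
    have := norm_sub_norm_le (u p - c) (u x - c)
    rw [norm_sub_rev (u p - c) (u x - c)] at this
    linarith
  have hUxn : ‖u x - c‖ = θ * ‖u y - c‖ := by
    rw [hux, norm_mul, Complex.norm_of_nonneg hθ0]
  have hθ : 0 < θ := by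
    rcases hθ0.lt_or_eq with h | h
    · exact h
    · rw [← h, zero_mul] at hUxn
      linarith
  have hUy0 : u y - c ≠ 0 := by
    intro h
    rw [h, norm_zero, mul_zero] at hUxn
    linarith
  have hdirx : NearDir δ (u p - c) (u y - c) := by
    rw [← nearDir_smul_iff hθ, ← hux]
    refine NearDir.of_norm_sub ?_
    have : δ * (‖u p - c‖ / 2) ≤ δ * ‖u x - c‖ := by gcongr; linarith
    linarith
  have hdist : ρ ≤ ‖x - y‖ + ρ₃ := by
    have h1 := norm_sub_norm_le (y - p) (x - p)
    rw [sub_sub_sub_cancel_right, norm_sub_rev y x] at h1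
    linarith [hyV p hp]
  rcases hy with hy | ⟨p₀, hp₀, hyp₀, w, hw1, hw2⟩
  · have h1 := hy p hp hdirx
    have h2 : (1 - θ) * ‖u y - c‖ ≤ ε₂ + ‖u‖ * ρ₃ := by linarith
    have h3 := mul_le_mul_of_nonneg_left h2 hK.le
    linarith
  · have ht0 := norm_pos_iff.2 (hV0 p₀ hp₀)
    have hy1 : ‖u y - c - (u p₀ - c)‖ ≤ ‖u‖ * ρ := by
      rw [sub_sub_sub_cancel_right, ← map_sub, ← hyp₀]
      exact u.le_opNorm _
    have hy2 : |‖u y - c‖ - ‖u p₀ - c‖| ≤ ‖u‖ * ρ := (abs_norm_sub_norm_le _ _).trans hy1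
    rw [abs_le] at hy2
    have hdiry : NearDir δ (u p₀ - c) (u y - c) := by
      refine NearDir.of_norm_sub ?_
      have h1 : δ * (‖u p₀ - c‖ / 2) ≤ δ * ‖u y - c‖ := by
        gcongr; linarith [hρ1 p₀ hp₀]
      linarith [hρδ p₀ hp₀]
    have hup := hδV p hp p₀ hp₀ _ hUy0 hdirx hdiry
    have hpp : p = p₀ := by
      by_contra hne
      have h1 := hVsep p hp p₀ hp₀ hne
      have h2 : (1 - θ) * ‖u y - c‖ ≤ ‖u‖ * ρ + ‖u‖ * ρ₃ := by
        rw [hup] at hUx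
        linarith
      have h3 := mul_le_mul_of_nonneg_left h2 hK.le
      have h4 : ‖p - p₀‖ ≤ ‖x - p‖ + ‖x - y‖ + ‖y - p₀‖ := by
        have : p - p₀ = -(x - p) + (x - y) + (y - p₀) := by abel
        rw [this]
        refine (norm_add_le _ _).trans (add_le_add_left ((norm_add_le _ _).trans ?_) _)
        rw [norm_neg]
      linarith
    subst hpp
    set a : ℂ := (starRingEnd ℂ) (u p - c) / ‖u p - c‖ with ha
    have ha1 : ‖a‖ = 1 := norm_conj_div_norm (hV0 p hp)
    have hat : a * (u p - c) = ‖u p - c‖ := conj_div_norm_mul_self (hV0 p hp)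
    have hkey : (θ : ℂ) * w - ((1 - θ) * ‖u p - c‖ : ℝ) =
        a * (u x - c - (u p - c)) - θ * (a * u (y - p) - w) := by
      push_cast
      rw [← hat, hux, map_sub]
      ring
    have hσ : ‖(θ : ℂ) * w - ((1 - θ) * ‖u p - c‖ : ℝ)‖ ≤ κ₂ * ρ + ‖u‖ * ρ₃ := by
      rw [hkey]
      refine (norm_sub_le _ _).trans ?_
      rw [norm_mul, norm_mul, ha1, Complex.norm_of_nonneg hθ0, one_mul]
      have := mul_le_mul hθ1 hw2 (norm_nonneg _) zero_le_one
      linarith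
    have h3 := le_of_near_cone hθ0 hw1 hσ
    have h4 : (1 - θ) * ‖u y - c‖ ≤ (1 - θ) * (2 * ‖u p - c‖) := by
      have : 0 ≤ 1 - θ := by linarith
      gcongr
      linarith
    have h5 : (1 - θ) * ‖u y - c‖ ≤ 6 * (κ₂ * ρ + ‖u‖ * ρ₃) := by linarith
    have h6 := mul_le_mul_of_nonneg_left h5 hK.le
    have h7 := mul_le_mul_of_nonneg_right hκ₂ hρ.le
    linarith

theorem exists_final_sweep {E : Type*} [NormedAddCommGroup E] [NormedSpace ℂ E]
    {u : E →L[ℂ] ℂ} {c : ℂ} {N V Z : Set E} {K δ ρ κ₂ ε₂ : ℝ} (hK : 0 < K) (hδ : 0 < δ)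
    (hF : ∀ ρ > (0 : ℝ), ∃ η > (0 : ℝ), ∃ e : E → E,
      ContinuousOn e {x | ∀ p ∈ V, ρ ≤ ‖x - p‖} ∧
      ∀ x, (∀ p ∈ V, ρ ≤ ‖x - p‖) → u (e x) = 1 ∧ ‖e x‖ ≤ K ∧
        (x ∈ N → ∀ z : ℂ, ‖z‖ ≤ η → x + z • e x ∈ N))
    (hρ : 0 < ρ) (hV0 : ∀ p ∈ V, u p - c ≠ 0)
    (hδV : ∀ p ∈ V, ∀ p' ∈ V, ∀ z : ℂ, z ≠ 0 → NearDir δ (u p - c) z →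
      NearDir δ (u p' - c) z → u p = u p')
    (hVsep : ∀ p ∈ V, ∀ p' ∈ V, p ≠ p' → 4 * ((1 + K * ‖u‖) * ρ) < ‖p - p'‖)
    (hρδ : ∀ p ∈ V, 8 * (‖u‖ * ρ) ≤ δ * ‖u p - c‖)
    (hρ1 : ∀ p ∈ V, 8 * (‖u‖ * ρ) ≤ ‖u p - c‖)
    (hκ₂ : 24 * (K * κ₂) ≤ 1) (hε₂ : 2 * (K * ε₂) ≤ ρ) (hZN : Z ⊆ N)
    (hZV : ∀ y ∈ Z, ∀ p ∈ V, ρ ≤ ‖y - p‖)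
    (hZ : ∀ y ∈ Z, (∀ p ∈ V, NearDir δ (u p - c) (u y - c) → ‖u y - c‖ ≤ ‖u p - c‖ + ε₂) ∨
      ∃ p ∈ V, ‖y - p‖ = ρ ∧ ∃ w : ℂ, w.re ≤ 2 * |w.im| ∧
        ‖(starRingEnd ℂ) (u p - c) / ‖u p - c‖ * u (y - p) - w‖ ≤ κ₂ * ρ) :
    ∃ G : ℝ → E → E, ContinuousOn (fun q : ℝ × E => G q.1 q.2) (Icc 0 1 ×ˢ Z) ∧
      (∀ y ∈ Z, G 0 y = y) ∧ ∀ s ∈ Icc (0 : ℝ) 1, ∀ y ∈ Z, G s y ∈ N ∧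
        u (G s y) - c = (1 - s : ℝ) * (u y - c) ∧ ‖G s y - y‖ ≤ K * (s * ‖u y - c‖) := by
  have hden : 0 < 4 * (1 + 12 * (K * ‖u‖)) := by positivity
  obtain ⟨η, hη, e, hec, he⟩ := hF (ρ / (4 * (1 + 12 * (K * ‖u‖)))) (by positivity)
  obtain ⟨G, hGc, hG0, hG⟩ := exists_sweep (c := c) (N := N) (Z := Z) (φ := fun _ => 1) hη hec
    (fun x hx => (he x hx).1) (fun x hx => (he x hx).2.1) (fun x hx hxR => (he x hxR).2.2 hx)
    hZN continuousOn_const (fun y _ => ⟨zero_le_one, le_rfl⟩) (by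
      intro y hy x hx θ hθ0 hθ1 hux hxy
      refine sweep_avoids_vertices hK hδ hρ hV0 hδV hVsep hρδ hρ1 hκ₂ hε₂ (by positivity)
        (le_of_eq ?_) (hZV y hy) (hZ y hy) (by linarith) hθ1 hux hxy
      field_simp)
  refine ⟨G, hGc, hG0, fun s hs y hy => ?_⟩
  have := hG s hs y hy
  rwa [mul_one] at this

end

section

open Set Filter Topology

theorem NearDir.mono {δ δ' : ℝ} {t z : ℂ} (h : NearDir δ t z) (hδ : δ ≤ δ') : NearDir δ' t z :=
  le_trans h (by gcongr)

theorem eventually_mul_lt_nhdsGT_zero (a : ℝ) {b : ℝ} (hb : 0 < b) :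
    ∀ᶠ ρ in 𝓝[>] (0 : ℝ), a * ρ < b := by
  have h : Tendsto (fun ρ : ℝ => a * ρ) (𝓝[>] 0) (𝓝 (a * 0)) :=
    ((continuous_const.mul continuous_id).tendsto 0).mono_left nhdsWithin_le_nhds
  rw [mul_zero] at h
  exact h.eventually_lt_const hb

theorem exists_pos_le_of_finite {α : Type*} {V : Set α} (hV : V.Finite) {f : α → ℝ}
    (hf : ∀ p ∈ V, 0 < f p) : ∃ κ > 0, ∀ p ∈ V, κ ≤ f p := by
  rcases V.eq_empty_or_nonempty with h | h
  · exact ⟨1, one_pos, by simp [h]⟩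
  · obtain ⟨q, hq, hq'⟩ := hV.exists_minimalFor f V h
    refine ⟨f q, hf q hq, fun p hp => ?_⟩
    rcases le_total (f q) (f p) with h | h
    · exact h
    · exact hq' hp h

theorem exists_pos_of_finite_sep {E : Type*} [NormedAddCommGroup E] {V : Set E}
    (hV : V.Finite) : ∃ d > 0, ∀ p ∈ V, ∀ p' ∈ V, p ≠ p' → d ≤ ‖p - p'‖ := by
  obtain ⟨d, hd, h⟩ := exists_pos_le_of_finite (V := (V ×ˢ V) ∩ {q | q.1 ≠ q.2})
    ((hV.prod hV).inter_of_left _) (f := fun q => ‖q.1 - q.2‖)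
    fun q hq => norm_pos_iff.2 (sub_ne_zero.2 hq.2)
  exact ⟨d, hd, fun p hp p' hp' hne => h (p, p') ⟨⟨hp, hp'⟩, hne⟩⟩

theorem re_conj_dir_mul_le {t z : ℂ} (ht : t ≠ 0) :
    ((starRingEnd ℂ) t / ‖t‖ * z).re ≤ ‖z‖ := by
  refine (Complex.re_le_norm _).trans ?_
  rw [norm_mul, norm_conj_div_norm ht, one_mul]

/-- Assembling the sweep from local data at the vertices. -/
theorem exists_sweep_of_vertex_pairs {E : Type*} [NormedAddCommGroup E] [NormedSpace ℂ E]
    {u : E →L[ℂ] ℂ} {c : ℂ} {N V : Set E} {K : ℝ} (hNo : IsOpen N) (hV : V.Finite) (hK : 0 < K)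
    (hF : ∀ ρ > (0 : ℝ), ∃ η > (0 : ℝ), ∃ e : E → E,
      ContinuousOn e {x | ∀ p ∈ V, ρ ≤ ‖x - p‖} ∧
      ∀ x, (∀ p ∈ V, ρ ≤ ‖x - p‖) → u (e x) = 1 ∧ ‖e x‖ ≤ K ∧
        (x ∈ N → ∀ z : ℂ, ‖z‖ ≤ η → x + z • e x ∈ N))
    (hV0 : ∀ p ∈ V, u p - c ≠ 0)
    (hdir : ∀ p ∈ V, ∀ p' ∈ V, (u p - c) / ‖u p - c‖ = (u p' - c) / ‖u p' - c‖ → u p = u p')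
    (hP : ∀ p ∈ V, ∀ κ₂ > (0 : ℝ), ∀ a : ℂ, a ≠ 0 → ∃ κ > (0 : ℝ), ∃ r > (0 : ℝ), ∃ C : Set E,
      (∀ x ∈ C, ‖x - p‖ < r → x ∈ N) ∧
      IsOpen ((N ∩ {x | ‖x - p‖ < r}) \ C) ∧
      ∀ ρ > (0 : ℝ), ρ < r → (∀ x ∈ C, (a * u (x - p)).re ≤ κ * ρ → ‖x - p‖ ≤ ρ / 2) ∧
        ContractsIn (C ∩ {x | (a * u (x - p)).re ≤ κ * ρ}) N ∧
        ∃ B : ℝ → E → E, ContinuousOn (fun q : ℝ × E => B q.1 q.2)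
            (Icc 0 1 ×ˢ ((N \ C) ∩ {x | (a * u (x - p)).re ≤ κ * ρ ∧ ‖x - p‖ ≤ ρ})) ∧
          ∀ x ∈ N \ C, (a * u (x - p)).re ≤ κ * ρ → ‖x - p‖ ≤ ρ → B 0 x = x ∧
            (∀ s ∈ Icc (0 : ℝ) 1, B s x ∈ N ∧ ‖B s x - p‖ ≤ ρ ∧ (‖x - p‖ = ρ → B s x = x)) ∧
            ‖B 1 x - p‖ = ρ ∧
              ∃ w : ℂ, w.re ≤ 2 * |w.im| ∧ ‖a * u (B 1 x - p) - w‖ ≤ κ₂ * ρ)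
    {m : ℝ} (hm : 0 < m) (hmV : ∀ p ∈ V, m < ‖u p - c‖) {ε : ℝ} (hε : 0 < ε) :
    ∃ (S : Set E) (τ : E → ℂ) (G : ℝ → E → E), S ⊆ N ∧ IsOpen (N \ S) ∧ ContractsIn S N ∧
      (∀ x ∈ S, ‖τ x‖ = 1 ∧ m ≤ (τ x * (u x - c)).re ∧ ∀ᶠ y in 𝓝[S] x, τ y = τ x) ∧
      ContinuousOn (fun q : ℝ × E => G q.1 q.2) (Icc 0 1 ×ˢ (N \ S)) ∧
      ∀ x ∈ N \ S, G 0 x = x ∧ u (G 1 x) = c ∧ ∀ s ∈ Icc (0 : ℝ) 1, G s x ∈ N ∧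
        (∃ θ ∈ Icc (0 : ℝ) 1, ‖(u (G s x) - c) - θ * (u x - c)‖ ≤ ε) ∧
        ‖G s x - x‖ ≤ 2 * K * ‖u x - c‖ + ε := by
  classical
  have hTfin : ((fun p => u p - c) '' V).Finite := hV.image _
  have hT0 : ∀ t ∈ (fun p => u p - c) '' V, t ≠ 0 := by
    rintro _ ⟨p, hp, rfl⟩
    exact hV0 p hp
  obtain ⟨δ, hδ, hδT⟩ := exists_sector_width hTfin hT0 (by
    rintro _ ⟨p, hp, rfl⟩ _ ⟨p', hp', rfl⟩ h
    simp only [hdir p hp p' hp' h])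
  have hδV : ∀ p ∈ V, ∀ p' ∈ V, ∀ z : ℂ, z ≠ 0 → NearDir δ (u p - c) z →
      NearDir δ (u p' - c) z → u p = u p' := by
    intro p hp p' hp' z hz h h'
    exact sub_left_injective (hδT _ ⟨p, hp, rfl⟩ _ ⟨p', hp', rfl⟩ z hz (h.mono (by linarith))
      (h'.mono (by linarith)))
  have hκ₂ : (0 : ℝ) < 1 / (24 * K) := by positivity
  have hP' := fun p hp => hP p hp _ hκ₂ ((starRingEnd ℂ) (u p - c) / ‖u p - c‖)
    (norm_ne_zero_iff.1 (by rw [norm_conj_div_norm (hV0 p hp)]; exact one_ne_zero))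
  choose! κp hκp rp hrp C hCN hCo hC using hP'
  obtain ⟨κ, hκ, hκV, hκK⟩ : ∃ κ > 0, (∀ p ∈ V, κ ≤ κp p) ∧ 2 * (K * κ) ≤ 1 := by
    obtain ⟨κ, hκ, hκV⟩ := exists_pos_le_of_finite hV hκp
    refine ⟨min κ (1 / (2 * K)), by positivity, fun p hp => (min_le_left _ _).trans (hκV p hp), ?_⟩
    have := mul_le_mul_of_nonneg_left (min_le_right κ (1 / (2 * K))) hK.le
    have h2 : K * (1 / (2 * K)) = 1 / 2 := by field_simp
    linarith
  obtain ⟨d, hd, hdV⟩ := exists_pos_of_finite_sep hV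
  obtain ⟨ρ, ⟨⟨hρr, hρδ, hρ1, hρm⟩, hρd, hρd', hρε⟩, hρ⟩ := (Eventually.exists
    (f := 𝓝[>] (0 : ℝ)) (((hV.eventually_all.2 fun p hp =>
      eventually_mul_lt_nhdsGT_zero 1 (hrp p hp)).and
      ((hV.eventually_all.2 fun p hp => eventually_mul_lt_nhdsGT_zero (8 * ‖u‖)
        (mul_pos hδ (norm_pos_iff.2 (hV0 p hp)))).and
      ((hV.eventually_all.2 fun p hp => eventually_mul_lt_nhdsGT_zero (8 * ‖u‖)
        (norm_pos_iff.2 (hV0 p hp))).and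
      (hV.eventually_all.2 fun p hp => eventually_mul_lt_nhdsGT_zero (‖u‖)
        (sub_pos.2 (hmV p hp)))))).and
      ((eventually_mul_lt_nhdsGT_zero (4 * (1 + K * ‖u‖)) hd).and
      ((eventually_mul_lt_nhdsGT_zero 4 hd).and
      (eventually_mul_lt_nhdsGT_zero (2 + 2 * K * ‖u‖ + 2 * ‖u‖) hε)))
      |>.and self_mem_nhdsWithin))
  have hρ : 0 < ρ := hρ
  have hC' := fun p hp => hC p hp ρ hρ (by simpa using hρr p hp)
  have hε₂ : 0 < κ * ρ := by positivity
  have hsub : ∀ p ∈ V, ∀ x : E, ((starRingEnd ℂ) (u p - c) / ‖u p - c‖ * u (x - p)).re ≤ κ * ρ →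
      ((starRingEnd ℂ) (u p - c) / ‖u p - c‖ * u (x - p)).re ≤ κp p * ρ := fun p hp x h =>
    h.trans (by have := hκV p hp; gcongr)
  have hdec : ∀ p ∈ V, ∀ x : E, ((starRingEnd ℂ) (u p - c) / ‖u p - c‖ * u (x - p)).re =
      ((starRingEnd ℂ) (u p - c) / ‖u p - c‖ * (u x - c)).re - ‖u p - c‖ := by
    intro p hp x
    have h1 := conj_div_norm_mul_self (hV0 p hp)
    have h2 : (starRingEnd ℂ) (u p - c) / ‖u p - c‖ * u (x - p) =
        (starRingEnd ℂ) (u p - c) / ‖u p - c‖ * (u x - c) - ((‖u p - c‖ : ℝ) : ℂ) := by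
      rw [map_sub u]; linear_combination -h1
    rw [h2, Complex.sub_re, Complex.ofReal_re]
  obtain ⟨φ, η, hη, hφc, hφ, hφT, hφη⟩ := exists_radial_shrink hTfin hT0 hδ hδT hε₂
  obtain ⟨F, hFc, hF0, hFN⟩ := exists_radial_homotopy (c := c) hF hφc hφ hη (fun z =>
    (hφη z).imp_right fun h s hs p hp => h s hs _ ⟨p, hp, rfl⟩)
  let W : Set E := {x | x ∈ N ∧ ∀ p ∈ V, NearDir δ (u p - c) (u x - c) →
    ‖u x - c‖ ≤ ‖u p - c‖ + κ * ρ}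
  have hWf : ∀ x ∈ W, ∀ p ∈ V, ‖x - p‖ ≤ ρ →
      ((starRingEnd ℂ) (u p - c) / ‖u p - c‖ * u (x - p)).re ≤ κ * ρ := by
    intro x hx p hp hxp
    have h1 : ‖(u x - c) - (u p - c)‖ ≤ ‖u‖ * ρ := by
      rw [sub_sub_sub_cancel_right, ← map_sub]
      exact (u.le_opNorm _).trans (by gcongr)
    have h2 : ‖u p - c‖ - ‖u‖ * ρ ≤ ‖u x - c‖ := by
      have := norm_sub_norm_le (u p - c) (u x - c)
      rw [norm_sub_rev (u p - c) (u x - c)] at this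
      linarith
    have h3 := hρδ p hp
    have h4 := hρ1 p hp
    have h5 := mul_le_mul_of_nonneg_left (show 7 / 8 * ‖u p - c‖ ≤ ‖u x - c‖ by linarith) hδ.le
    have h6 : 0 ≤ ‖u‖ * ρ := by positivity
    have := hx.2 p hp (NearDir.of_norm_sub (by linarith))
    rw [hdec p hp]
    have := re_conj_dir_mul_le (z := u x - c) (hV0 p hp)
    linarith
  obtain ⟨S, P, hSN, hSo, hSP, hPc, hSc, B, hBc, hB⟩ := exists_glued_sweep (W := W)
    (f := fun p x => ((starRingEnd ℂ) (u p - c) / ‖u p - c‖ * u (x - p)).re) (C := C)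
    (Cone := fun p y => ∃ w : ℂ, w.re ≤ 2 * |w.im| ∧
      ‖(starRingEnd ℂ) (u p - c) / ‖u p - c‖ * u (y - p) - w‖ ≤ 1 / (24 * K) * ρ)
    hV hNo (fun x hx => hx.1) hρ
    (fun p hp p' hp' hne => hρd'.trans_le (hdV p hp p' hp' hne)) hWf
    (fun p hp => ⟨rp p, by simpa using hρr p hp, hCo p hp⟩)
    (fun p hp x hx hfx => (hC' p hp).1 x hx (hsub p hp x hfx))
    (fun p hp => (hC' p hp).2.1.mono (fun x hx => ⟨hx.1, hsub p hp x hx.2⟩) subset_rfl)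
    (fun p hp => by
      obtain ⟨-, -, B, hBc, hB⟩ := hC' p hp
      exact ⟨B, hBc.mono (prod_mono_right fun x hx => ⟨hx.1, hsub p hp x hx.2.1, hx.2.2⟩),
        fun x hx h1 h2 => hB x hx (hsub p hp x h1) h2⟩)
  have hone : (1 : ℝ) ∈ Icc (0 : ℝ) 1 := ⟨zero_le_one, le_rfl⟩
  have hFu : ∀ x ∈ N, u (F 1 x) - c = (1 - φ (u x - c) : ℝ) * (u x - c) := fun x hx => by
    have := (hFN 1 hone x hx).2.1
    rwa [one_mul] at this
  have hFW : ∀ x ∈ N, F 1 x ∈ W := by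
    refine fun x hx => ⟨(hFN 1 hone x hx).1, fun p hp h => ?_⟩
    rw [hFu x hx] at h ⊢
    exact hφT _ _ ⟨p, hp, rfl⟩ h
  have hF1c : ContinuousOn (F 1) N :=
    hFc.comp (f := fun x : E => ((1 : ℝ), x)) (by fun_prop) fun x hx => ⟨hone, hx⟩
  let S' : Set E := {x | x ∈ N ∧ F 1 x ∈ S}
  have hS'o : IsOpen (N \ S') := by
    have : N \ S' = N ∩ F 1 ⁻¹' (N \ S) := by
      ext x
      constructor
      · exact fun h => ⟨h.1, (hFN 1 hone x h.1).1, fun h' => h.2 ⟨h.1, h'⟩⟩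
      · exact fun h => ⟨h.1, fun h' => h.2.2 h'.2⟩
    rw [this]
    exact hF1c.isOpen_inter_preimage hNo hSo
  let Z : Set E := {y | y ∈ N ∧ (∀ p ∈ V, ρ ≤ ‖y - p‖) ∧
    ((∀ p ∈ V, NearDir δ (u p - c) (u y - c) → ‖u y - c‖ ≤ ‖u p - c‖ + κ * ρ) ∨
      ∃ p ∈ V, ‖y - p‖ = ρ ∧ ∃ w : ℂ, w.re ≤ 2 * |w.im| ∧
        ‖(starRingEnd ℂ) (u p - c) / ‖u p - c‖ * u (y - p) - w‖ ≤ 1 / (24 * K) * ρ)}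
  obtain ⟨G, hGc, hG0, hG⟩ := exists_final_sweep (Z := Z) hK hδ hF hρ hV0 hδV
    (fun p hp p' hp' hne => by have := hdV p hp p' hp' hne; linarith)
    (fun p hp => by have := hρδ p hp; linarith) (fun p hp => by have := hρ1 p hp; linarith)
    (by rw [show 24 * (K * (1 / (24 * K))) = 1 by field_simp])
    (show 2 * (K * (κ * ρ)) ≤ ρ by nlinarith) (fun y hy => hy.1) (fun y hy => hy.2.1)
    (fun y hy => hy.2.2)
  have hFWS : ∀ x ∈ N \ S', F 1 x ∈ W \ S := fun x hx =>
    ⟨hFW x hx.1, fun h => hx.2 ⟨hx.1, h⟩⟩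
  have hBZ : ∀ y ∈ W \ S, B 1 y ∈ Z := by
    intro y hy
    obtain ⟨-, h1, h2, h3⟩ := hB y hy
    refine ⟨(h1 1 hone).1, h2, ?_⟩
    rcases h3 with h3 | h3
    · left
      rw [h3]
      exact hy.1.2
    · exact Or.inr h3
  obtain ⟨H, hHc, hH0, hH1, hH⟩ := exists_homotopy_trans (Z := N \ S') (Z' := W \ S)
    (hFc.mono (prod_mono_right sdiff_subset)) hBc hFWS (fun x hx => (hB x hx).1)
  obtain ⟨H', hH'c, hH'0, hH'1, hH'⟩ := exists_homotopy_trans hHc hGc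
    (fun x hx => by rw [hH1]; exact hBZ _ (hFWS x hx)) hG0
  have hρε' : 2 * ρ + 2 * (K * (‖u‖ * ρ)) + 2 * (‖u‖ * ρ) < ε := by linarith
  have hKuρ : 0 ≤ K * (‖u‖ * ρ) := by positivity
  have huρ : 0 ≤ ‖u‖ * ρ := by positivity
  refine ⟨S', fun x => (starRingEnd ℂ) (u (P (F 1 x)) - c) / ‖u (P (F 1 x)) - c‖, H',
    fun x hx => hx.1, hS'o, hSc.of_deform (hFc.mono (prod_mono_right fun x hx => hx.1))
      (fun x hx => hF0 x hx.1) (fun s hs x hx => (hFN s hs x hx.1).1)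
      (fun x hx => ⟨hx.2, hFW x hx.1⟩), fun x hx => ⟨?_, ?_, ?_⟩, hH'c, fun x hx => ⟨?_, ?_, ?_⟩⟩
  · exact norm_conj_div_norm (hV0 _ (hSP _ hx.2).1)
  · obtain ⟨hp, hxp⟩ := hSP _ hx.2
    have h1 := hdec _ hp (F 1 x)
    have h2 : -(‖u‖ * ρ) ≤
        ((starRingEnd ℂ) (u (P (F 1 x)) - c) / ‖u (P (F 1 x)) - c‖ * u (F 1 x - P (F 1 x))).re := by
      refine neg_le_of_abs_le ((Complex.abs_re_le_norm _).trans ?_)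
      rw [norm_mul, norm_conj_div_norm (hV0 _ hp), one_mul]
      exact (u.le_opNorm _).trans (by gcongr; linarith)
    rw [hFu x hx.1, mul_left_comm, Complex.re_ofReal_mul] at h1
    have h3 := hρm _ hp
    obtain ⟨h4, h5⟩ := hφ (u x - c)
    by_contra! h6
    rcases le_total 0 ((starRingEnd ℂ) (u (P (F 1 x)) - c) / ‖u (P (F 1 x)) - c‖ * (u x - c)).re
      with h7 | h7 <;> nlinarith
  · have ht : Tendsto (F 1) (𝓝[S'] x) (𝓝[S] (F 1 x)) :=
      tendsto_nhdsWithin_of_tendsto_nhds_of_eventually_within _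
        ((hF1c x hx.1).mono_left (nhdsWithin_mono _ fun y hy => hy.1))
        (eventually_mem_nhdsWithin.mono fun y hy => hy.2)
    filter_upwards [ht.eventually (hPc _ hx.2)] with y hy
    rw [hy]
  · rw [hH'0, hH0, hF0 x hx.1]
  · have := (hG 1 hone _ (hBZ _ (hFWS x hx))).2.1
    rw [sub_self, Complex.ofReal_zero, zero_mul, sub_eq_zero] at this
    rw [hH'1, hH1, this]
  · intro s hs
    obtain ⟨hφ0, hφ1⟩ := hφ (u x - c)
    have hz := norm_nonneg (u x - c)
    have hKz : 0 ≤ K * ‖u x - c‖ := by positivity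
    have hFx : ∀ s ∈ Icc (0 : ℝ) 1, ‖F s x - x‖ ≤ K * ‖u x - c‖ := by
      intro s hs
      refine (hFN s hs x hx.1).2.2.trans ?_
      have h1 : s * φ (u x - c) ≤ 1 := mul_le_one₀ hs.2 hφ0 hφ1
      have h2 := mul_le_mul_of_nonneg_right h1 hz
      exact mul_le_mul_of_nonneg_left (by linarith) hK.le
    obtain ⟨-, hBx, -⟩ := hB _ (hFWS x hx)
    have hBu : ∀ s ∈ Icc (0 : ℝ) 1, ‖(u (B s (F 1 x)) - c) -
        (1 - φ (u x - c) : ℝ) * (u x - c)‖ ≤ 2 * (‖u‖ * ρ) := by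
      intro s hs
      rw [← hFu x hx.1, sub_sub_sub_cancel_right, ← map_sub]
      refine (u.le_opNorm _).trans ?_
      have := mul_le_mul_of_nonneg_left (hBx s hs).2 (norm_nonneg u)
      linarith
    have hθ : (1 - φ (u x - c)) ∈ Icc (0 : ℝ) 1 := ⟨by linarith, by linarith⟩
    rcases hH' s hs x with ⟨s', hs', h⟩ | ⟨s', hs', h⟩
    · rw [h]
      rcases hH s' hs' x with ⟨s'', hs'', h⟩ | ⟨s'', hs'', h⟩
      · rw [h]
        obtain ⟨g1, g2, -⟩ := hFN s'' hs'' x hx.1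
        refine ⟨g1, ⟨1 - s'' * φ (u x - c), ⟨?_, ?_⟩, ?_⟩, ?_⟩
        · have h1 : s'' * φ (u x - c) ≤ 1 := mul_le_one₀ hs''.2 hφ0 hφ1
          linarith
        · have := mul_nonneg hs''.1 hφ0
          linarith
        · rw [g2, sub_self, norm_zero]; exact hε.le
        · have := hFx s'' hs''
          linarith
      · rw [h]
        refine ⟨(hBx s'' hs'').1, ⟨_, hθ, (hBu s'' hs'').trans (by linarith)⟩, ?_⟩
        have h1 := norm_add_le (B s'' (F 1 x) - F 1 x) (F 1 x - x)
        rw [sub_add_sub_cancel] at h1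
        have h2 := hFx 1 hone
        have h3 := (hBx s'' hs'').2
        linarith
    · rw [h, hH1]
      obtain ⟨g1, g2, g3⟩ := hG s' hs' _ (hBZ _ (hFWS x hx))
      have h0 := hBu 1 hone
      refine ⟨g1, ⟨(1 - s') * (1 - φ (u x - c)), ⟨?_, ?_⟩, ?_⟩, ?_⟩
      · exact mul_nonneg (by linarith [hs'.2]) hθ.1
      · exact mul_le_one₀ (by linarith [hs'.1]) hθ.1 hθ.2
      · rw [g2, Complex.ofReal_mul, mul_assoc, ← mul_sub, norm_mul,
          Complex.norm_of_nonneg (by linarith [hs'.2])]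
        refine (mul_le_of_le_one_left (norm_nonneg _) (by linarith [hs'.1])).trans ?_
        linarith
      · have h1 := norm_add₃_le (a := G s' (B 1 (F 1 x)) - B 1 (F 1 x))
          (b := B 1 (F 1 x) - F 1 x) (c := F 1 x - x)
        rw [sub_add_sub_cancel, sub_add_sub_cancel] at h1
        have h2 := hFx 1 hone
        have h3 := (hBx 1 hone).2
        have h4 : ‖u (B 1 (F 1 x)) - c‖ ≤ ‖u x - c‖ + 2 * (‖u‖ * ρ) := by
          have h5 := norm_le_norm_sub_add (u (B 1 (F 1 x)) - c)
            ((1 - φ (u x - c) : ℝ) * (u x - c))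
          rw [norm_mul ((1 - φ (u x - c) : ℝ) : ℂ), Complex.norm_of_nonneg hθ.1] at h5
          have h6 := mul_le_of_le_one_left hz hθ.2
          linarith
        have h7 : K * (s' * ‖u (B 1 (F 1 x)) - c‖) ≤ K * (‖u x - c‖ + 2 * (‖u‖ * ρ)) := by
          refine mul_le_mul_of_nonneg_left ?_ hK.le
          exact (mul_le_of_le_one_left (norm_nonneg _) hs'.2).trans h4
        linarith

end

section

open Set Filter Topology

theorem hasSweep_of_subsingleton {E ι : Type*} [NormedAddCommGroup E] [NormedSpace ℂ E]
    [Subsingleton E] (lam : ι → E →L[ℂ] ℂ) (b : ι → ℂ) (u : E →L[ℂ] ℂ) : HasSweep lam b u := by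
  refine ⟨1, one_pos, fun c hc m hm hmV ε hε => ?_⟩
  have hV : (0 : E) ∈ arrVertices lam b := fun x _ => Subsingleton.elim x 0
  have h0 : u 0 - c ≠ 0 := sub_ne_zero.2 (hc.1 0 hV)
  refine ⟨affCompl lam b, fun _ => (starRingEnd ℂ) (u 0 - c) / ‖u 0 - c‖, fun _ x => x,
    subset_rfl, by rw [sdiff_self]; exact isOpen_empty,
    ⟨fun _ x => x, continuousOn_snd, fun _ _ => rfl, fun _ _ x hx => hx,
      fun x _ => Eventually.of_forall fun y => Subsingleton.elim y x⟩,
    fun x _ => ⟨norm_conj_div_norm h0, ?_, Eventually.of_forall fun _ => rfl⟩, ?_,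
    fun x hx => absurd hx.1 hx.2⟩
  · rw [Subsingleton.elim x 0, conj_div_norm_mul_self h0, Complex.ofReal_re]
    exact (hmV 0 hV).le
  · rw [sdiff_self, prod_empty]
    exact continuousOn_empty _

theorem hasSweep_of_finrank {n : ℕ} : ∀ {E ι : Type*} [NormedAddCommGroup E] [NormedSpace ℂ E]
    [FiniteDimensional ℂ E] [Fintype ι] {lam : ι → E →L[ℂ] ℂ} (b : ι → ℂ) {u : E →L[ℂ] ℂ},
    Module.finrank ℂ E = n → GenericFor lam u → HasSweep lam b u := by
  classical
  induction n with
  | zero =>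
    intro E ι _ _ _ _ lam b u hn _
    have : Subsingleton E := Module.finrank_zero_iff.1 hn
    exact hasSweep_of_subsingleton lam b u
  | succ n ih =>
    intro E ι _ _ _ _ lam b u hn hu
    have : Nontrivial E := Module.nontrivial_of_finrank_pos (R := ℂ) (by omega)
    obtain ⟨K, hK, hF⟩ := exists_transverse_field (b := b) hu
    refine ⟨2 * K, by positivity, fun c hc m hm hmV ε hε => ?_⟩
    exact exists_sweep_of_vertex_pairs isOpen_affCompl finite_arrVertices hK hF
      (fun p hp => sub_ne_zero.2 (hc.1 p hp)) hc.2
      (fun p hp κ₂ hκ₂ a ha => exists_vertex_pair hu hp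
        (fun J E' lam' b' u' hE' hu' => ih b' (by omega) hu') hκ₂ ha) hm hmV hε

end

section

open Set Filter Topology

theorem exists_genericFor {E ι : Type*} [NormedAddCommGroup E] [NormedSpace ℂ E]
    [FiniteDimensional ℂ E] [Fintype ι] (lam : ι → E →L[ℂ] ℂ) : ∃ u : E →L[ℂ] ℂ,
    GenericFor lam u := by
  classical
  have h : ∀ S : {S : Set ι // ¬ Separating lam S}, ∃ e : E, e ≠ 0 ∧ ∀ i ∈ S.1, lam i e = 0 := by
    rintro ⟨S, hS⟩
    simp only [Separating, not_forall] at hS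
    obtain ⟨e, he, h0⟩ := hS
    exact ⟨e, h0, he⟩
  choose e he0 he using h
  obtain ⟨f, hf⟩ := Module.exists_dual_forall_apply_ne_zero (K := ℂ) e he0
  refine ⟨LinearMap.toContinuousLinearMap f, fun S hS => ⟨(f (e ⟨S, hS⟩))⁻¹ • e ⟨S, hS⟩,
    fun i hi => ?_, ?_⟩⟩
  · rw [map_smul, he ⟨S, hS⟩ i hi, smul_zero]
  · change f _ = 1
    rw [map_smul, smul_eq_mul, inv_mul_cancel₀ (hf _)]

/-- Transport of a contraction along a section of a projection. -/
theorem ContractsIn.of_section {E E' : Type*} [TopologicalSpace E] [TopologicalSpace E']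
    {A' N' : Set E'} {B N : Set E} (h : ContractsIn A' N') {f : E → E'} {g : E' → E}
    (hf : Continuous f) (hg : Continuous g) (hfB : ∀ x ∈ B, f x ∈ A') (hgN : ∀ y ∈ N', g y ∈ N)
    (hgf : ∀ x ∈ B, g (f x) = x) : ContractsIn B N := by
  obtain ⟨K, k1, k2, k3, k4⟩ := h
  refine ⟨fun s x => g (K s (f x)), ?_, fun x hx => ?_, fun s hs x hx => ?_, fun x hx => ?_⟩
  · exact hg.comp_continuousOn (k1.comp (f := fun q : ℝ × E => (q.1, f q.2)) (by fun_prop)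
      fun q hq => ⟨hq.1, hfB _ hq.2⟩)
  · change g (K 0 (f x)) = x
    rw [k2 _ (hfB x hx), hgf x hx]
  · exact hgN _ (k3 s hs _ (hfB x hx))
  · have ht : Tendsto f (𝓝[B] x) (𝓝[A'] (f x)) :=
      tendsto_nhdsWithin_of_tendsto_nhds_of_eventually_within _
        (hf.continuousAt.mono_left nhdsWithin_le_nhds) (eventually_mem_nhdsWithin.mono hfB)
    filter_upwards [ht.eventually (k4 _ (hfB x hx))] with y hy
    rw [hy]

theorem IsLocallyClosed.inter_preimage_of_isOpen {X Y : Type*} [TopologicalSpace X]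
    [TopologicalSpace Y] {f : X → Y} {O : Set X} {A : Set Y} (hA : IsLocallyClosed A)
    (hf : ContinuousOn f O) (hO : IsOpen O) : IsLocallyClosed (O ∩ f ⁻¹' A) := by
  obtain ⟨U, F, hU, hF, rfl⟩ := hA
  refine ⟨O ∩ f ⁻¹' U, (O ∩ f ⁻¹' Fᶜ)ᶜ, hf.isOpen_inter_preimage hO hU,
    (hf.isOpen_inter_preimage hO hF.isOpen_compl).isClosed_compl, ?_⟩
  ext x
  simp only [mem_inter_iff, mem_preimage, mem_compl_iff]
  tauto

/-- The complement of an affine arrangement in dimension `n` is a union of `n + 1` locally closed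
sets, each of which contracts to a discrete set. -/
theorem exists_contracting_cover {n : ℕ} : ∀ {E ι : Type*} [NormedAddCommGroup E]
    [NormedSpace ℂ E] [FiniteDimensional ℂ E] [Fintype ι] (lam : ι → E →L[ℂ] ℂ) (b : ι → ℂ),
    Module.finrank ℂ E = n → ∃ A : Fin (n + 1) → Set E, affCompl lam b = ⋃ i, A i ∧
      ∀ i, IsLocallyClosed (A i) ∧ ContractsIn (A i) (affCompl lam b) := by
  classical
  induction n with
  | zero =>
    intro E ι _ _ _ _ lam b hn
    have : Subsingleton E := Module.finrank_zero_iff.1 hn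
    refine ⟨fun _ => affCompl lam b, (iUnion_const _).symm, fun _ =>
      ⟨isOpen_affCompl.isLocallyClosed, fun _ x => x, continuousOn_snd, fun _ _ => rfl,
        fun _ _ x hx => hx, fun x _ => Eventually.of_forall fun y => Subsingleton.elim y x⟩⟩
  | succ n ih =>
    intro E ι _ _ _ _ lam b hn
    have : Nontrivial E := Module.nontrivial_of_finrank_pos (R := ℂ) (by omega)
    obtain ⟨u, hu⟩ := exists_genericFor lam
    obtain ⟨e, -, he⟩ := hu ∅ fun h => by
      obtain ⟨x, hx⟩ := exists_ne (0 : E)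
      exact hx (h x fun i hi => absurd hi (notMem_empty i))
    obtain ⟨c, -, hc⟩ := exists_goodLevel lam b u 0 one_pos
    obtain ⟨m, hm, hmV⟩ := exists_pos_le_of_finite (finite_arrVertices (lam := lam) (b := b))
      (f := fun p => ‖u p - c‖) fun p hp => norm_pos_iff.2 (sub_ne_zero.2 (hc.1 p hp))
    obtain ⟨K, hK, hsw⟩ := hasSweep_of_finrank b hn hu
    obtain ⟨S, τ, G, hSN, hSo, hSc, -, hGc, hG⟩ := hsw c hc (m / 2) (by linarith)
      (fun p hp => by have := hmV p hp; linarith) 1 one_pos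
    have hrank : Module.finrank ℂ (LinearMap.ker (u : E →ₗ[ℂ] ℂ)) = n := by
      have h1 := LinearMap.finrank_range_add_finrank_ker (u : E →ₗ[ℂ] ℂ)
      have h2 : LinearMap.range (u : E →ₗ[ℂ] ℂ) = ⊤ := by
        rw [LinearMap.range_eq_top]
        intro z
        exact ⟨z • e, by change u (z • e) = z; rw [map_smul, he, smul_eq_mul, mul_one]⟩
      rw [h2, finrank_top, Module.finrank_self] at h1
      omega
    obtain ⟨A', hA'u, hA'⟩ := ih (fun i => (lam i).comp (LinearMap.ker (u : E →ₗ[ℂ] ℂ)).subtypeL)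
      (fun i => b i + lam i (c • e)) hrank
    let π : E → LinearMap.ker (u : E →ₗ[ℂ] ℂ) := fun x => ⟨x - u x • e, by
      rw [LinearMap.mem_ker]
      change u (x - u x • e) = 0
      rw [map_sub, map_smul, he, smul_eq_mul, mul_one, sub_self]⟩
    have hπc : Continuous π := Continuous.subtype_mk (by fun_prop) _
    let g : LinearMap.ker (u : E →ₗ[ℂ] ℂ) → E := fun y => y + c • e
    have hgc : Continuous g := by fun_prop
    have hgπ : ∀ x, u x = c → g (π x) = x := by
      intro x hx
      simp only [g, π, hx]
      abel
    have hgN : ∀ y, g y ∈ affCompl lam b ↔ y ∈ affCompl (fun i =>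
        (lam i).comp (LinearMap.ker (u : E →ₗ[ℂ] ℂ)).subtypeL)
        (fun i => b i + lam i (c • e)) := by
      intro y
      refine forall_congr' fun i => ?_
      change lam i (y + c • e) + b i ≠ 0 ↔ lam i y + (b i + lam i (c • e)) ≠ 0
      rw [map_add, add_assoc, add_comm (b i)]
    have hone : (1 : ℝ) ∈ Icc (0 : ℝ) 1 := ⟨zero_le_one, le_rfl⟩
    have hG1c : ContinuousOn (fun x => π (G 1 x)) (affCompl lam b \ S) :=
      hπc.comp_continuousOn (hGc.comp (f := fun x : E => ((1 : ℝ), x)) (by fun_prop)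
        fun x hx => ⟨hone, hx⟩)
    refine ⟨Fin.snoc (fun i => (affCompl lam b \ S) ∩ (fun x => π (G 1 x)) ⁻¹' A' i) S, ?_, ?_⟩
    · ext x
      rw [mem_iUnion]
      constructor
      · intro hx
        by_cases hxS : x ∈ S
        · exact ⟨Fin.last _, by rwa [Fin.snoc_last]⟩
        · have h1 : π (G 1 x) ∈ ⋃ i, A' i := by
            rw [← hA'u, ← hgN, hgπ _ (hG x ⟨hx, hxS⟩).2.1]
            exact ((hG x ⟨hx, hxS⟩).2.2 1 hone).1
          obtain ⟨i, hi⟩ := mem_iUnion.1 h1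
          exact ⟨i.castSucc, by rw [Fin.snoc_castSucc]; exact ⟨⟨hx, hxS⟩, hi⟩⟩
      · rintro ⟨i, hi⟩
        induction i using Fin.lastCases with
        | last => rw [Fin.snoc_last] at hi; exact hSN hi
        | cast i => rw [Fin.snoc_castSucc] at hi; exact hi.1.1
    · intro i
      induction i using Fin.lastCases with
      | last =>
        rw [Fin.snoc_last]
        refine ⟨⟨affCompl lam b, (affCompl lam b \ S)ᶜ, isOpen_affCompl, hSo.isClosed_compl, ?_⟩,
          hSc⟩
        ext x
        have := @hSN x
        simp only [mem_inter_iff, mem_compl_iff, Set.mem_sdiff]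
        tauto
      | cast i =>
        rw [Fin.snoc_castSucc]
        refine ⟨(hA' i).1.inter_preimage_of_isOpen hG1c hSo, ?_⟩
        refine ContractsIn.of_deform (B := {x | u x = c ∧ π x ∈ A' i})
          ((hA' i).2.of_section hπc hgc (fun x hx => hx.2) (fun y hy => (hgN y).2 hy)
            fun x hx => hgπ x hx.1) (hGc.mono (prod_mono_right inter_subset_left))
          (fun x hx => (hG x hx.1).1) (fun s hs x hx => ((hG x hx.1).2.2 s hs).1)
          fun x hx => ⟨(hG x hx.1).2.1, hx.2⟩

end

section

open Set Filter Topology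
open scoped unitInterval

universe u v

/-- A homotopy over a locally closed set extends to an open neighbourhood, for maps into an open
subset of a Tietze space. -/
theorem exists_isOpen_homotopic {X : Type v} {Y : Type u} [NormedAddCommGroup X] [NormedSpace ℝ X]
    [TietzeExtension.{u} X] [TopologicalSpace Y] [TopologicalSpace.MetrizableSpace Y]
    {p : X → Prop} (hp : IsOpen {x | p x}) {B : Set Y} (hB : IsLocallyClosed B)
    (f g : C(Y, {x // p x})) (h : (f.restrict B).Homotopic (g.restrict B)) :
    ∃ U : Set Y, IsOpen U ∧ B ⊆ U ∧ (f.restrict U).Homotopic (g.restrict U) := by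
  obtain ⟨O, F, hO, hF, rfl⟩ := hB
  obtain ⟨H⟩ := h
  let j : I × ↥(O ∩ F) → I × O := fun q => (q.1, ⟨q.2.1, q.2.2.1⟩)
  have hi : IsClosedEmbedding (inclusion (inter_subset_left : O ∩ F ⊆ O)) := by
    refine ⟨IsEmbedding.inclusion inter_subset_left, ?_⟩
    rw [range_inclusion]
    have : {x : O | (x : Y) ∈ O ∩ F} = Subtype.val ⁻¹' F := by
      ext ⟨x, hx⟩
      exact ⟨fun h => h.2, fun h => ⟨hx, h⟩⟩
    exact this ▸ hF.preimage continuous_subtype_val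
  have hj : IsClosedEmbedding j := IsClosedEmbedding.id.prodMap hi
  obtain ⟨E, hE⟩ := ContinuousMap.exists_extension hj
    (⟨fun q => (H q : X), by fun_prop⟩ : C(I × ↥(O ∩ F), X))
  have hE' : ∀ q : I × ↥(O ∩ F), E (j q) = (H q : X) := fun q => DFunLike.congr_fun hE q
  let T : I × O → X := fun q => E q + (1 - q.1 : ℝ) • ((f q.2 : X) - E (0, q.2)) +
    (q.1 : ℝ) • ((g q.2 : X) - E (1, q.2))
  have hT : Continuous T := by fun_prop
  have hT0 : ∀ y, T (0, y) = f y := fun y => by simp [T]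
  have hT1 : ∀ y, T (1, y) = g y := fun y => by simp [T]
  have hTB : ∀ q : I × ↥(O ∩ F), T (j q) = H q := by
    intro q
    have h0 : E (0, (j q).2) = f q.2 := by
      have := hE' (0, q.2)
      rw [H.apply_zero] at this
      exact this
    have h1 : E (1, (j q).2) = g q.2 := by
      have := hE' (1, q.2)
      rw [H.apply_one] at this
      exact this
    simp only [T]
    rw [h0, h1, hE']
    simp [j]
  have hU : IsOpen {y : O | ∀ t, p (T (t, y))} := by
    have h1 : IsClosed (T ⁻¹' {x | p x}ᶜ) := hp.isClosed_compl.preimage hT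
    have h2 := isClosedMap_snd_of_compactSpace _ h1
    rw [← isClosed_compl_iff]
    convert h2 using 1
    ext y
    constructor
    · intro hy
      by_contra hn
      exact hy fun t => by
        by_contra ht
        exact hn ⟨(t, y), ht, rfl⟩
    · rintro ⟨q, hq, rfl⟩ hy
      exact hq (hy q.1)
  refine ⟨Subtype.val '' {y : O | ∀ t, p (T (t, y))}, hO.isOpenMap_subtype_val _ hU, ?_, ?_⟩
  · intro y hy
    refine ⟨⟨y, hy.1⟩, fun t => ?_, rfl⟩
    rw [show T (t, ⟨y, hy.1⟩) = H (t, ⟨y, hy⟩) from hTB (t, ⟨y, hy⟩)]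
    exact (H _).2
  · have hUO : ∀ y : ↥(Subtype.val '' {y : O | ∀ t, p (T (t, y))}), y.1 ∈ O := by
      rintro ⟨_, y, -, rfl⟩
      exact y.2
    have hUp : ∀ (y : ↥(Subtype.val '' {y : O | ∀ t, p (T (t, y))})) t,
        p (T (t, ⟨y, hUO y⟩)) := by
      rintro ⟨_, y, hy, rfl⟩ t
      exact hy t
    exact ⟨{
      toFun := fun q => ⟨T (q.1, ⟨q.2, hUO q.2⟩), hUp q.2 q.1⟩
      continuous_toFun := Continuous.subtype_mk (hT.comp (continuous_fst.prodMk
        (Continuous.subtype_mk (by fun_prop) _))) _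
      map_zero_left := fun y => Subtype.ext (hT0 _)
      map_one_left := fun y => Subtype.ext (hT1 _) }⟩

theorem hasMotionPlanningSection_of_homotopic {X : Type*} [TopologicalSpace X] {U : Set (X × X)}
    (h : ((ContinuousMap.fst : C(X × X, X)).restrict U).Homotopic
      ((ContinuousMap.snd : C(X × X, X)).restrict U)) : HasMotionPlanningSection X U := by
  obtain ⟨H⟩ := h
  refine ⟨(H.toContinuousMap.comp ContinuousMap.prodSwap).curry, fun p => ⟨?_, ?_⟩⟩
  · exact H.apply_zero p
  · exact H.apply_one p

/-- Motion planners over locally closed pieces give a cover by open sets. -/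
theorem hasTCCover_of_isLocallyClosed {X : Type u} [NormedAddCommGroup X] [NormedSpace ℝ X]
    [TietzeExtension.{u} X] {p : X → Prop} (hp : IsOpen {x | p x}) {k : ℕ}
    (B : Fin k → Set ({x // p x} × {x // p x})) (hB : ∀ i, IsLocallyClosed (B i))
    (hBu : ∀ q, ∃ i, q ∈ B i)
    (h : ∀ i, (ContinuousMap.fst.restrict (B i)).Homotopic (ContinuousMap.snd.restrict (B i))) :
    HasTCCover {x // p x} k := by
  choose U hU hBU hUh using fun i => exists_isOpen_homotopic hp (hB i) _ _ (h i)
  refine ⟨U, hU, ?_, fun i => hasMotionPlanningSection_of_homotopic (hUh i)⟩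
  rw [eq_univ_iff_forall]
  intro q
  obtain ⟨i, hi⟩ := hBu q
  exact mem_iUnion.2 ⟨i, hBU i hi⟩

end

section

open Set Filter Topology
open scoped unitInterval

universe u

theorem exists_path_compl_hyperplanes {X ι : Type*} [NormedAddCommGroup X] [NormedSpace ℂ X]
    [Finite ι] (a : ι → X →L[ℂ] ℂ) {x y : X} (hx : ∀ i, a i x ≠ 0) (hy : ∀ i, a i y ≠ 0) :
    ∃ γ : C(I, X), γ 0 = x ∧ γ 1 = y ∧ ∀ t i, a i (γ t) ≠ 0 := by
  let Bad : Set ℂ := ⋃ i, {z | a i (x + z • (y - x)) = 0}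
  have hBad : Bad.Countable := by
    refine countable_iUnion fun i => Set.Subsingleton.countable fun z hz z' hz' => ?_
    have h1 : a i (x + z • (y - x)) = 0 := hz
    have h2 : a i (x + z' • (y - x)) = 0 := hz'
    rw [map_add, map_smul, smul_eq_mul] at h1 h2
    have h3 : (z - z') * a i (y - x) = 0 := by linear_combination h1 - h2
    rcases mul_eq_zero.1 h3 with h | h
    · exact sub_eq_zero.1 h
    · rw [h, mul_zero, add_zero] at h1
      exact absurd h1 (hx i)
  have hmem : ∀ z : ℂ, z ∈ Badᶜ ↔ ∀ i, a i (x + z • (y - x)) ≠ 0 := by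
    intro z
    simp [Bad]
  obtain ⟨γ, hγ⟩ := (hBad.isPathConnected_compl_of_one_lt_rank
    (by rw [Complex.rank_real_complex]; exact Cardinal.one_lt_two)).joinedIn 0
    ((hmem 0).2 fun i => by rw [zero_smul, add_zero]; exact hx i) 1
    ((hmem 1).2 fun i => by rw [one_smul, add_sub_cancel]; exact hy i)
  refine ⟨⟨fun t => x + γ t • (y - x), by fun_prop⟩, ?_, ?_, fun t => (hmem _).1 (hγ t)⟩
  · change x + γ 0 • (y - x) = x
    rw [γ.source, zero_smul, add_zero]
  · change x + γ 1 • (y - x) = y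
    rw [γ.target, one_smul, add_sub_cancel]

theorem ContinuousMap.homotopic_of_subtype {X B : Type*} [TopologicalSpace X] [TopologicalSpace B]
    {p : X → Prop} {f g : C(B, {x // p x})} {T : I × B → X} (hT : Continuous T)
    (hp : ∀ q, p (T q)) (h0 : ∀ b, T (0, b) = f b) (h1 : ∀ b, T (1, b) = g b) :
    f.Homotopic g :=
  ⟨{ toFun := fun q => ⟨T q, hp q⟩
     continuous_toFun := hT.subtype_mk _
     map_zero_left := fun b => Subtype.ext (h0 b)
     map_one_left := fun b => Subtype.ext (h1 b) }⟩

/-- The complement of the zero sets of a family of functionals. -/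
abbrev HyperplaneCompl {X ι : Type*} [NormedAddCommGroup X] [NormedSpace ℂ X]
    (a : ι → X →L[ℂ] ℂ) := {x : X // ∀ i, a i x ≠ 0}

theorem hasTCCover_compl_hyperplanes {X ι : Type u} [NormedAddCommGroup X] [NormedSpace ℂ X]
    [TietzeExtension.{u} X] [Fintype ι] {q : ℕ} (a : ι → X →L[ℂ] ℂ) (F : Fin (q + 1) → ι)
    (w : Fin (q + 1) → X) (hspan : ∀ h x, a h x = ∑ i, a (F i) x * a h (w i)) :
    HasTCCover (HyperplaneCompl a) (2 * (q + 1)) := by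
  classical
  let _ : NormedSpace ℝ X := NormedSpace.restrictScalars ℝ ℂ X
  let L₁ : (Fin q → ℂ) →L[ℂ] X :=
    ∑ i, (ContinuousLinearMap.proj (R := ℂ) (φ := fun _ : Fin q => ℂ) i).smulRight (w i.succ)
  let L₂ : (Fin (q + 1) → ℂ) →L[ℂ] X :=
    ∑ i, (ContinuousLinearMap.proj (R := ℂ) (φ := fun _ : Fin (q + 1) => ℂ) i).smulRight (w i)
  have hL₁ : ∀ z, L₁ z = ∑ i, z i • w i.succ := fun z => by
    simp [L₁]
  have hL₂ : ∀ z, L₂ z = ∑ i, z i • w i := fun z => by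
    simp [L₂]
  let lam : ι ⊕ ι → (Fin q → ℂ) × (Fin (q + 1) → ℂ) →L[ℂ] ℂ :=
    Sum.elim (fun h => (a h).comp (L₁.comp (ContinuousLinearMap.fst ℂ _ _)))
      (fun h => (a h).comp (L₂.comp (ContinuousLinearMap.snd ℂ _ _)))
  let b : ι ⊕ ι → ℂ := Sum.elim (fun h => a h (w 0)) 0
  let j₁ : (Fin q → ℂ) × (Fin (q + 1) → ℂ) → X := fun e => w 0 + L₁ e.1
  let j₂ : (Fin q → ℂ) × (Fin (q + 1) → ℂ) → X := fun e => L₂ e.2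
  have hj₁c : Continuous j₁ := by fun_prop
  have hj₂c : Continuous j₂ := by fun_prop
  have hj₁ : ∀ e ∈ affCompl lam b, ∀ h, a h (j₁ e) ≠ 0 := by
    intro e he h
    rw [map_add, add_comm]
    exact he (Sum.inl h)
  have hj₂ : ∀ e ∈ affCompl lam b, ∀ h, a h (j₂ e) ≠ 0 := by
    intro e he h
    have h1 := he (Sum.inr h)
    change a h (L₂ e.2) + 0 ≠ 0 at h1
    rwa [add_zero] at h1
  obtain ⟨A, hAu, hA⟩ := exists_contracting_cover (n := 2 * q + 1) lam b (by
    rw [Module.finrank_prod, Module.finrank_fin_fun, Module.finrank_fin_fun]; omega)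
  let s : HyperplaneCompl a × HyperplaneCompl a → ℂ := fun v => a (F 0) v.1
  have hsc : Continuous s := by fun_prop
  have hs0 : ∀ v, s v ≠ 0 := fun v => v.1.2 _
  let R : X → X := fun x => L₂ fun i => a (F i) x
  have hRc : Continuous R := by fun_prop
  have hR : ∀ h x, a h (R x) = a h x := by
    intro h x
    rw [hspan h x]
    simp only [R, hL₂, map_sum, map_smul, smul_eq_mul]
  let β : HyperplaneCompl a × HyperplaneCompl a → (Fin q → ℂ) × (Fin (q + 1) → ℂ) := fun v =>
    (fun i => (s v)⁻¹ * a (F i.succ) v.1, (s v)⁻¹ • fun i => a (F i) v.2)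
  have hβc : Continuous β := by
    have h1 : Continuous fun v => (s v)⁻¹ := hsc.inv₀ hs0
    fun_prop
  have hβ₁ : ∀ v : HyperplaneCompl a × HyperplaneCompl a, s v • j₁ (β v) = R v.1 := by
    intro v
    simp only [j₁, R, hL₁, hL₂, β, smul_add, Finset.smul_sum, Fin.sum_univ_succ, smul_smul,
      mul_inv_cancel_left₀ (hs0 v)]
    rfl
  have hβ₂ : ∀ v : HyperplaneCompl a × HyperplaneCompl a, s v • j₂ (β v) = R v.2 := by
    intro v
    simp only [j₂, R, β, map_smul, smul_smul, mul_inv_cancel₀ (hs0 v), one_smul]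
  have hβN : ∀ v, β v ∈ affCompl lam b := by
    rintro v (h | h)
    · change a h (L₁ (β v).1) + a h (w 0) ≠ 0
      rw [add_comm, ← map_add]
      intro h0
      have h1 := hR h v.1
      rw [← hβ₁ v, map_smul] at h1
      rw [show a h (j₁ (β v)) = 0 from h0, smul_zero] at h1
      exact v.1.2 h h1.symm
    · change a h (L₂ (β v).2) + 0 ≠ 0
      rw [add_zero]
      intro h0
      have h1 := hR h v.2
      rw [← hβ₂ v, map_smul] at h1
      rw [show a h (j₂ (β v)) = 0 from h0, smul_zero] at h1
      exact v.2.2 h h1.symm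
  have hsmul : ∀ v x, (∀ h, a h x ≠ 0) → ∀ h, a h (s v • x) ≠ 0 := fun v x hx h => by
    rw [map_smul]
    exact mul_ne_zero (hs0 v) (hx h)
  have hRM : ∀ x : HyperplaneCompl a, ∀ h, a h (R x) ≠ 0 := fun x h => by rw [hR]; exact x.2 h
  have hopen : IsOpen {x : X | ∀ i, a i x ≠ 0} := by
    have : {x : X | ∀ i, a i x ≠ 0} = ⋂ i, {x | a i x ≠ 0} := by ext; simp
    rw [this]
    exact isOpen_iInter_of_finite fun i => isOpen_ne_fun (by fun_prop) continuous_const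
  have hseg : ∀ x : HyperplaneCompl a, ∀ t : I, ∀ h, a h (x + ((t : ℝ) : ℂ) • (R x - x)) ≠ 0 := by
    intro x t h
    rw [map_add, map_smul, map_sub, hR, sub_self, smul_zero, add_zero]
    exact x.2 h
  have hγ : ∀ e, ∃ γ : C(I, X), e ∈ affCompl lam b → γ 0 = j₁ e ∧ γ 1 = j₂ e ∧
      ∀ t i, a i (γ t) ≠ 0 := by
    intro e
    by_cases he : e ∈ affCompl lam b
    · obtain ⟨γ, hγ⟩ := exists_path_compl_hyperplanes a (hj₁ e he) (hj₂ e he)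
      exact ⟨γ, fun _ => hγ⟩
    · exact ⟨ContinuousMap.const _ 0, fun h => absurd h he⟩
  choose γ hγ using hγ
  refine hasTCCover_of_isLocallyClosed hopen (fun i => β ⁻¹' A i)
    (fun i => (hA i).1.preimage hβc) (fun v => ?_) fun i => ?_
  · have := hβN v
    rw [hAu, mem_iUnion] at this
    exact this
  · obtain ⟨-, K, hKc, hK0, hKN, hK1⟩ := hA i
    have hone : (1 : ℝ) ∈ Icc (0 : ℝ) 1 := ⟨zero_le_one, le_rfl⟩
    have hKc' : Continuous fun v : I × ↥(β ⁻¹' A i) => K v.1 (β v.2) :=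
      hKc.comp_continuous (f := fun v : I × ↥(β ⁻¹' A i) => ((v.1 : ℝ), β v.2)) (by fun_prop)
        fun v => ⟨v.1.2, v.2.2⟩
    have hKN' : ∀ v : I × ↥(β ⁻¹' A i), K v.1 (β v.2) ∈ affCompl lam b :=
      fun v => hKN _ v.1.2 _ v.2.2
    have hK1c : Continuous fun v : ↥(β ⁻¹' A i) => K 1 (β v) :=
      hKc'.comp (f := fun v => ((1 : I), v)) (by fun_prop)
    have hK1N : ∀ v : ↥(β ⁻¹' A i), K 1 (β v) ∈ affCompl lam b := fun v => hKN' (1, v)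
    have hloc : ∀ v : ↥(β ⁻¹' A i), ∀ᶠ v' : ↥(β ⁻¹' A i) in 𝓝 v,
        K 1 (β v') = K 1 (β v) := by
      intro v
      have ht : Tendsto (fun v : ↥(β ⁻¹' A i) => β v) (𝓝 v) (𝓝[A i] (β v)) :=
        tendsto_nhdsWithin_of_tendsto_nhds_of_eventually_within _
          (hβc.comp continuous_subtype_val).continuousAt (Eventually.of_forall fun v => v.2)
      exact ht.eventually (hK1 _ v.2)
    let f₁ : C(↥(β ⁻¹' A i), HyperplaneCompl a) := ⟨fun v => ⟨R v.1.1, hRM _⟩,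
      (hRc.comp (by fun_prop)).subtype_mk _⟩
    let f₂ : C(↥(β ⁻¹' A i), HyperplaneCompl a) := ⟨fun v => ⟨s v • j₁ (K 1 (β v)),
      hsmul _ _ (hj₁ _ (hK1N v))⟩,
      ((hsc.comp continuous_subtype_val).smul (hj₁c.comp hK1c)).subtype_mk _⟩
    let f₃ : C(↥(β ⁻¹' A i), HyperplaneCompl a) := ⟨fun v => ⟨s v • j₂ (K 1 (β v)),
      hsmul _ _ (hj₂ _ (hK1N v))⟩,
      ((hsc.comp continuous_subtype_val).smul (hj₂c.comp hK1c)).subtype_mk _⟩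
    let f₄ : C(↥(β ⁻¹' A i), HyperplaneCompl a) := ⟨fun v => ⟨R v.1.2, hRM _⟩,
      (hRc.comp (by fun_prop)).subtype_mk _⟩
    have h₁ : (ContinuousMap.fst.restrict (β ⁻¹' A i)).Homotopic f₁ := by
      refine ContinuousMap.homotopic_of_subtype
        (T := fun v => (v.2.1.1 : X) + ((v.1 : ℝ) : ℂ) • (R v.2.1.1 - v.2.1.1))
        ((show Continuous fun v : I × ↥(β ⁻¹' A i) => (v.2.1.1 : X) by fun_prop).add
          ((show Continuous fun v : I × ↥(β ⁻¹' A i) => ((v.1 : ℝ) : ℂ) by fun_prop).smul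
            ((hRc.comp (by fun_prop)).sub (by fun_prop))))
        (fun v => hseg _ _) (fun v => ?_) fun v => ?_
      · simp
      · simp [f₁]
    have h₂ : f₁.Homotopic f₂ := by
      refine ContinuousMap.homotopic_of_subtype
        (T := fun v => s v.2 • j₁ (K v.1 (β v.2)))
        ((hsc.comp (by fun_prop)).smul (hj₁c.comp hKc'))
        (fun v => hsmul _ _ (hj₁ _ (hKN' v))) (fun v => ?_) fun v => ?_
      · change s v • j₁ (K 0 (β v)) = R v.1.1
        rw [hK0 _ v.2, hβ₁]
      · rfl
    have h₃ : f₂.Homotopic f₃ := by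
      have hc : Continuous fun v : I × ↥(β ⁻¹' A i) => γ (K 1 (β v.2)) v.1 := by
        refine continuous_iff_continuousAt.2 fun v => ?_
        have h1 : ContinuousAt (fun v' : I × ↥(β ⁻¹' A i) => γ (K 1 (β v.2)) v'.1) v := by
          fun_prop
        refine h1.congr ?_
        filter_upwards [continuous_snd.continuousAt.eventually (hloc v.2)] with v' hv'
        rw [hv']
      refine ContinuousMap.homotopic_of_subtype
        (T := fun v => s v.2 • γ (K 1 (β v.2)) v.1)
        ((hsc.comp (by fun_prop)).smul hc)
        (fun v => hsmul _ _ ((hγ _ (hK1N v.2)).2.2 v.1)) (fun v => ?_) fun v => ?_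
      · change s v • γ (K 1 (β v)) 0 = s v • j₁ (K 1 (β v))
        rw [(hγ _ (hK1N v)).1]
      · change s v • γ (K 1 (β v)) 1 = s v • j₂ (K 1 (β v))
        rw [(hγ _ (hK1N v)).2.1]
    have h₄ : f₄.Homotopic f₃ := by
      refine ContinuousMap.homotopic_of_subtype
        (T := fun v => s v.2 • j₂ (K v.1 (β v.2)))
        ((hsc.comp (by fun_prop)).smul (hj₂c.comp hKc'))
        (fun v => hsmul _ _ (hj₂ _ (hKN' v))) (fun v => ?_) fun v => ?_
      · change s v • j₂ (K 0 (β v)) = R v.1.2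
        rw [hK0 _ v.2, hβ₂]
      · rfl
    have h₅ : (ContinuousMap.snd.restrict (β ⁻¹' A i)).Homotopic f₄ := by
      refine ContinuousMap.homotopic_of_subtype
        (T := fun v => (v.2.1.2 : X) + ((v.1 : ℝ) : ℂ) • (R v.2.1.2 - v.2.1.2))
        ((show Continuous fun v : I × ↥(β ⁻¹' A i) => (v.2.1.2 : X) by fun_prop).add
          ((show Continuous fun v : I × ↥(β ⁻¹' A i) => ((v.1 : ℝ) : ℂ) by fun_prop).smul
            ((hRc.comp (by fun_prop)).sub (by fun_prop))))
        (fun v => hseg _ _) (fun v => ?_) fun v => ?_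
      · simp
      · simp [f₄]
    exact ((h₁.trans h₂).trans h₃).trans (h₅.trans h₄).symm

end

section

open Set

theorem hasTCCover_subtype_congr {X : Type*} [TopologicalSpace X] {p p' : X → Prop} {k : ℕ}
    (hp : p = p') (h : HasTCCover {x // p x} k) : HasTCCover {x // p' x} k := by
  subst hp
  exact h

theorem hasTCCover_arrComplement {ℓ : ℕ} (𝒜 : Finset (Submodule ℂ (Fin ℓ → ℂ)))
    (α : 𝒜 → ((Fin ℓ → ℂ) →ₗ[ℂ] ℂ))
    (hα : ∀ H : 𝒜, α H ≠ 0 ∧ (H : Submodule ℂ (Fin ℓ → ℂ)) = LinearMap.ker (α H))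
    (q : ℕ) (hr : q + 1 = Module.finrank ℂ (Submodule.span ℂ (Set.range α)))
    (F : Fin (q + 1) → 𝒜) (hindF : LinearIndependent ℂ (fun i => α (F i))) :
    HasTCCover (ArrComplement 𝒜) (2 * (q + 1)) := by
  obtain ⟨w, hw⟩ := exists_dual_family _ hindF
  have hspan : Submodule.span ℂ (range fun i => α (F i)) = Submodule.span ℂ (range α) := by
    refine Submodule.eq_of_le_of_finrank_eq (Submodule.span_mono ?_) ?_
    · rintro _ ⟨i, rfl⟩
      exact ⟨F i, rfl⟩
    · rw [← hr, finrank_span_eq_card hindF, Fintype.card_fin]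
  have hexp : ∀ h x, α h x = ∑ i, α (F i) x * α h (w i) := by
    intro h x
    have hmem : α h ∈ Submodule.span ℂ (range fun i => α (F i)) := by
      rw [hspan]
      exact Submodule.subset_span ⟨h, rfl⟩
    obtain ⟨c, hc⟩ := (Submodule.mem_span_range_iff_exists_fun ℂ).1 hmem
    rw [← hc]
    simp [hw, mul_comm]
  have hcov : HasTCCover {x : Fin ℓ → ℂ // ∀ h : 𝒜,
      LinearMap.toContinuousLinearMap (α h) x ≠ 0} (2 * (q + 1)) := hasTCCover_compl_hyperplanes
    (fun h : 𝒜 => LinearMap.toContinuousLinearMap (α h)) F w hexp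
  have hp : (fun x : Fin ℓ → ℂ => ∀ h : 𝒜, LinearMap.toContinuousLinearMap (α h) x ≠ 0) =
      fun x => ∀ H ∈ 𝒜, x ∉ H := by
    funext x
    refine propext ⟨fun h H hH hx => h ⟨H, hH⟩ ?_, fun h H hx => h H H.2 ?_⟩
    · have : x ∈ LinearMap.ker (α ⟨H, hH⟩) := (hα ⟨H, hH⟩).2 ▸ hx
      exact this
    · rw [(hα H).2]
      exact hx
  exact hasTCCover_subtype_congr hp hcov

end

/-- let `𝒜` be a central complex hyperplane arrangement of rank `r ≥ 1`
containing `2r - 1` distinct hyperplanes `F 0, …, F (r-1), G 0, …, G (r-2)` such that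
`F 0, …, F (r-1)` are independent and, for each `j`, the set
`{F j, G 0, …, G (r-2)}` is independent.  Then `TC(M(𝒜)) = 2r`. -/
theorem tc_arrangement_complement_eq (ℓ : ℕ) (𝒜 : Finset (Submodule ℂ (Fin ℓ → ℂ)))
    (α : 𝒜 → ((Fin ℓ → ℂ) →ₗ[ℂ] ℂ))
    (hα : ∀ H : 𝒜, α H ≠ 0 ∧ (H : Submodule ℂ (Fin ℓ → ℂ)) = LinearMap.ker (α H))
    (r : ℕ) (hr : r = Module.finrank ℂ (Submodule.span ℂ (Set.range α)))
    (hr1 : 0 < r)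
    (F : Fin r → 𝒜) (G : Fin (r - 1) → 𝒜)
    (hdistinct : Function.Injective (Sum.elim F G : Fin r ⊕ Fin (r - 1) → 𝒜))
    (hindF : LinearIndependent ℂ (fun i => α (F i)))
    (hindG : ∀ j : Fin r, LinearIndependent ℂ
      (Sum.elim (fun _ : Unit => α (F j)) (fun i => α (G i)))) :
    TopComplexity (ArrComplement 𝒜) = (2 * r : ℕ) := by
  obtain ⟨q, rfl⟩ : ∃ q, r = q + 1 := ⟨r - 1, by omega⟩
  refine le_antisymm (sInf_le ⟨_, rfl, hasTCCover_arrComplement 𝒜 α hα q hr F hindF⟩)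
    (le_sInf ?_)
  rintro _ ⟨k, rfl, hk⟩
  exact_mod_cast le_of_hasTCCover_arrComplement 𝒜 α hα q hr F G hindF hindG hk
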